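/- arXiv:2405.07953 — 2 statements merged into one kernel-verified Lean document; each statement's English description precedes it below -/
import Mathlib

section
/- Let ρ₁, ρ₂ be real algebraic numbers with ρ₁ > 1 and ρ₂ > 1, and let c₁, c₂ be nonzero real algebraic numbers. Then there exists a real constant C > 0 such that for all natural numbers n₁, n₂: if c₁·ρ₁^{n₁} + c₂·ρ₂^{n₂} ≠ 0, then |c₁·ρ₁^{n₁} + c₂·ρ₂^{n₂}| > ρ₁^{n₁}/(n₁+2)^C and |c₁·ρ₁^{n₁} + c₂·ρ₂^{n₂}| > ρ₂^{n₂}/(n₂+2)^C. -/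
/-- Liouville inequality for integer polynomial expressions in three real algebraic numbers. -/
theorem bk_liouville (a : Fin 3 → ℝ) (ha : ∀ j, IsAlgebraic ℚ (a j)) :
    ∃ c d : ℕ, 1 ≤ c ∧ 1 ≤ d ∧ ∀ (ι : Type) (s : Finset ι) (k : ι → ℤ) (e : ι → Fin 3 → ℕ)
      (D : ℕ) (H : ℝ), 1 ≤ H → (∀ i ∈ s, ∀ j, e i j ≤ D) → ∑ i ∈ s, |(k i : ℝ)| ≤ H →
      (∑ i ∈ s, (k i : ℝ) * ∏ j, a j ^ e i j) ≠ 0 →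
      1 ≤ |∑ i ∈ s, (k i : ℝ) * ∏ j, a j ^ e i j| * (H ^ d * (c : ℝ) ^ D) := by
  classical
  let K := IntermediateField.adjoin ℚ (Set.range a)
  haveI : FiniteDimensional ℚ K := by
    apply IntermediateField.finiteDimensional_adjoin
    rintro _ ⟨j, rfl⟩
    exact (ha j).isIntegral
  let a' : Fin 3 → K := fun j => ⟨a j, IntermediateField.subset_adjoin ℚ _ ⟨j, rfl⟩⟩
  have hq : ∀ j, ∃ y : ℤ, y ≠ 0 ∧ IsIntegral ℤ ((y : K) * a' j) := by
    intro j
    have h1 : IsAlgebraic ℚ (a' j) := Algebra.IsAlgebraic.isAlgebraic _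
    have h2 : IsAlgebraic ℤ (a' j) := (IsFractionRing.isAlgebraic_iff ℤ ℚ K).mpr h1
    obtain ⟨y, hy, hy2⟩ := h2.exists_integral_multiple
    exact ⟨y, hy, by simpa [zsmul_eq_mul] using hy2⟩
  choose y hy hyint using hq
  let q : ℤ := ∏ j, y j
  have hq0 : q ≠ 0 := Finset.prod_ne_zero_iff.mpr fun j _ => hy j
  have hqint : ∀ j, IsIntegral ℤ ((q : K) * a' j) := by
    intro j
    have : (q : K) * a' j = ((∏ i ∈ Finset.univ.erase j, y i : ℤ) : K) * ((y j : K) * a' j) := by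
      have : q = (∏ i ∈ Finset.univ.erase j, y i) * y j := by
        rw [Finset.prod_erase_mul _ _ (Finset.mem_univ j)]
      rw [this]; push_cast; ring
    rw [this]
    exact IsIntegral.mul (isIntegral_algebraMap (R := ℤ) (A := K)) (hyint j)
  -- bound for all conjugates
  obtain ⟨M, hM1, hM⟩ : ∃ M : ℝ, 1 ≤ M ∧ ∀ (σ : K →ₐ[ℚ] ℂ) j, ‖σ (a' j)‖ ≤ M := by
    refine ⟨1 + ∑ σ : K →ₐ[ℚ] ℂ, ∑ j, ‖σ (a' j)‖, ?_, ?_⟩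
    · have : 0 ≤ ∑ σ : K →ₐ[ℚ] ℂ, ∑ j, ‖σ (a' j)‖ := by positivity
      linarith
    · intro σ j
      have h1 : ‖σ (a' j)‖ ≤ ∑ j, ‖σ (a' j)‖ :=
        Finset.single_le_sum (f := fun j => ‖σ (a' j)‖) (fun _ _ => norm_nonneg _)
          (Finset.mem_univ j)
      have h2 : ∑ j, ‖σ (a' j)‖ ≤ ∑ σ : K →ₐ[ℚ] ℂ, ∑ j, ‖σ (a' j)‖ :=
        Finset.single_le_sum (f := fun σ : K →ₐ[ℚ] ℂ => ∑ j, ‖σ (a' j)‖)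
          (fun _ _ => by positivity) (Finset.mem_univ σ)
      linarith
  let σ₀ : K →ₐ[ℚ] ℂ := (Complex.ofRealAm.restrictScalars ℚ).comp K.val
  have hσ₀ : ∀ x : K, ‖σ₀ x‖ = |(x : ℝ)| := by
    intro x
    change ‖((x : ℝ) : ℂ)‖ = _
    simp
  let G : ℝ := |(q : ℝ)| * M
  have hqabs : 1 ≤ |(q : ℝ)| := by
    exact_mod_cast Int.one_le_abs hq0
  have hG : 1 ≤ G := one_le_mul_of_one_le_of_one_le hqabs hM1
  let d := Fintype.card (K →ₐ[ℚ] ℂ)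
  have hd : 1 ≤ d := Fintype.card_pos_iff.mpr ⟨σ₀⟩
  refine ⟨⌈G ^ (3 * d)⌉₊, d, ?_, hd, ?_⟩
  · exact Nat.one_le_ceil_iff.mpr (by positivity)
  intro ι s k e D H hH he hk hne
  let ξ : K := ∑ i ∈ s, (k i : K) * ∏ j, a' j ^ e i j
  have hξ : (ξ : ℝ) = ∑ i ∈ s, (k i : ℝ) * ∏ j, a j ^ e i j := by
    change K.val ξ = _
    simp only [ξ, map_sum, map_mul, map_prod, map_pow, map_intCast]
    rfl
  rw [← hξ] at hne ⊢
  have hξ0 : ξ ≠ 0 := by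
    intro h; apply hne; rw [h]; rfl
  let x : K := (q : K) ^ (3 * D) * ξ
  have hx0 : x ≠ 0 := mul_ne_zero (pow_ne_zero _ (by exact_mod_cast hq0)) hξ0
  have hxint : IsIntegral ℤ x := by
    have : x = ∑ i ∈ s, ((k i * ∏ j, q ^ (D - e i j) : ℤ) : K) * ∏ j, ((q : K) * a' j) ^ e i j := by
      simp only [x, ξ, Finset.mul_sum]
      refine Finset.sum_congr rfl fun i hi => ?_
      have h3 : (q : K) ^ (3 * D) = ∏ j : Fin 3, ((q : K) ^ (D - e i j) * (q : K) ^ e i j) := by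
        rw [Finset.prod_congr rfl (fun j _ => by
          rw [← pow_add, Nat.sub_add_cancel (he i hi j)])]
        simp [← pow_mul, mul_comm]
      rw [h3]
      push_cast
      simp only [mul_pow, Finset.prod_mul_distrib]
      ring
    rw [this]
    refine IsIntegral.sum _ fun i _ => IsIntegral.mul
      (isIntegral_algebraMap (R := ℤ) (A := K)) (IsIntegral.prod _ fun j _ => (hqint j).pow _)
  have hnorm : 1 ≤ ∏ σ : K →ₐ[ℚ] ℂ, ‖σ x‖ := by
    have h1 := Algebra.norm_eq_prod_embeddings ℚ ℂ x
    rw [← norm_prod, ← h1]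
    have h2 : IsIntegral ℤ (Algebra.norm ℚ x) := Algebra.isIntegral_norm ℚ hxint
    obtain ⟨n, hn⟩ := IsIntegrallyClosed.isIntegral_iff.mp h2
    have hn0 : n ≠ 0 := by
      rintro rfl
      have : Algebra.norm ℚ x = 0 := by rw [← hn]; simp
      exact hx0 (Algebra.norm_eq_zero_iff.mp this)
    rw [← hn]
    simp only [algebraMap_int_eq, eq_intCast, map_intCast, Complex.norm_intCast]
    exact_mod_cast Int.one_le_abs hn0
  have hbound : ∀ σ : K →ₐ[ℚ] ℂ, ‖σ x‖ ≤ G ^ (3 * D) * H := by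
    intro σ
    have h1 : ‖σ ξ‖ ≤ H * M ^ (3 * D) := by
      simp only [ξ, map_sum, map_mul, map_prod, map_pow, map_intCast]
      calc ‖∑ i ∈ s, (k i : ℂ) * ∏ j, σ (a' j) ^ e i j‖
          ≤ ∑ i ∈ s, ‖(k i : ℂ) * ∏ j, σ (a' j) ^ e i j‖ := norm_sum_le _ _
        _ ≤ ∑ i ∈ s, |(k i : ℝ)| * M ^ (3 * D) := by
            refine Finset.sum_le_sum fun i hi => ?_
            rw [norm_mul, Complex.norm_intCast, norm_prod]
            refine mul_le_mul_of_nonneg_left ?_ (abs_nonneg _)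
            calc ∏ j, ‖σ (a' j) ^ e i j‖ ≤ ∏ j : Fin 3, M ^ D := by
                  refine Finset.prod_le_prod (fun _ _ => norm_nonneg _) fun j _ => ?_
                  rw [norm_pow]
                  exact (pow_le_pow_left₀ (norm_nonneg _) (hM σ j) _).trans
                    (pow_le_pow_right₀ hM1 (he i hi j))
              _ = M ^ (3 * D) := by simp [← pow_mul, mul_comm]
        _ ≤ H * M ^ (3 * D) := by
            rw [← Finset.sum_mul]
            exact mul_le_mul_of_nonneg_right hk (by positivity)
    simp only [x, map_mul, map_pow, map_intCast, norm_mul, norm_pow, Complex.norm_intCast, G,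
      mul_pow]
    calc _ ≤ |(q : ℝ)| ^ (3 * D) * (H * M ^ (3 * D)) :=
          mul_le_mul_of_nonneg_left h1 (by positivity)
      _ = _ := by ring
  have hprod : ∏ σ : K →ₐ[ℚ] ℂ, ‖σ x‖ ≤ ‖σ₀ x‖ * (G ^ (3 * D) * H) ^ (d - 1) := by
    rw [← Finset.mul_prod_erase _ _ (Finset.mem_univ σ₀)]
    refine mul_le_mul_of_nonneg_left ?_ (norm_nonneg _)
    calc _ ≤ ∏ σ ∈ Finset.univ.erase σ₀, (G ^ (3 * D) * H) :=
          Finset.prod_le_prod (fun _ _ => norm_nonneg _) fun σ _ => hbound σ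
      _ = _ := by
          rw [Finset.prod_const, Finset.card_erase_of_mem (Finset.mem_univ _), Finset.card_univ]
  have hσx : ‖σ₀ x‖ ≤ |(ξ : ℝ)| * G ^ (3 * D) := by
    rw [show σ₀ x = (q : ℂ) ^ (3 * D) * σ₀ ξ by simp [x, map_mul, map_pow, map_intCast]]
    rw [norm_mul, hσ₀, norm_pow, Complex.norm_intCast, mul_comm]
    refine mul_le_mul_of_nonneg_left (pow_le_pow_left₀ (abs_nonneg _) ?_ _) (abs_nonneg _)
    exact le_mul_of_one_le_right (abs_nonneg _) hM1
  calc (1 : ℝ) ≤ ‖σ₀ x‖ * (G ^ (3 * D) * H) ^ (d - 1) := hnorm.trans hprod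
    _ ≤ (|(ξ : ℝ)| * G ^ (3 * D)) * (G ^ (3 * D) * H) ^ (d - 1) := by gcongr
    _ ≤ (|(ξ : ℝ)| * (G ^ (3 * D) * H)) * (G ^ (3 * D) * H) ^ (d - 1) := by
        gcongr
        exact le_mul_of_one_le_right (by positivity) hH
    _ = |(ξ : ℝ)| * (H ^ d * (G ^ (3 * d)) ^ D) := by
        obtain ⟨d', hd'⟩ : ∃ d', d = d' + 1 := ⟨d - 1, by omega⟩
        rw [hd']; simp only [Nat.add_sub_cancel]
        ring
    _ ≤ _ := by
        gcongr
        exact Nat.le_ceil _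

/-- Thue–Siegel lemma for real linear forms. -/
theorem bk_siegel {α β : Type} [Fintype α] [Fintype β] (A : α → β → ℝ) (Y a : ℝ) (d : ℕ)
    (hd : 1 ≤ d) (ha : 0 ≤ a) (hA : ∀ i j, |A i j| ≤ a) (hY1 : 1 ≤ Y)
    (hY : (Fintype.card β : ℝ) * (a + 1) ≤ Y)
    (hcard : (8 * d + 1) * Fintype.card α ≤ Fintype.card β) (hα : 0 < Fintype.card α) :
    ∃ p : β → ℤ, p ≠ 0 ∧ (∀ j, |(p j : ℝ)| ≤ Y) ∧
      ∀ i, |∑ j, A i j * (p j : ℝ)| * Y ^ (8 * d - 4) ≤ 1 := by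
  classical
  let Q : ℝ := Y ^ (8 * d - 2)
  have hQ1 : 1 ≤ Q := one_le_pow₀ hY1
  have hQ0 : 0 < Q := by linarith
  have hY0 : 0 < Y := by linarith
  let A' : Matrix α β ℤ := fun i j => ⌊Q * A i j⌋
  letI := Matrix.seminormedAddCommGroup (m := α) (n := β) (α := ℤ)
  have hlt : Fintype.card α < Fintype.card β := by nlinarith
  obtain ⟨p, hp0, hp, hpn⟩ := Int.Matrix.exists_ne_zero_int_vec_norm_le A' hlt hα
  have hA'n : ‖A'‖ ≤ Q * a + 1 := by
    rw [Matrix.norm_le_iff (by positivity)]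
    intro i j
    rw [Int.norm_eq_abs]
    have h1 := Int.floor_le (Q * A i j)
    have h2 := Int.lt_floor_add_one (Q * A i j)
    have h3 := abs_le.mp (hA i j)
    change |((⌊Q * A i j⌋ : ℤ) : ℝ)| ≤ _
    rw [abs_le]
    constructor
    · have := mul_le_mul_of_nonneg_left h3.1 hQ0.le
      linarith
    · have := mul_le_mul_of_nonneg_left h3.2 hQ0.le
      linarith
  have hNpos : (0 : ℝ) < Fintype.card β := by
    exact_mod_cast (lt_of_le_of_lt (Nat.zero_le _) hlt)
  have hbase : (Fintype.card β : ℝ) * max 1 ‖A'‖ ≤ Y ^ (8 * d) := by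
    have h1 : max 1 ‖A'‖ ≤ Q * (a + 1) := by
      apply max_le
      · nlinarith
      · nlinarith
    calc (Fintype.card β : ℝ) * max 1 ‖A'‖ ≤ Fintype.card β * (Q * (a + 1)) := by gcongr
      _ = Q * (Fintype.card β * (a + 1)) := by ring
      _ ≤ Q * Y := by gcongr
      _ = Y ^ (8 * d - 2 + 1) := by rw [pow_succ]
      _ ≤ Y ^ (8 * d) := pow_le_pow_right₀ hY1 (by omega)
  have hpY : ∀ j, |(p j : ℝ)| ≤ Y := by
    intro j
    have h1 : |(p j : ℝ)| ≤ ‖p‖ := by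
      rw [← Int.norm_eq_abs]
      exact norm_le_pi_norm p j
    refine h1.trans (hpn.trans ?_)
    have hMr : (0 : ℝ) < Fintype.card α := by exact_mod_cast hα
    have hcr : (8 * (d : ℝ) + 1) * Fintype.card α ≤ Fintype.card β := by exact_mod_cast hcard
    have hd' : (1 : ℝ) ≤ d := by exact_mod_cast hd
    have hexp : (Fintype.card α : ℝ) / (Fintype.card β - Fintype.card α) ≤ 1 / (8 * d) := by
      rw [div_le_div_iff₀ (by nlinarith) (by positivity)]
      nlinarith
    calc ((Fintype.card β : ℝ) * max 1 ‖A'‖) ^ ((Fintype.card α : ℝ) / (Fintype.card β - Fintype.card α))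
        ≤ (Y ^ (8 * d)) ^ ((Fintype.card α : ℝ) / (Fintype.card β - Fintype.card α)) := by
          apply Real.rpow_le_rpow (by positivity) hbase
          apply div_nonneg hMr.le
          nlinarith
      _ ≤ (Y ^ (8 * d)) ^ (1 / (8 * (d : ℝ))) :=
          Real.rpow_le_rpow_of_exponent_le (one_le_pow₀ hY1) hexp
      _ = Y := by
          rw [← Real.rpow_natCast, ← Real.rpow_mul hY0.le]
          push_cast
          rw [mul_one_div_cancel (by positivity), Real.rpow_one]
  refine ⟨p, hp0, hpY, fun i => ?_⟩
  have h0 : ∑ j, (A' i j : ℝ) * (p j : ℝ) = 0 := by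
    have := congrFun hp i
    simp only [Matrix.mulVec, dotProduct, Pi.zero_apply] at this
    exact_mod_cast this
  have h1 : Q * ∑ j, A i j * (p j : ℝ) = ∑ j, (Q * A i j - A' i j) * (p j : ℝ) := by
    simp only [sub_mul, Finset.sum_sub_distrib, h0, sub_zero, Finset.mul_sum, mul_assoc]
  have h2 : |Q * ∑ j, A i j * (p j : ℝ)| ≤ Fintype.card β * Y := by
    rw [h1]
    calc _ ≤ ∑ j, |(Q * A i j - A' i j) * (p j : ℝ)| := Finset.abs_sum_le_sum_abs _ _
      _ ≤ ∑ _j : β, Y := by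
          refine Finset.sum_le_sum fun j _ => ?_
          rw [abs_mul]
          have h3 : |Q * A i j - A' i j| ≤ 1 := by
            have h1 := Int.floor_le (Q * A i j)
            have h2 := Int.lt_floor_add_one (Q * A i j)
            change |Q * A i j - ((⌊Q * A i j⌋ : ℤ) : ℝ)| ≤ _
            rw [abs_le]; constructor <;> linarith
          calc _ ≤ 1 * Y := mul_le_mul h3 (hpY j) (abs_nonneg _) zero_le_one
            _ = Y := one_mul _
      _ = _ := by simp
  have h3 : (Fintype.card β : ℝ) ≤ Y := by nlinarith
  rw [abs_mul, abs_of_pos hQ0] at h2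
  have h4 : Q = Y ^ (8 * d - 4) * Y ^ 2 := by
    change Y ^ (8 * d - 2) = _
    rw [← pow_add]; congr 1; omega
  have h5 : Q * |∑ j, A i j * (p j : ℝ)| ≤ Y ^ 2 := by nlinarith
  rw [h4] at h5
  have h6 : Y ^ 2 * (|∑ j, A i j * (p j : ℝ)| * Y ^ (8 * d - 4)) ≤ Y ^ 2 * 1 := by nlinarith
  exact le_of_mul_le_mul_left h6 (by positivity)

/-- Rolle: a differentiable function with `n+1` zeros has a derivative with `n` zeros. -/
theorem bk_rolle (f f' : ℝ → ℝ) (hf : ∀ x, HasDerivAt f (f' x) x) (Z : Finset ℝ)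
    (hZ : ∀ x ∈ Z, f x = 0) :
    ∃ Z' : Finset ℝ, Z.card ≤ Z'.card + 1 ∧ ∀ x ∈ Z', f' x = 0 := by
  classical
  rcases Nat.eq_zero_or_pos Z.card with h | h
  · exact ⟨∅, by omega, by simp⟩
  obtain ⟨n, hn⟩ : ∃ n, Z.card = n + 1 := ⟨Z.card - 1, by omega⟩
  let g := Z.orderEmbOfFin hn
  have hg : ∀ i, f (g i) = 0 := fun i => hZ _ (Z.orderEmbOfFin_mem hn i)
  have hex : ∀ i : Fin n, ∃ c ∈ Set.Ioo (g i.castSucc) (g i.succ), f' c = 0 := by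
    intro i
    have hlt : g i.castSucc < g i.succ := by
      rw [OrderEmbedding.lt_iff_lt]; exact Fin.castSucc_lt_succ
    exact exists_hasDerivAt_eq_zero hlt
      (fun x _ => (hf x).continuousAt.continuousWithinAt) (by rw [hg, hg]) (fun x _ => hf x)
  choose c hc hc' using hex
  have hmono : StrictMono c := by
    intro i j hij
    have h1 : g i.succ ≤ g j.castSucc := by
      rw [OrderEmbedding.le_iff_le]
      rw [Fin.le_def]; simp; exact hij
    exact (hc i).2.trans_le (h1.trans (hc j).1.le)
  refine ⟨Finset.univ.image c, ?_, ?_⟩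
  · rw [Finset.card_image_of_injective _ hmono.injective, hn]; simp
  · intro x hx
    simp only [Finset.mem_image, Finset.mem_univ, true_and] at hx
    obtain ⟨i, rfl⟩ := hx
    exact hc' i

/-- Zero estimate for real exponential polynomials. -/
theorem bk_zero_estimate {ι : Type} (W : Finset ι) (w : ι → ℝ)
    (hw : ∀ i ∈ W, ∀ j ∈ W, w i = w j → i = j) :
    ∀ (N : ℕ) (n : ι → ℕ), ∑ i ∈ W, n i = N → ∀ (P : ι → Polynomial ℝ),
      (∀ i ∈ W, P i ∈ Polynomial.degreeLT ℝ (n i)) → ∀ Z : Finset ℝ, N ≤ Z.card →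
      (∀ x ∈ Z, ∑ i ∈ W, (P i).eval x * Real.exp (w i * x) = 0) → ∀ i ∈ W, P i = 0 := by
  classical
  intro N
  induction N with
  | zero =>
    intro n hn P hP Z _ _ i hi
    have : n i = 0 := by
      have := Finset.sum_eq_zero_iff.mp hn i hi
      exact this
    have h := hP i hi
    rw [this] at h
    simpa [Polynomial.mem_degreeLT] using h
  | succ N ih =>
    intro n hn P hP Z hZc hZ
    obtain ⟨i₀, hi₀, hni₀⟩ : ∃ i ∈ W, n i ≠ 0 := by
      by_contra hcon
      push Not at hcon
      rw [Finset.sum_eq_zero hcon] at hn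
      omega
    let P' : ι → Polynomial ℝ := fun i =>
      Polynomial.derivative (P i) + Polynomial.C (w i - w i₀) * P i
    let f : ℝ → ℝ := fun x => ∑ i ∈ W, (P i).eval x * Real.exp ((w i - w i₀) * x)
    let f' : ℝ → ℝ := fun x => ∑ i ∈ W, (P' i).eval x * Real.exp ((w i - w i₀) * x)
    have hf : ∀ x, HasDerivAt f (f' x) x := by
      intro x
      apply HasDerivAt.fun_sum
      intro i _
      have h1 := (P i).hasDerivAt x
      have h2 : HasDerivAt (fun x => Real.exp ((w i - w i₀) * x))
          (Real.exp ((w i - w i₀) * x) * (w i - w i₀)) x := by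
        have := ((hasDerivAt_id x).const_mul (w i - w i₀)).exp
        simpa using this
      refine (h1.fun_mul h2).congr_deriv ?_
      simp only [P', Polynomial.eval_add, Polynomial.eval_mul, Polynomial.eval_C]
      ring
    have hfac : ∀ x, f x = Real.exp (-(w i₀) * x) * ∑ i ∈ W, (P i).eval x * Real.exp (w i * x) := by
      intro x
      simp only [f, Finset.mul_sum]
      refine Finset.sum_congr rfl fun i _ => ?_
      rw [show (w i - w i₀) * x = -(w i₀) * x + w i * x by ring, Real.exp_add]
      ring
    have hfac' : ∀ x, f' x = Real.exp (-(w i₀) * x) * ∑ i ∈ W, (P' i).eval x * Real.exp (w i * x) := by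
      intro x
      simp only [f', Finset.mul_sum]
      refine Finset.sum_congr rfl fun i _ => ?_
      rw [show (w i - w i₀) * x = -(w i₀) * x + w i * x by ring, Real.exp_add]
      ring
    obtain ⟨Z', hZ'c, hZ'⟩ := bk_rolle f f' hf Z (fun x hx => by rw [hfac, hZ x hx, mul_zero])
    let n' : ι → ℕ := Function.update n i₀ (n i₀ - 1)
    have hn' : ∑ i ∈ W, n' i = N := by
      rw [← Finset.add_sum_erase _ _ hi₀] at hn ⊢
      have : ∑ i ∈ W.erase i₀, n' i = ∑ i ∈ W.erase i₀, n i := by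
        refine Finset.sum_congr rfl fun i hi => ?_
        simp [n', Function.update_of_ne (Finset.ne_of_mem_erase hi)]
      rw [this]
      simp only [n', Function.update_self]
      omega
    have hP' : ∀ i ∈ W, P' i ∈ Polynomial.degreeLT ℝ (n' i) := by
      intro i hi
      have hPi := hP i hi
      rw [Polynomial.mem_degreeLT] at hPi
      by_cases h : i = i₀
      · subst h
        simp only [P', sub_self, Polynomial.C_0, zero_mul, add_zero, n', Function.update_self]
        rw [Polynomial.mem_degreeLT]
        by_cases h0 : Polynomial.derivative (P i) = 0
        · rw [h0]; simp
        have hne : P i ≠ 0 := by rintro h1; rw [h1] at h0; simp at h0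
        have h2 : (P i).natDegree ≠ 0 := by
          intro h3
          exact h0 (Polynomial.derivative_of_natDegree_zero h3)
        have h3 := Polynomial.natDegree_derivative_lt h2
        have h4 : (P i).natDegree < n i := by
          rwa [Polynomial.degree_eq_natDegree hne, Nat.cast_lt] at hPi
        rw [Polynomial.degree_eq_natDegree h0, Nat.cast_lt]
        omega
      · simp only [n', Function.update_of_ne h]
        refine Submodule.add_mem _ ?_ ?_
        · rw [Polynomial.mem_degreeLT]
          exact (Polynomial.degree_derivative_le).trans_lt hPi
        · rw [← Polynomial.smul_eq_C_mul]
          exact Submodule.smul_mem _ _ (hP i hi)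
    have hP'0 := ih n' hn' P' hP' Z' (by omega) (by
      intro x hx
      have := hZ' x hx
      rw [hfac'] at this
      exact (mul_eq_zero.mp this).resolve_left (Real.exp_ne_zero _))
    have hothers : ∀ i ∈ W, i ≠ i₀ → P i = 0 := by
      intro i hi hne
      by_contra h0
      have h1 := hP'0 i hi
      have hwne : w i - w i₀ ≠ 0 := sub_ne_zero.mpr fun h => hne (hw i hi i₀ hi₀ h)
      have h2 : Polynomial.C (w i - w i₀) * P i = - Polynomial.derivative (P i) :=
        eq_neg_of_add_eq_zero_right h1
      have h3 : (Polynomial.C (w i - w i₀) * P i).degree = (P i).degree := by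
        rw [Polynomial.degree_mul, Polynomial.degree_C hwne, zero_add]
      rw [h2, Polynomial.degree_neg] at h3
      exact (Polynomial.degree_derivative_lt h0).ne h3
    intro i hi
    by_cases h : i = i₀
    · subst h
      have h1 := hP'0 i hi
      simp only [P', sub_self, Polynomial.C_0, zero_mul, add_zero] at h1
      have h2 : (P i).natDegree = 0 := Polynomial.derivative_eq_zero.mp h1
      rw [Polynomial.eq_C_of_natDegree_eq_zero h2]
      have hcard : 0 < Z.card := by omega
      obtain ⟨x, hx⟩ := Finset.card_pos.mp hcard
      have h3 := hZ x hx
      rw [Finset.sum_eq_single_of_mem i hi (fun j hj hji => by rw [hothers j hj hji]; simp)] at h3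
      have h4 := (mul_eq_zero.mp h3).resolve_right (Real.exp_ne_zero _)
      rw [Polynomial.eq_C_of_natDegree_eq_zero h2, Polynomial.eval_C] at h4
      rw [h4]; simp
    · exact hothers i hi h

theorem bk_factor_one (a : ℂ) (n : ℕ) : ∀ (f : ℂ → ℂ), Differentiable ℂ f →
    (n : ℕ∞) ≤ analyticOrderAt f a →
    ∃ g : ℂ → ℂ, Differentiable ℂ g ∧ ∀ z, f z = (z - a) ^ n * g z := by
  induction n with
  | zero => intro f hf _; exact ⟨f, hf, by simp⟩
  | succ n ih =>
    intro f hf ho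
    have hfa : f a = 0 := by
      apply apply_eq_zero_of_analyticOrderAt_ne_zero
      intro h; rw [h] at ho; simp at ho
    have hd : Differentiable ℂ (dslope f a) := by
      intro z
      have h1 : DifferentiableOn ℂ (dslope f a) Set.univ :=
        (Complex.differentiableOn_dslope Filter.univ_mem).mpr hf.differentiableOn
      exact h1.differentiableAt Filter.univ_mem
    have hfe : f = (fun z => z - a) * dslope f a := by
      funext z
      have := sub_smul_dslope f a z
      simp only [smul_eq_mul, hfa, sub_zero] at this
      simp [this]
    have ho1 : analyticOrderAt (fun z : ℂ => z - a) a = 1 := by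
      apply AnalyticAt.analyticOrderAt_eq_one_of_zero_deriv_ne_zero
      · fun_prop
      · simp
      · simp
    have ho2 : (n : ℕ∞) ≤ analyticOrderAt (dslope f a) a := by
      rw [hfe, analyticOrderAt_mul (by fun_prop) (hd.analyticAt a), ho1] at ho
      rw [Nat.cast_add, Nat.cast_one, add_comm] at ho
      exact (ENat.add_le_add_iff_left (by simp)).mp ho
    obtain ⟨g, hg, hg2⟩ := ih _ hd ho2
    refine ⟨g, hg, fun z => ?_⟩
    have : f z = (z - a) * dslope f a z := congrFun hfe z
    rw [this, hg2, pow_succ]; ring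

theorem bk_factor (T : ℕ) (Z : Finset ℂ) : ∀ (f : ℂ → ℂ), Differentiable ℂ f →
    (∀ a ∈ Z, (T : ℕ∞) ≤ analyticOrderAt f a) →
    ∃ g : ℂ → ℂ, Differentiable ℂ g ∧ ∀ z, f z = (∏ a ∈ Z, (z - a) ^ T) * g z := by
  classical
  induction Z using Finset.induction_on with
  | empty => intro f hf _; exact ⟨f, hf, by simp⟩
  | insert a Z ha ih =>
    intro f hf ho
    obtain ⟨g, hg, hfg⟩ := bk_factor_one a T f hf (ho a (Finset.mem_insert_self _ _))
    have hfe : f = (fun z => (z - a) ^ T) * g := by funext z; exact hfg z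
    obtain ⟨g', hg', hgg'⟩ := ih g hg (by
      intro b hb
      have hne : b ≠ a := by rintro rfl; exact ha hb
      have h1 := ho b (Finset.mem_insert_of_mem hb)
      rw [hfe, analyticOrderAt_mul (by fun_prop) (hg.analyticAt b)] at h1
      have h2 : analyticOrderAt (fun z : ℂ => (z - a) ^ T) b = 0 := by
        rw [analyticOrderAt_eq_zero]
        right
        exact pow_ne_zero _ (sub_ne_zero.mpr hne)
      rwa [h2, zero_add] at h1)
    refine ⟨g', hg', fun z => ?_⟩
    rw [Finset.prod_insert ha, hfg, hgg']; ring

/-- Schwarz lemma with zeros of order `T` at `0, 1, …, S - 1`. -/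
theorem bk_schwarz (f : ℂ → ℂ) (hf : Differentiable ℂ f) (T S S' x : ℕ) (M : ℝ)
    (ho : ∀ s < S, (T : ℕ∞) ≤ analyticOrderAt f (s : ℂ)) (hSS : S ≤ S') (hS' : 0 < S')
    (hx : x ≤ S') (hM : ∀ z : ℂ, ‖z‖ ≤ 4 * S' → ‖f z‖ ≤ M) :
    ‖f x‖ ≤ M * Real.exp (-(T * S)) := by
  classical
  let Z : Finset ℂ := (Finset.range S).image (fun s : ℕ => (s : ℂ))
  have hinj : Function.Injective (fun s : ℕ => (s : ℂ)) := Nat.cast_injective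
  have hZc : Z.card = S := by
    rw [Finset.card_image_of_injective _ hinj, Finset.card_range]
  obtain ⟨g, hg, hfg⟩ := bk_factor T Z f hf (by
    intro a ha
    simp only [Z, Finset.mem_image, Finset.mem_range] at ha
    obtain ⟨s, hs, rfl⟩ := ha
    exact ho s hs)
  have hS'r : (1 : ℝ) ≤ S' := by exact_mod_cast hS'
  have hSr : (S : ℝ) ≤ S' := by exact_mod_cast hSS
  have hM0 : 0 ≤ M := (norm_nonneg _).trans (hM 0 (by simp))
  have hZn : ∀ a ∈ Z, ∃ s : ℕ, s < S ∧ a = s := by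
    intro a ha
    simp only [Z, Finset.mem_image, Finset.mem_range] at ha
    obtain ⟨s, hs, rfl⟩ := ha
    exact ⟨s, hs, rfl⟩
  have hgb : ∀ z ∈ Metric.sphere (0 : ℂ) (4 * S'), ‖g z‖ ≤ M / (3 * S') ^ (T * S) := by
    intro z hz
    have hz' : ‖z‖ = 4 * S' := by simpa using hz
    have h1 : (3 * (S' : ℝ)) ^ (T * S) ≤ ‖∏ a ∈ Z, (z - a) ^ T‖ := by
      rw [norm_prod]
      calc (3 * (S' : ℝ)) ^ (T * S) = ∏ a ∈ Z, (3 * (S' : ℝ)) ^ T := by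
            rw [Finset.prod_const, hZc, pow_mul]
        _ ≤ _ := by
            refine Finset.prod_le_prod (fun _ _ => by positivity) fun a ha => ?_
            obtain ⟨s, hs, rfl⟩ := hZn a ha
            rw [norm_pow]
            refine pow_le_pow_left₀ (by positivity) ?_ _
            have h2 := norm_sub_norm_le z (s : ℂ)
            rw [hz', Complex.norm_natCast] at h2
            have : (s : ℝ) ≤ S := by exact_mod_cast hs.le
            linarith
    have h2 := hM z hz'.le
    rw [hfg, norm_mul] at h2
    rw [le_div_iff₀ (by positivity), mul_comm]
    exact (mul_le_mul_of_nonneg_right h1 (norm_nonneg _)).trans h2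
  have hgx : ‖g x‖ ≤ M / (3 * S') ^ (T * S) := by
    refine Complex.norm_le_of_forall_mem_frontier_norm_le (U := Metric.ball 0 (4 * S'))
      Metric.isBounded_ball hg.diffContOnCl ?_ ?_
    · rw [frontier_ball _ (by positivity)]
      exact hgb
    · rw [closure_ball _ (by positivity)]
      simp only [Metric.mem_closedBall, dist_zero_right, Complex.norm_natCast]
      have : (x : ℝ) ≤ S' := by exact_mod_cast hx
      linarith
  have hprod : ‖∏ a ∈ Z, ((x : ℂ) - a) ^ T‖ ≤ (S' : ℝ) ^ (T * S) := by
    rw [norm_prod]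
    calc _ ≤ ∏ a ∈ Z, (S' : ℝ) ^ T := by
          refine Finset.prod_le_prod (fun _ _ => norm_nonneg _) fun a ha => ?_
          obtain ⟨s, hs, rfl⟩ := hZn a ha
          rw [norm_pow]
          refine pow_le_pow_left₀ (norm_nonneg _) ?_ _
          have h3 : ((x : ℂ) - (s : ℂ)) = (((x : ℝ) - (s : ℝ) : ℝ) : ℂ) := by push_cast; ring
          rw [h3, Complex.norm_real, Real.norm_eq_abs, abs_le]
          have h4 : (x : ℝ) ≤ S' := by exact_mod_cast hx
          have h5 : (s : ℝ) ≤ S := by exact_mod_cast hs.le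
          have h6 : (0 : ℝ) ≤ x := Nat.cast_nonneg _
          have h7 : (0 : ℝ) ≤ s := Nat.cast_nonneg _
          constructor <;> linarith
      _ = _ := by rw [Finset.prod_const, hZc, pow_mul]
  rw [hfg, norm_mul]
  calc _ ≤ (S' : ℝ) ^ (T * S) * (M / (3 * S') ^ (T * S)) := by gcongr
    _ = M * (1 / 3 : ℝ) ^ (T * S) := by
        rw [mul_pow, one_div, inv_pow]; field_simp
    _ ≤ M * Real.exp (-1) ^ (T * S) := by
        gcongr
        rw [Real.exp_neg, ← one_div]
        exact one_div_le_one_div_of_le (Real.exp_pos _) Real.exp_one_lt_three.le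
    _ = _ := by
        rw [← Real.exp_nat_mul]; push_cast; ring_nf

theorem bk_norm_cos_le (z : ℂ) : ‖Complex.cos z‖ ≤ Real.exp ‖z‖ := by
  rw [Complex.cos]
  have h1 : ‖Complex.exp (z * Complex.I)‖ ≤ Real.exp ‖z‖ := by
    refine (Complex.norm_exp_le_exp_norm _).trans (le_of_eq ?_); simp
  have h2 : ‖Complex.exp (-z * Complex.I)‖ ≤ Real.exp ‖z‖ := by
    refine (Complex.norm_exp_le_exp_norm _).trans (le_of_eq ?_); simp
  rw [norm_div]
  have h3 := norm_add_le (Complex.exp (z * Complex.I)) (Complex.exp (-z * Complex.I))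
  simp only [Complex.norm_ofNat]
  linarith

/-- An entire function of exponential type, `1` to order `T` at `0`, `0` to order `T` at the
other integers. -/
theorem bk_theta (T : ℕ) : ∃ g : ℂ → ℂ, Differentiable ℂ g ∧
    (∀ n : ℤ, n ≠ 0 → (T : ℕ∞) ≤ analyticOrderAt g (n : ℂ)) ∧
    ((T : ℕ∞) ≤ analyticOrderAt (fun z => g z - 1) 0) ∧
    ∀ z, ‖g z‖ ≤ Real.exp (1 + T * (1 + 4 * T * ‖z‖)) := by
  let D : ℂ → ℂ := dslope Complex.sin 0
  have hDd : Differentiable ℂ D := by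
    intro z
    have h1 : DifferentiableOn ℂ D Set.univ :=
      (Complex.differentiableOn_dslope Filter.univ_mem).mpr
        Complex.differentiable_sin.differentiableOn
    exact h1.differentiableAt Filter.univ_mem
  have hD0 : D 0 = 1 := by simp [D]
  have hDw : ∀ w, w * D w = Complex.sin w := by
    intro w
    have := sub_smul_dslope Complex.sin 0 w
    simpa using this
  have hDb : ∀ w, ‖D w‖ ≤ Real.exp ‖w‖ := by
    intro w
    by_cases hw : w = 0
    · subst hw; rw [hD0]; simp
    have h1 : ‖Complex.sin w - Complex.sin 0‖ ≤ Real.exp ‖w‖ * ‖w - 0‖ := by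
      refine Convex.norm_image_sub_le_of_norm_deriv_le (s := Metric.closedBall 0 ‖w‖)
        (fun x _ => Complex.differentiable_sin x) ?_ (convex_closedBall _ _) (by simp) (by simp)
      intro x hx
      rw [Complex.deriv_sin]
      refine (bk_norm_cos_le x).trans (Real.exp_le_exp.mpr ?_)
      simpa using hx
    have hwp : 0 < ‖w‖ := norm_pos_iff.mpr hw
    rw [Complex.sin_zero, sub_zero, sub_zero, ← hDw, norm_mul, mul_comm] at h1
    exact le_of_mul_le_mul_right h1 hwp
  let q : ℂ → ℂ := fun z => D (Real.pi * z) ^ T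
  have hqd : Differentiable ℂ q := by
    have : Differentiable ℂ (fun z : ℂ => D (Real.pi * z)) :=
      hDd.comp (differentiable_id.const_mul _)
    exact this.pow T
  have hqb : ∀ z, ‖q z‖ ≤ Real.exp (4 * T * ‖z‖) := by
    intro z
    simp only [q, norm_pow]
    calc _ ≤ Real.exp ‖(Real.pi : ℂ) * z‖ ^ T := pow_le_pow_left₀ (norm_nonneg _) (hDb _) _
      _ = Real.exp (T * (Real.pi * ‖z‖)) := by
          rw [← Real.exp_nat_mul, norm_mul, Complex.norm_real, Real.norm_eq_abs,
            abs_of_pos Real.pi_pos]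
      _ ≤ _ := by
          apply Real.exp_le_exp.mpr
          have := Real.pi_le_four
          have h2 : (0 : ℝ) ≤ T * ‖z‖ := by positivity
          nlinarith
  have hpow : ∀ (f : ℂ → ℂ) (a : ℂ), Differentiable ℂ f → f a = 0 →
      (T : ℕ∞) ≤ analyticOrderAt (fun z => f z ^ T) a := by
    intro f a hf h0
    have h1 : analyticOrderAt f a ≠ 0 := by
      rw [(hf.analyticAt a).analyticOrderAt_ne_zero]; exact h0
    have h2 : (1 : ℕ∞) ≤ analyticOrderAt f a := Order.one_le_iff_ne_zero.mpr h1
    have h3 := analyticOrderAt_pow (hf.analyticAt a) T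
    change (T : ℕ∞) ≤ analyticOrderAt (f ^ T) a
    rw [h3, nsmul_eq_mul]
    calc (T : ℕ∞) = T * 1 := by simp
      _ ≤ _ := by gcongr
  refine ⟨fun z => 1 - (1 - q z) ^ T, by fun_prop, ?_, ?_, ?_⟩
  · intro n hn
    have hne : (Real.pi : ℂ) * n ≠ 0 :=
      mul_ne_zero (by exact_mod_cast Real.pi_ne_zero) (by exact_mod_cast hn)
    have hz : D (Real.pi * n) = 0 := by
      have h1 := hDw (Real.pi * n)
      have h2 : Complex.sin (Real.pi * n) = 0 := by
        rw [mul_comm]; exact Complex.sin_int_mul_pi n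
      rw [h2] at h1
      exact (mul_eq_zero.mp h1).resolve_left hne
    have hq : (T : ℕ∞) ≤ analyticOrderAt q (n : ℂ) := by
      refine hpow (fun z : ℂ => D (Real.pi * z)) n ?_ hz
      exact hDd.comp (differentiable_id.const_mul _)
    have hfe : (fun z => 1 - (1 - q z) ^ T) = q * fun z => ∑ i ∈ Finset.range T, (1 - q z) ^ i := by
      funext z
      have := mul_geom_sum (1 - q z) T
      simp only [Pi.mul_apply]
      linear_combination this
    have hsd : Differentiable ℂ (fun z => ∑ i ∈ Finset.range T, (1 - q z) ^ i) := by fun_prop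
    rw [hfe, analyticOrderAt_mul (hqd.analyticAt _) (hsd.analyticAt _)]
    exact hq.trans le_self_add
  · have h1 := hpow (fun z => 1 - q z) 0 (by fun_prop) (by simp [q, hD0])
    have h2 : (fun z => (1 - (1 - q z) ^ T) - 1) = -(fun z => (1 - q z) ^ T) := by
      funext z; simp
    rw [h2, analyticOrderAt_neg]
    exact h1
  · intro z
    have hE : (1 : ℝ) ≤ Real.exp (4 * T * ‖z‖) := Real.one_le_exp (by positivity)
    have he : (2 : ℝ) ≤ Real.exp 1 := by
      have := Real.add_one_le_exp (1 : ℝ); linarith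
    have h1 : ‖1 - q z‖ ≤ Real.exp (1 + 4 * T * ‖z‖) := by
      rw [Real.exp_add]
      have h2 := norm_sub_le (1 : ℂ) (q z)
      rw [norm_one] at h2
      have := hqb z
      nlinarith
    have h2 : ‖(1 - q z) ^ T‖ ≤ Real.exp (T * (1 + 4 * T * ‖z‖)) := by
      rw [norm_pow, Real.exp_nat_mul]
      exact pow_le_pow_left₀ (norm_nonneg _) h1 _
    have h3 := norm_sub_le (1 : ℂ) ((1 - q z) ^ T)
    rw [norm_one] at h3
    have h4 : (1 : ℝ) ≤ Real.exp (T * (1 + 4 * T * ‖z‖)) := Real.one_le_exp (by positivity)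
    rw [Real.exp_add]
    nlinarith

/-- Exponential polynomials with derivatives in three directions. -/
noncomputable def bkG {ι : Type} [Fintype ι] (κ u v w : ι → ℂ) (q : ι → Polynomial ℂ)
    (t0 t1 t2 : ℕ) (z : ℂ) : ℂ :=
  ∑ i, κ i * u i ^ t1 * v i ^ t2 * (Polynomial.derivative^[t0] (q i)).eval z *
    Complex.exp (w i * z)

theorem bkG_hasDerivAt {ι : Type} [Fintype ι] (κ u v w : ι → ℂ) (q : ι → Polynomial ℂ)
    (μ1 μ2 : ℂ) (hw : ∀ i, w i = μ1 * u i + μ2 * v i) (t0 t1 t2 : ℕ) (z : ℂ) :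
    HasDerivAt (bkG κ u v w q t0 t1 t2)
      (bkG κ u v w q (t0 + 1) t1 t2 z + μ1 * bkG κ u v w q t0 (t1 + 1) t2 z +
        μ2 * bkG κ u v w q t0 t1 (t2 + 1) z) z := by
  have h : HasDerivAt (bkG κ u v w q t0 t1 t2)
      (∑ i, (κ i * u i ^ t1 * v i ^ t2 *
        (Polynomial.derivative (Polynomial.derivative^[t0] (q i))).eval z * Complex.exp (w i * z) +
        κ i * u i ^ t1 * v i ^ t2 * (Polynomial.derivative^[t0] (q i)).eval z *
          (Complex.exp (w i * z) * w i))) z := by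
    apply HasDerivAt.fun_sum
    intro i _
    have h1 := ((Polynomial.derivative^[t0] (q i)).hasDerivAt z).const_mul
      (κ i * u i ^ t1 * v i ^ t2)
    have h2 : HasDerivAt (fun z => Complex.exp (w i * z)) (Complex.exp (w i * z) * w i) z := by
      have := ((hasDerivAt_id z).const_mul (w i)).cexp
      simpa using this
    exact h1.fun_mul h2
  refine h.congr_deriv ?_
  simp only [bkG, Finset.mul_sum, ← Finset.sum_add_distrib]
  refine Finset.sum_congr rfl fun i _ => ?_
  rw [Function.iterate_succ_apply', hw i]
  ring

theorem bkG_iteratedDeriv {ι : Type} [Fintype ι] (κ u v w : ι → ℂ) (q : ι → Polynomial ℂ)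
    (μ1 μ2 : ℂ) (hw : ∀ i, w i = μ1 * u i + μ2 * v i) (n : ℕ) (s : ℂ)
    (h0 : ∀ t0 t1 t2, t0 + t1 + t2 < n → bkG κ u v w q t0 t1 t2 s = 0) (j : ℕ) :
    ∀ t0 t1 t2, t0 + t1 + t2 + j < n → iteratedDeriv j (bkG κ u v w q t0 t1 t2) s = 0 := by
  have hdiff : ∀ t0 t1 t2, Differentiable ℂ (bkG κ u v w q t0 t1 t2) := fun t0 t1 t2 z =>
    (bkG_hasDerivAt κ u v w q μ1 μ2 hw t0 t1 t2 z).differentiableAt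
  have hcd : ∀ t0 t1 t2 (m : ℕ), ContDiffAt ℂ m (bkG κ u v w q t0 t1 t2) s :=
    fun t0 t1 t2 m => (hdiff t0 t1 t2).contDiff.contDiffAt
  induction j with
  | zero =>
    intro t0 t1 t2 h
    simpa using h0 t0 t1 t2 h
  | succ j ih =>
    intro t0 t1 t2 h
    rw [iteratedDeriv_succ']
    have hd : deriv (bkG κ u v w q t0 t1 t2) = fun z =>
        bkG κ u v w q (t0 + 1) t1 t2 z + μ1 * bkG κ u v w q t0 (t1 + 1) t2 z +
        μ2 * bkG κ u v w q t0 t1 (t2 + 1) z := by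
      funext z
      exact (bkG_hasDerivAt κ u v w q μ1 μ2 hw t0 t1 t2 z).deriv
    have e1 : ContDiffAt ℂ j (fun z => μ1 * bkG κ u v w q t0 (t1 + 1) t2 z) s :=
      contDiffAt_const.mul (hcd _ _ _ _)
    have e2 : ContDiffAt ℂ j (fun z => μ2 * bkG κ u v w q t0 t1 (t2 + 1) z) s :=
      contDiffAt_const.mul (hcd _ _ _ _)
    rw [hd, iteratedDeriv_fun_add ((hcd _ _ _ _).add e1) e2,
      iteratedDeriv_fun_add (hcd _ _ _ _) e1,
      iteratedDeriv_const_mul_field, iteratedDeriv_const_mul_field,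
      ih _ _ _ (by omega), ih _ _ _ (by omega), ih _ _ _ (by omega)]
    simp

/-- The analytic part of the extrapolation step. -/
theorem bk_step {ι : Type} [Fintype ι] (a u v ε : ι → ℂ) (q : ι → Polynomial ℂ)
    (μ1 μ2 : ℂ) (T S S' : ℕ) (hSS : S ≤ S') (hS' : 0 < S')
    (hzero : ∀ t0 t1 t2 s : ℕ, t0 + t1 + t2 < 2 * T → s < S →
      bkG a u v (fun i => μ1 * u i + μ2 * v i + ε i) q t0 t1 t2 s = 0)
    (δ : ℝ) (hε : ∀ i, ‖ε i‖ ≤ δ)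
    (hδ : 4 * (S' : ℝ) ^ 2 * Real.exp (1 + T * (1 + 4 * T * (5 * S'))) * δ
      ≤ Real.exp (-(T * S)))
    (t0 t1 t2 : ℕ) (ht : t0 + t1 + t2 < T) (M : ℝ)
    (hM : ∀ i z, ‖z‖ ≤ 4 * S' → ‖a i * u i ^ t1 * v i ^ t2 *
      (Polynomial.derivative^[t0] (q i)).eval z‖ *
        Real.exp (‖μ1 * u i + μ2 * v i‖ * (4 * S')) ≤ M)
    (x : ℕ) (hx : x ≤ S') :
    ‖bkG a u v (fun i => μ1 * u i + μ2 * v i + ε i) q t0 t1 t2 x‖ ≤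
      3 * (Fintype.card ι * M) * Real.exp (-(T * S)) := by
  classical
  obtain ⟨g, hgd, hg1, hg0, hgb⟩ := bk_theta T
  let W : ι → ℂ := fun i => μ1 * u i + μ2 * v i
  let c : ι → ℂ → ℂ := fun i z => a i * u i ^ t1 * v i ^ t2 *
      (Polynomial.derivative^[t0] (q i)).eval z * Complex.exp (W i * z)
  have hcd : ∀ i, Differentiable ℂ (c i) := by
    intro i
    have : Differentiable ℂ (fun z => (Polynomial.derivative^[t0] (q i)).eval z) :=
      Polynomial.differentiable _
    fun_prop
  let θ : ι → ℂ → ℂ := fun i z =>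
    1 + ∑ s ∈ Finset.range S, (Complex.exp (ε i * s) - 1) * g (z - s)
  have hθd : ∀ i, Differentiable ℂ (θ i) := by
    intro i
    have : ∀ s : ℕ, Differentiable ℂ (fun z : ℂ => g (z - s)) := fun s =>
      hgd.comp (differentiable_id.sub_const _)
    fun_prop
  have hcb : ∀ i z, ‖z‖ ≤ 4 * S' → ‖c i z‖ ≤ M := by
    intro i z hz
    refine le_trans ?_ (hM i z hz)
    simp only [c]
    rw [norm_mul]
    refine mul_le_mul_of_nonneg_left ?_ (norm_nonneg _)
    refine (Complex.norm_exp_le_exp_norm _).trans (Real.exp_le_exp.mpr ?_)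
    rw [norm_mul]
    exact mul_le_mul_of_nonneg_left hz (norm_nonneg _)
  let F : ℂ → ℂ := fun z => ∑ i, c i z * θ i z
  have hFd : Differentiable ℂ F := by fun_prop
  have hS'r : (1 : ℝ) ≤ S' := by exact_mod_cast hS'
  have hSr : (S : ℝ) ≤ S' := by exact_mod_cast hSS
  set G : ℝ := Real.exp (1 + T * (1 + 4 * T * (5 * S'))) with hGdef
  have hG1 : 1 ≤ G := Real.one_le_exp (by positivity)
  have hE1 : Real.exp (-((T : ℝ) * S)) ≤ 1 := by
    rw [Real.exp_le_one_iff]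
    have : (0 : ℝ) ≤ T * S := by positivity
    linarith
  set E : ℝ := Real.exp (-((T : ℝ) * S)) with hEdef
  have hE0 : 0 < E := Real.exp_pos _
  rcases isEmpty_or_nonempty ι with hemp | ⟨⟨i₀⟩⟩
  · simp [bkG]
  have hδ0 : 0 ≤ δ := (norm_nonneg _).trans (hε i₀)
  have hδS : 4 * ((S' : ℝ) * δ) ≤ E := by
    refine le_trans ?_ hδ
    have h1 : (S' : ℝ) * 1 ≤ S' ^ 2 * G := by
      have : (S' : ℝ) ≤ S' ^ 2 := by nlinarith
      exact mul_le_mul this hG1 zero_le_one (by positivity)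
    have := mul_le_mul_of_nonneg_right h1 hδ0
    linarith
  have hexp1 : ∀ i, ∀ s : ℕ, s ≤ S' → ‖Complex.exp (ε i * s) - 1‖ ≤ 2 * (S' * δ) := by
    intro i s hs
    have h1 : ‖ε i * s‖ ≤ S' * δ := by
      rw [norm_mul, Complex.norm_natCast, mul_comm]
      have : (s : ℝ) ≤ S' := by exact_mod_cast hs
      exact mul_le_mul this (hε i) (norm_nonneg _) (by positivity)
    have h2 := Complex.norm_exp_sub_one_le (x := ε i * s) (by linarith)
    linarith
  have hθ1 : ∀ i z, ‖z‖ ≤ 4 * S' → ‖θ i z - 1‖ ≤ E / 2 := by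
    intro i z hz
    simp only [θ, add_sub_cancel_left]
    calc _ ≤ ∑ s ∈ Finset.range S, ‖(Complex.exp (ε i * s) - 1) * g (z - s)‖ := norm_sum_le _ _
      _ ≤ ∑ s ∈ Finset.range S, 2 * (S' * δ) * G := by
          refine Finset.sum_le_sum fun s hs => ?_
          rw [Finset.mem_range] at hs
          rw [norm_mul]
          refine mul_le_mul (hexp1 i s (by omega)) ?_ (norm_nonneg _) (by positivity)
          refine (hgb _).trans (Real.exp_le_exp.mpr ?_)
          have h1 : ‖z - s‖ ≤ 5 * S' := by
            have h2 := norm_sub_le z (s : ℂ)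
            rw [Complex.norm_natCast] at h2
            have : (s : ℝ) ≤ S := by exact_mod_cast hs.le
            linarith
          gcongr
      _ = S * (2 * (S' * δ) * G) := by simp
      _ ≤ S' * (2 * (S' * δ) * G) := by gcongr
      _ ≤ E / 2 := by linarith
  have hFb : ∀ z : ℂ, ‖z‖ ≤ 4 * S' → ‖F z‖ ≤ Fintype.card ι * M * 2 := by
    intro z hz
    calc ‖F z‖ ≤ ∑ i, ‖c i z * θ i z‖ := norm_sum_le _ _
      _ ≤ ∑ _i : ι, M * 2 := by
          refine Finset.sum_le_sum fun i _ => ?_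
          rw [norm_mul]
          have h1 := hθ1 i z hz
          have h2 : ‖θ i z‖ ≤ 2 := by
            have h3 := norm_add_le (θ i z - 1) 1
            simp only [sub_add_cancel, norm_one] at h3
            linarith
          exact mul_le_mul (hcb i z hz) h2 (norm_nonneg _) ((norm_nonneg _).trans (hcb i z hz))
      _ = _ := by simp; ring
  have hord : ∀ s < S, (T : ℕ∞) ≤ analyticOrderAt F (s : ℂ) := by
    intro s hs
    let κ : ι → ℂ := fun i => a i * Complex.exp (ε i * s)
    have hW : ∀ i, W i = μ1 * u i + μ2 * v i := fun _ => rfl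
    have hGd : Differentiable ℂ (bkG κ u v W q t0 t1 t2) := fun z =>
      (bkG_hasDerivAt κ u v W q μ1 μ2 hW t0 t1 t2 z).differentiableAt
    have hGo : (T : ℕ∞) ≤ analyticOrderAt (bkG κ u v W q t0 t1 t2) (s : ℂ) := by
      rw [natCast_le_analyticOrderAt_iff_iteratedDeriv_eq_zero (hGd.analyticAt _)]
      intro j hj
      refine bkG_iteratedDeriv κ u v W q μ1 μ2 hW (2 * T) s ?_ j t0 t1 t2 (by omega)
      intro r0 r1 r2 hr
      rw [← hzero r0 r1 r2 s hr hs]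
      simp only [bkG, κ, W]
      refine Finset.sum_congr rfl fun i _ => ?_
      rw [add_mul _ (ε i), Complex.exp_add]
      ring
    obtain ⟨k, hk, hGk⟩ := bk_factor_one _ _ _ hGd hGo
    have hθf : ∀ i, ∃ k : ℂ → ℂ, Differentiable ℂ k ∧
        ∀ z, θ i z - Complex.exp (ε i * s) = (z - s) ^ T * k z := by
      intro i
      have hgs : ∀ s' : ℕ, ∃ k : ℂ → ℂ, Differentiable ℂ k ∧
          ∀ z, g (z - s') - (if s' = s then 1 else 0) = (z - s) ^ T * k z := by
        intro s'
        by_cases h : s' = s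
        · subst h
          obtain ⟨k, hk, hk2⟩ := bk_factor_one 0 T (fun z => g z - 1) (hgd.sub_const 1) hg0
          refine ⟨fun z => k (z - s'), hk.comp (differentiable_id.sub_const _), fun z => ?_⟩
          have := hk2 (z - s')
          simp only [sub_zero] at this
          simp [this]
        · obtain ⟨k, hk, hk2⟩ := bk_factor_one _ T g hgd (hg1 ((s : ℤ) - s') (by omega))
          refine ⟨fun z => k (z - s'), hk.comp (differentiable_id.sub_const _), fun z => ?_⟩
          have := hk2 (z - s')
          rw [if_neg h, sub_zero, this]
          push_cast
          ring
      choose k hk hk2 using hgs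
      refine ⟨fun z => ∑ s' ∈ Finset.range S, (Complex.exp (ε i * s') - 1) * k s' z,
        by fun_prop, fun z => ?_⟩
      have h1 : ∑ s' ∈ Finset.range S, (Complex.exp (ε i * s') - 1) *
          (if s' = s then (1 : ℂ) else 0) = Complex.exp (ε i * s) - 1 := by
        simp [Finset.sum_ite_eq', hs]
      have h2 : ∑ s' ∈ Finset.range S, (Complex.exp (ε i * s') - 1) * g (z - s') =
          ∑ s' ∈ Finset.range S, (Complex.exp (ε i * s') - 1) * ((z - s) ^ T * k s' z) +
          ∑ s' ∈ Finset.range S, (Complex.exp (ε i * s') - 1) *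
            (if s' = s then (1 : ℂ) else 0) := by
        rw [← Finset.sum_add_distrib]
        refine Finset.sum_congr rfl fun s' _ => ?_
        rw [← hk2]; ring
      simp only [θ]
      rw [h2, h1, Finset.mul_sum]
      have h3 : ∀ s' : ℕ, (z - s) ^ T * ((Complex.exp (ε i * s') - 1) * k s' z) =
        (Complex.exp (ε i * s') - 1) * ((z - s) ^ T * k s' z) := fun s' => by ring
      simp only [h3]
      ring
    choose k' hk' hk2' using hθf
    rw [natCast_le_analyticOrderAt (hFd.analyticAt _)]
    refine ⟨fun z => k z + ∑ i, c i z * k' i z, ?_, Filter.Eventually.of_forall fun z => ?_⟩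
    · have : Differentiable ℂ (fun z => k z + ∑ i, c i z * k' i z) := by fun_prop
      exact this.analyticAt _
    · rw [smul_eq_mul, mul_add, ← hGk, Finset.mul_sum]
      simp only [F, bkG, κ, ← Finset.sum_add_distrib]
      refine Finset.sum_congr rfl fun i _ => ?_
      have h1 : θ i z = Complex.exp (ε i * s) + (z - s) ^ T * k' i z := by rw [← hk2']; ring
      rw [h1]
      simp only [c]
      ring
  have hmain := bk_schwarz F hFd T S S' x _ hord hSS hS' hx hFb
  have hxn : ‖(x : ℂ)‖ ≤ 4 * S' := by
    rw [Complex.norm_natCast]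
    have : (x : ℝ) ≤ S' := by exact_mod_cast hx
    linarith
  have hdiff : ‖bkG a u v (fun i => μ1 * u i + μ2 * v i + ε i) q t0 t1 t2 x - F x‖ ≤
      Fintype.card ι * M * E := by
    have h1 : bkG a u v (fun i => μ1 * u i + μ2 * v i + ε i) q t0 t1 t2 x - F x =
        ∑ i, c i x * ((Complex.exp (ε i * x) - 1) - (θ i x - 1)) := by
      simp only [bkG, F, ← Finset.sum_sub_distrib]
      refine Finset.sum_congr rfl fun i _ => ?_
      rw [add_mul _ (ε i), Complex.exp_add]
      simp only [c, W]
      ring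
    rw [h1]
    calc _ ≤ ∑ i, ‖c i x * ((Complex.exp (ε i * x) - 1) - (θ i x - 1))‖ := norm_sum_le _ _
      _ ≤ ∑ _i : ι, M * E := by
          refine Finset.sum_le_sum fun i _ => ?_
          rw [norm_mul]
          have h2 : ‖(Complex.exp (ε i * x) - 1) - (θ i x - 1)‖ ≤ E := by
            have h3 := norm_sub_le (Complex.exp (ε i * x) - 1) (θ i x - 1)
            have h4 := hexp1 i x hx
            have h5 := hθ1 i x hxn
            linarith
          exact mul_le_mul (hcb i x hxn) h2 (norm_nonneg _) ((norm_nonneg _).trans (hcb i x hxn))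
      _ = _ := by simp; ring
  have h3 := norm_add_le (bkG a u v (fun i => μ1 * u i + μ2 * v i + ε i) q t0 t1 t2 x - F x) (F x)
  rw [sub_add_cancel] at h3
  linarith

noncomputable def bkBin (i : ℕ) : Polynomial ℚ :=
  ∏ j ∈ Finset.range i, (Polynomial.C (1 / ((j : ℚ) + 1)) * (Polynomial.X - Polynomial.C (j : ℚ)))

noncomputable def bkQ (h m : ℕ) : Polynomial ℚ := bkBin h ^ (m / h) * bkBin (m % h)

theorem bkBin_degree (i : ℕ) : (bkBin i).degree = i := by
  unfold bkBin
  rw [Polynomial.degree_prod]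
  have : ∀ j ∈ Finset.range i, (Polynomial.C (1 / ((j : ℚ) + 1)) * (Polynomial.X - Polynomial.C (j : ℚ))).degree = 1 := by
    intro j _
    rw [Polynomial.degree_mul, Polynomial.degree_X_sub_C, Polynomial.degree_C (by positivity)]
    simp
  rw [Finset.sum_congr rfl this]
  simp

theorem bkQ_degree (h m : ℕ) : (bkQ h m).degree = m := by
  unfold bkQ
  rw [Polynomial.degree_mul, Polynomial.degree_pow, bkBin_degree, bkBin_degree]
  have := Nat.div_add_mod m h
  conv_rhs => rw [← this]
  push_cast
  rw [nsmul_eq_mul, mul_comm]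

theorem bkQ_indep (h n : ℕ) (p : Fin n → ℝ)
    (hp : ∑ m, Polynomial.C (p m) * (bkQ h m).map (algebraMap ℚ ℝ) = 0) : p = 0 := by
  let S : Polynomial.Sequence ℝ := ⟨fun m => (bkQ h m).map (algebraMap ℚ ℝ), by
    intro i; rw [Polynomial.degree_map, bkQ_degree]⟩
  have h1 : LinearIndependent ℝ (fun m : Fin n => S (m : ℕ)) :=
    (S.linearIndependent).comp (fun m : Fin n => (m : ℕ)) Fin.val_injective
  rw [Fintype.linearIndependent_iff] at h1
  funext m
  refine h1 p ?_ m
  rw [← hp]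
  refine Finset.sum_congr rfl fun i _ => ?_
  rw [Polynomial.smul_eq_C_mul]

theorem bk_deriv_comp (p : Polynomial ℚ) (s d : ℚ) (n : ℕ) :
    Polynomial.derivative^[n] (p.comp (Polynomial.C s + Polynomial.C d * Polynomial.X)) =
      Polynomial.C (d ^ n) * (Polynomial.derivative^[n] p).comp (Polynomial.C s + Polynomial.C d * Polynomial.X) := by
  induction n with
  | zero => simp
  | succ n ih =>
    rw [Function.iterate_succ_apply', ih, Function.iterate_succ_apply', Polynomial.derivative_C_mul,
      Polynomial.derivative_comp]
    simp only [map_add, Polynomial.derivative_C, Polynomial.derivative_C_mul, Polynomial.derivative_X, zero_add, mul_one, pow_succ, map_mul]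
    ring

theorem bkBin_pascal (i : ℕ) : (bkBin (i+1)).comp (Polynomial.X + 1) = bkBin (i+1) + bkBin i := by
  have key : ∀ i : ℕ, (bkBin i).comp (Polynomial.X + 1) * (Polynomial.X - Polynomial.C (i : ℚ) + 1) = bkBin i * (Polynomial.X + 1) := by
    intro i
    induction i with
    | zero => simp [bkBin]
    | succ i ih =>
      have e : bkBin (i+1) = bkBin i * (Polynomial.C (1 / ((i : ℚ) + 1)) * (Polynomial.X - Polynomial.C (i : ℚ))) := by
        unfold bkBin; rw [Finset.prod_range_succ]
      rw [e, Polynomial.mul_comp]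
      simp only [Polynomial.mul_comp, Polynomial.C_comp, Polynomial.sub_comp, Polynomial.X_comp]
      push_cast
      simp only [map_add, map_one]
      linear_combination (Polynomial.C (1 / ((i : ℚ) + 1)) * (Polynomial.X - Polynomial.C (i : ℚ))) * ih
  have e : bkBin (i+1) = bkBin i * (Polynomial.C (1 / ((i : ℚ) + 1)) * (Polynomial.X - Polynomial.C (i : ℚ))) := by
    unfold bkBin; rw [Finset.prod_range_succ]
  have hc : (Polynomial.C (1 / ((i : ℚ) + 1))) * (Polynomial.C (i : ℚ) + 1) = 1 := by
    rw [← Polynomial.C_1, ← Polynomial.C_add, ← Polynomial.C_mul]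
    congr 1; field_simp
  rw [e]
  simp only [Polynomial.mul_comp, Polynomial.C_comp, Polynomial.sub_comp, Polynomial.X_comp]
  have := key i
  linear_combination Polynomial.C (1 / ((i : ℚ) + 1)) * this + bkBin i * hc

/-- integrality of the shifted and rescaled binomial polynomials -/
theorem bkBin_int (h d : ℕ) (hd : ∀ j, 1 ≤ j → j ≤ h → j ∣ d) (s : ℕ) : ∀ i ≤ h, ∃ r : Polynomial ℤ,
    (bkBin i).comp (Polynomial.C (s : ℚ) + Polynomial.C (d : ℚ) * Polynomial.X) = r.map (Int.castRingHom ℚ) := by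
  induction s with
  | zero =>
    intro i hi
    rcases Nat.eq_zero_or_pos i with rfl | hpos
    · exact ⟨1, by simp [bkBin]⟩
    · obtain ⟨k, rfl⟩ : ∃ k, i = k + 1 := ⟨i - 1, by omega⟩
      have claim : ∀ k, k + 1 ≤ h → ∃ r : Polynomial ℤ, Polynomial.C ((k : ℚ) + 1) * (bkBin (k+1)).comp (Polynomial.C (0 : ℚ) + Polynomial.C (d : ℚ) * Polynomial.X) = Polynomial.C (d : ℚ) * r.map (Int.castRingHom ℚ) := by
        intro k
        induction k with
        | zero => intro _; exact ⟨Polynomial.X, by simp [bkBin]⟩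
        | succ k ih =>
          intro hk
          obtain ⟨r, hr⟩ := ih (by omega)
          obtain ⟨g, hg⟩ := hd (k+1) (by omega) (by omega)
          refine ⟨r * (Polynomial.C (g : ℤ) * Polynomial.X - 1), ?_⟩
          have e : bkBin (k+1+1) = bkBin (k+1) * (Polynomial.C (1 / (((k+1 : ℕ) : ℚ) + 1)) * (Polynomial.X - Polynomial.C ((k+1 : ℕ) : ℚ))) := by
            unfold bkBin; rw [Finset.prod_range_succ]
          have hc : (Polynomial.C (((k+1 : ℕ) : ℚ) + 1)) * Polynomial.C (1 / (((k+1 : ℕ) : ℚ) + 1)) = 1 := by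
            rw [← Polynomial.C_1, ← Polynomial.C_mul]
            congr 1; field_simp
          rw [e]
          simp only [Polynomial.mul_comp, Polynomial.C_comp, Polynomial.sub_comp, Polynomial.X_comp]
          have hg2 : Polynomial.C (d : ℚ) = Polynomial.C ((k : ℚ) + 1) * Polynomial.C (g : ℚ) := by
            rw [← Polynomial.C_mul, hg]; push_cast; rfl
          have hk1 : Polynomial.C ((k+1 : ℕ) : ℚ) = Polynomial.C ((k : ℚ) + 1) := by push_cast; rfl
          simp only [Polynomial.map_mul, Polynomial.map_sub, Polynomial.map_C, Polynomial.map_X, Polynomial.map_one]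
          have hgg : (Int.castRingHom ℚ) (g : ℤ) = (g : ℚ) := by simp
          rw [hgg]
          set B := (bkBin (k+1)).comp (Polynomial.C (0 : ℚ) + Polynomial.C (d : ℚ) * Polynomial.X)
          rw [hk1] 
          have : Polynomial.C (0:ℚ) = 0 := Polynomial.C_0
          rw [this]
          calc _ = (Polynomial.C (((k+1 : ℕ) : ℚ) + 1)) * Polynomial.C (1 / (((k+1 : ℕ) : ℚ) + 1)) * (B * (Polynomial.C (d : ℚ) * Polynomial.X - Polynomial.C ((k : ℚ) + 1))) := by ring
            _ = B * (Polynomial.C (d : ℚ) * Polynomial.X - Polynomial.C ((k : ℚ) + 1)) := by rw [hc, one_mul]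
            _ = (Polynomial.C ((k:ℚ) + 1) * B) * (Polynomial.C (g : ℚ) * Polynomial.X - 1) := by
                conv_lhs => rw [hg2]
                ring
            _ = _ := by rw [hr]; ring
      obtain ⟨r, hr⟩ := claim k hi
      obtain ⟨g, hg⟩ := hd (k+1) (by omega) hi
      refine ⟨Polynomial.C (g : ℤ) * r, ?_⟩
      have hne : Polynomial.C ((k : ℚ) + 1) ≠ 0 := by
        rw [Ne, Polynomial.C_eq_zero]; positivity
      apply mul_left_cancel₀ hne
      have hg2 : Polynomial.C (d : ℚ) = Polynomial.C ((k : ℚ) + 1) * Polynomial.C (g : ℚ) := by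
        rw [← Polynomial.C_mul, hg]; push_cast; rfl
      have hgg : (Int.castRingHom ℚ) (g : ℤ) = (g : ℚ) := by simp
      simp only [Polynomial.map_mul, Polynomial.map_C, hgg]
      simp only [Nat.cast_zero]
      rw [hr, hg2]; ring
  | succ s ih =>
    intro i hi
    rcases Nat.eq_zero_or_pos i with rfl | hpos
    · exact ⟨1, by simp [bkBin]⟩
    · obtain ⟨k, rfl⟩ : ∃ k, i = k + 1 := ⟨i - 1, by omega⟩
      obtain ⟨r1, h1⟩ := ih (k+1) hi
      obtain ⟨r2, h2⟩ := ih k (by omega)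
      refine ⟨r1 + r2, ?_⟩
      rw [Polynomial.map_add, ← h1, ← h2, ← Polynomial.add_comp, ← bkBin_pascal, Polynomial.comp_assoc]
      congr 1
      simp
      ring

theorem bkQ_int (h d : ℕ) (hh : 0 < h) (hd : ∀ j, 1 ≤ j → j ≤ h → j ∣ d) (m s t : ℕ) :
    ∃ k : ℤ, (k : ℚ) = (d : ℚ) ^ t * (Polynomial.derivative^[t] (bkQ h m)).eval (s : ℚ) := by
  obtain ⟨r1, h1⟩ := bkBin_int h d hd s h le_rfl
  obtain ⟨r2, h2⟩ := bkBin_int h d hd s (m % h) (Nat.mod_lt _ hh).le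
  have e : (bkQ h m).comp (Polynomial.C (s : ℚ) + Polynomial.C (d : ℚ) * Polynomial.X) = (r1 ^ (m/h) * r2).map (Int.castRingHom ℚ) := by
    unfold bkQ
    rw [Polynomial.mul_comp, Polynomial.pow_comp, h1, h2]; simp
  have e2 := bk_deriv_comp (bkQ h m) s d t
  rw [e] at e2
  have e3 := congrArg (Polynomial.eval 0) e2
  rw [Polynomial.iterate_derivative_map] at e3
  simp only [Polynomial.eval_mul, Polynomial.eval_C, Polynomial.eval_comp, Polynomial.eval_add, Polynomial.eval_X, mul_zero, add_zero] at e3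
  refine ⟨(Polynomial.derivative^[t] (r1 ^ (m/h) * r2)).eval 0, ?_⟩
  rw [← e3]
  rw [Polynomial.eval_zero_map]; simp

theorem bkBin_bound (i h R : ℕ) (hi : i ≤ h) (z : ℂ) (hz : ‖z‖ ≤ R) :
    ‖((bkBin i).map (algebraMap ℚ ℂ)).eval z‖ ≤ 2 ^ (R + h) := by
  have claim : ∀ i : ℕ, ‖((bkBin i).map (algebraMap ℚ ℂ)).eval z‖ ≤ ((R + i).choose i : ℝ) := by
    intro i
    induction i with
    | zero => simp [bkBin]
    | succ i ih =>
      have e : bkBin (i+1) = bkBin i * (Polynomial.C (1 / ((i : ℚ) + 1)) * (Polynomial.X - Polynomial.C (i : ℚ))) := by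
        unfold bkBin; rw [Finset.prod_range_succ]
      rw [e]
      simp only [Polynomial.map_mul, Polynomial.map_sub, Polynomial.map_C, Polynomial.map_X, Polynomial.eval_mul, Polynomial.eval_sub, Polynomial.eval_C, Polynomial.eval_X, norm_mul]
      have hc : ((R + i + 1 : ℕ) : ℝ) * ((R+i).choose i : ℝ) = ((R + (i+1)).choose (i+1) : ℝ) * (i + 1) := by
        have := Nat.add_one_mul_choose_eq (R+i) i
        exact_mod_cast this
      have hn : ‖(algebraMap ℚ ℂ) (1 / ((i:ℚ) + 1))‖ = 1 / ((i : ℝ) + 1) := by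
        have : (algebraMap ℚ ℂ) (1 / ((i:ℚ) + 1)) = (((1 / ((i:ℝ) + 1)) : ℝ) : ℂ) := by
          push_cast; simp
        rw [this, Complex.norm_real, Real.norm_eq_abs, abs_of_pos (by positivity)]
      have hz2 : ‖z - (algebraMap ℚ ℂ) (i:ℚ)‖ ≤ ((R + i + 1 : ℕ) : ℝ) := by
        refine (norm_sub_le _ _).trans ?_
        have : ‖(algebraMap ℚ ℂ) (i:ℚ)‖ = i := by simp
        rw [this]; push_cast; linarith
      rw [hn]
      calc _ ≤ ((R + i).choose i : ℝ) * (1 / ((i : ℝ) + 1) * ((R + i + 1 : ℕ) : ℝ)) := by gcongr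
        _ = (((R + i + 1 : ℕ) : ℝ) * ((R+i).choose i : ℝ)) / (i+1) := by ring
        _ = ((R + (i+1)).choose (i+1) : ℝ) := by rw [hc]; field_simp
        _ ≤ _ := le_rfl
  refine (claim i).trans ?_
  calc ((R + i).choose i : ℝ) ≤ ((2 ^ (R + i) : ℕ) : ℝ) := by exact_mod_cast Nat.choose_le_two_pow _ _
    _ = 2 ^ (R + i) := by push_cast; rfl
    _ ≤ _ := pow_le_pow_right₀ (by norm_num) (by omega)

theorem bkQ_bound (h m L R : ℕ) (hh : 0 < h) (hm : m < L * h) (z : ℂ) (hz : ‖z‖ ≤ R) :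
    ‖((bkQ h m).map (algebraMap ℚ ℂ)).eval z‖ ≤ 2 ^ ((R + h) * L) := by
  unfold bkQ
  simp only [Polynomial.map_mul, Polynomial.map_pow, Polynomial.eval_mul, Polynomial.eval_pow, norm_mul, norm_pow]
  have h1 := bkBin_bound h h R le_rfl z hz
  have h2 := bkBin_bound (m % h) h R (Nat.mod_lt _ hh).le z hz
  have h3 : m / h + 1 ≤ L := by
    have : m / h < L := by rwa [Nat.div_lt_iff_lt_mul hh]
    omega
  calc _ ≤ ((2:ℝ) ^ (R + h)) ^ (m/h) * 2 ^ (R + h) := by gcongr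
    _ = 2 ^ ((R+h) * (m/h+1)) := by rw [← pow_succ, ← pow_mul]
    _ ≤ _ := pow_le_pow_right₀ (by norm_num) (by gcongr)

theorem bk_poly_iteratedDeriv (p : Polynomial ℂ) (t : ℕ) :
    iteratedDeriv t (fun z => p.eval z) = fun z => (Polynomial.derivative^[t] p).eval z := by
  induction t with
  | zero => simp
  | succ t ih =>
    rw [iteratedDeriv_succ, ih, Function.iterate_succ_apply']
    funext z
    rw [Polynomial.deriv]

theorem bkQ_deriv_bound (h m L R t : ℕ) (hh : 0 < h) (hm : m < L * h) (z : ℂ) (hz : ‖z‖ ≤ R) :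
    ‖(Polynomial.derivative^[t] ((bkQ h m).map (algebraMap ℚ ℂ))).eval z‖ ≤ t.factorial * 2 ^ ((R + 1 + h) * L) := by
  have := Complex.norm_iteratedDeriv_le_of_forall_mem_sphere_norm_le (c := z) (R := 1) (C := 2 ^ ((R + 1 + h) * L)) (f := fun z => ((bkQ h m).map (algebraMap ℚ ℂ)).eval z) t one_pos
    (Polynomial.differentiable _).diffContOnCl ?_
  · rw [bk_poly_iteratedDeriv] at this
    simpa using this
  · intro w hw
    refine bkQ_bound h m L (R+1) hh hm w ?_
    rw [mem_sphere_iff_norm] at hw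
    have : ‖w‖ ≤ ‖w - z‖ + ‖z‖ := by simpa using norm_add_le (w - z) z
    push_cast; linarith
 
theorem bk_lcm (h : ℕ) : ∃ d : ℕ, 0 < d ∧ (∀ j, 1 ≤ j → j ≤ h → j ∣ d) ∧ (d : ℝ) ≤ Real.exp (6 * h) := by
  refine ⟨Nat.lcmUpto h, Nat.lcmUpto_pos h, ?_, ?_⟩
  · intro j h1 h2
    exact Finset.dvd_lcm (f := id) (by simp; omega)
  · have h1 := Chebyshev.psi_eq_log_lcmUpto h
    have h2 := Chebyshev.psi_le_const_mul_self (x := (h : ℝ)) (by positivity)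
    rw [h1] at h2
    have hp : (0:ℝ) < Nat.lcmUpto h := by exact_mod_cast Nat.lcmUpto_pos h
    rw [← Real.log_le_iff_le_exp hp]
    refine h2.trans ?_
    have : Real.log 4 ≤ 2 := by
      have : Real.log 4 = 2 * Real.log 2 := by
        rw [show (4:ℝ) = 2^2 by norm_num, Real.log_pow]; norm_num
      rw [this]; linarith [Real.log_two_lt_d9]
    have : (0:ℝ) ≤ h := by positivity
    nlinarith

abbrev BkI (L h : ℕ) := Fin (L * h) × Fin L × Fin L × Fin L

def bkLam {L h : ℕ} (i : BkI L h) : Fin 3 → ℕ := ![(i.2.1 : ℕ), (i.2.2.1 : ℕ), (i.2.2.2 : ℕ)]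

theorem bkLam_lt {L h : ℕ} (i : BkI L h) (j : Fin 3) : bkLam i j < L := by
  fin_cases j
  · exact i.2.1.2
  · exact i.2.2.1.2
  · exact i.2.2.2.2

def bkU {L h : ℕ} (b : Fin 3 → ℤ) (i : BkI L h) : ℤ := b 2 * (bkLam i 0 : ℤ) - b 0 * (bkLam i 2 : ℤ)
def bkV {L h : ℕ} (b : Fin 3 → ℤ) (i : BkI L h) : ℤ := b 2 * (bkLam i 1 : ℤ) - b 1 * (bkLam i 2 : ℤ)
noncomputable def bkW {L h : ℕ} (a : Fin 3 → ℝ) (i : BkI L h) : ℝ := ∑ j, (bkLam i j : ℝ) * Real.log (a j)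
noncomputable def bkq {L h : ℕ} (i : BkI L h) : Polynomial ℂ := (bkQ h (i.1 : ℕ)).map (algebraMap ℚ ℂ)

noncomputable def bkZ {L h : ℕ} (a : Fin 3 → ℝ) (b : Fin 3 → ℤ) (p : BkI L h → ℤ) (t0 t1 t2 s : ℕ) : ℂ :=
  bkG (fun i => (p i : ℂ)) (fun i => (bkU b i : ℂ)) (fun i => (bkV b i : ℂ)) (fun i => ((bkW a i : ℝ) : ℂ))
    bkq t0 t1 t2 (s : ℂ)

theorem bk_exp_w {L h : ℕ} (a : Fin 3 → ℝ) (ha : ∀ j, 0 < a j) (i : BkI L h) (s : ℕ) :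
    Real.exp (bkW a i * s) = ∏ j, a j ^ (bkLam i j * s) := by
  unfold bkW
  rw [Finset.sum_mul, Real.exp_sum]
  refine Finset.prod_congr rfl fun j _ => ?_
  rw [show (bkLam i j : ℝ) * Real.log (a j) * s = ((bkLam i j * s : ℕ) : ℝ) * Real.log (a j) by push_cast; ring]
  rw [Real.exp_nat_mul, Real.exp_log (ha j)]

theorem bk_arith {L h : ℕ} (hh : 0 < h) (a : Fin 3 → ℝ) (ha : ∀ j, 0 < a j) (D0 : ℕ)
    (hD0 : ∀ j, 1 ≤ j → j ≤ h → j ∣ D0) (t0 s : ℕ) :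
    ∃ kq : BkI L h → ℤ, (∀ i, |(kq i : ℝ)| ≤ (D0 : ℝ) ^ t0 * (t0.factorial * 2 ^ ((s + 1 + h) * L))) ∧
      ∀ (t1 t2 : ℕ) (b : Fin 3 → ℤ) (p : BkI L h → ℤ), (D0 : ℂ) ^ t0 * bkZ a b p t0 t1 t2 s =
        ((∑ i, ((p i * (bkU b i ^ t1 * bkV b i ^ t2 * kq i) : ℤ) : ℝ) * ∏ j, a j ^ (bkLam i j * s) : ℝ) : ℂ) := by
  have H := fun i : BkI L h => bkQ_int h D0 hh hD0 (i.1 : ℕ) s t0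
  choose kq hkq using H
  have hc : ∀ i, ((kq i : ℤ) : ℂ) = (D0 : ℂ) ^ t0 * (Polynomial.derivative^[t0] (bkq i)).eval (s : ℂ) := by
    intro i
    have h1 := congrArg (algebraMap ℚ ℂ) (hkq i)
    have h2 : (Polynomial.derivative^[t0] (bkq i)).eval (s : ℂ) = algebraMap ℚ ℂ ((Polynomial.derivative^[t0] (bkQ h i.1)).eval (s:ℚ)) := by
      unfold bkq
      rw [Polynomial.iterate_derivative_map]
      have : (s : ℂ) = algebraMap ℚ ℂ (s : ℚ) := by simp
      rw [this, Polynomial.eval_map, Polynomial.eval₂_at_apply]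
    rw [h2]
    rw [map_mul, map_pow] at h1
    simpa using h1
  refine ⟨kq, ?_, ?_⟩
  · intro i
    have h1 : |(kq i : ℝ)| = ‖((kq i : ℤ) : ℂ)‖ := by
      rw [Complex.norm_intCast]
    rw [h1, hc, norm_mul, norm_pow, Complex.norm_natCast]
    gcongr
    exact bkQ_deriv_bound h i.1 L s t0 hh i.1.2 s (by simp)
  · intro t1 t2 b p
    unfold bkZ bkG
    rw [Finset.mul_sum, Complex.ofReal_sum]
    refine Finset.sum_congr rfl fun i _ => ?_
    rw [← bk_exp_w a ha]
    push_cast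
    rw [hc]
    ring

theorem bk_van {L h : ℕ} (hh : 0 < h) (a : Fin 3 → ℝ) (ha : ∀ j, 0 < a j) (D0 : ℕ) (hD0p : 0 < D0)
    (hD0 : ∀ j, 1 ≤ j → j ≤ h → j ∣ D0) (c d : ℕ)
    (hLiou : ∀ (ι : Type) (s : Finset ι) (k : ι → ℤ) (e : ι → Fin 3 → ℕ) (D : ℕ) (H : ℝ), 1 ≤ H →
      (∀ i ∈ s, ∀ j, e i j ≤ D) → ∑ i ∈ s, |(k i : ℝ)| ≤ H →
      (∑ i ∈ s, (k i : ℝ) * ∏ j, a j ^ e i j) ≠ 0 →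
      1 ≤ |∑ i ∈ s, (k i : ℝ) * ∏ j, a j ^ e i j| * (H ^ d * (c : ℝ) ^ D))
    (b : Fin 3 → ℤ) (p : BkI L h → ℤ) (t0 t1 t2 s : ℕ) (Y U H : ℝ) (hU : ∀ i : BkI L h, |(bkU b i : ℝ)| ≤ U)
    (hV : ∀ i : BkI L h, |(bkV b i : ℝ)| ≤ U) (hp : ∀ i, |(p i : ℝ)| ≤ Y) (hH1 : 1 ≤ H)
    (hH : (L : ℝ) ^ 4 * h * (Y * (U ^ t1 * U ^ t2 * ((D0 : ℝ) ^ t0 * (t0.factorial * 2 ^ ((s + 1 + h) * L))))) ≤ H)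
    (hsmall : (D0 : ℝ) ^ t0 * ‖bkZ a b p t0 t1 t2 s‖ * (H ^ d * (c : ℝ) ^ (L * s)) < 1) :
    bkZ a b p t0 t1 t2 s = 0 := by
  obtain ⟨kq, hkq, hid⟩ := bk_arith (L := L) hh a ha D0 hD0 t0 s
  have h1 := hid t1 t2 b p
  by_contra hne
  have hne2 : (∑ i, ((p i * (bkU b i ^ t1 * bkV b i ^ t2 * kq i) : ℤ) : ℝ) * ∏ j, a j ^ (bkLam i j * s) : ℝ) ≠ 0 := by
    intro h0
    rw [h0] at h1
    have : (D0 : ℂ) ^ t0 ≠ 0 := pow_ne_zero _ (by exact_mod_cast hD0p.ne')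
    rw [Complex.ofReal_zero] at h1
    exact (mul_ne_zero this hne) h1
  have h2 := hLiou (BkI L h) Finset.univ (fun i => p i * (bkU b i ^ t1 * bkV b i ^ t2 * kq i))
    (fun i j => bkLam i j * s) (L * s) H hH1 (fun i _ j => Nat.mul_le_mul_right _ (bkLam_lt i j).le) ?_ hne2
  · have h3 := congrArg norm h1
    rw [norm_mul, norm_pow, Complex.norm_natCast, Complex.norm_real, Real.norm_eq_abs] at h3
    rw [h3] at hsmall
    linarith
  · refine le_trans ?_ hH
    calc _ ≤ ∑ i : BkI L h, (Y * (U ^ t1 * U ^ t2 * ((D0 : ℝ) ^ t0 * (t0.factorial * 2 ^ ((s + 1 + h) * L))))) := by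
          refine Finset.sum_le_sum fun i _ => ?_
          push_cast
          rw [abs_mul, abs_mul, abs_mul, abs_pow, abs_pow]
          have hY0 : 0 ≤ Y := (abs_nonneg _).trans (hp i)
          have hU0 : 0 ≤ U := (abs_nonneg _).trans (hU i)
          gcongr
          · exact hp i
          · exact hU i
          · exact hV i
          · exact hkq i
      _ = _ := by
          rw [Finset.sum_const, nsmul_eq_mul]
          congr 1
          simp [Finset.card_univ, Fintype.card_prod]
          ring

theorem bkW_abs {L h : ℕ} (a : Fin 3 → ℝ) (lam : ℝ) (hlam : ∀ j, |Real.log (a j)| ≤ lam) (i : BkI L h) :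
    |bkW a i| ≤ 3 * L * lam := by
  unfold bkW
  refine (Finset.abs_sum_le_sum_abs _ _).trans ?_
  calc _ ≤ ∑ j : Fin 3, (L : ℝ) * lam := by
        refine Finset.sum_le_sum fun j _ => ?_
        rw [abs_mul, Nat.abs_cast]
        have : (bkLam i j : ℝ) ≤ L := by exact_mod_cast (bkLam_lt i j).le
        gcongr
        exact hlam j
    _ = _ := by simp; ring

theorem bk_two_pow_le (n : ℕ) : (2:ℝ) ^ n ≤ Real.exp n := by
  have : (2:ℝ) ≤ Real.exp 1 := by linarith [Real.add_one_le_exp (1:ℝ)]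
  calc (2:ℝ) ^ n ≤ (Real.exp 1) ^ n := by gcongr
    _ = _ := by rw [← Real.exp_nat_mul]; simp

theorem bkUV_abs {L h : ℕ} (b : Fin 3 → ℤ) (hb : ∀ j, |(b j : ℝ)| ≤ 2 ^ h) (hL : 2 * (L : ℝ) ≤ Real.exp h) (i : BkI L h) :
    |(bkU b i : ℝ)| ≤ Real.exp (2 * h) ∧ |(bkV b i : ℝ)| ≤ Real.exp (2 * h) := by
  have key : ∀ j k : Fin 3, |(b 2 : ℝ) * (bkLam i j : ℝ) - b k * (bkLam i 2 : ℝ)| ≤ Real.exp (2 * h) := by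
    intro j k
    refine (abs_sub _ _).trans ?_
    rw [abs_mul, abs_mul, Nat.abs_cast, Nat.abs_cast]
    have h1 : (bkLam i j : ℝ) ≤ L := by exact_mod_cast (bkLam_lt i j).le
    have h2 : (bkLam i 2 : ℝ) ≤ L := by exact_mod_cast (bkLam_lt i 2).le
    calc _ ≤ (2:ℝ) ^ h * L + 2 ^ h * L := by
          gcongr
          · exact hb 2
          · exact hb k
      _ = 2 ^ h * (2 * L) := by ring
      _ ≤ Real.exp h * Real.exp h := by
          gcongr
          exact bk_two_pow_le h
      _ = _ := by rw [← Real.exp_add]; ring_nf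
  unfold bkU bkV
  push_cast
  exact ⟨key 0 0, key 1 1⟩

theorem bk_entry {L h T σ : ℕ} (D0 : ℕ) (hσ : 1 ≤ σ) (hh : 1 ≤ h) (hD0 : (D0 : ℝ) ≤ Real.exp (6 * h)) (hD1 : 0 < D0)
    (hT : (T : ℝ) ≤ Real.exp h) (t0 t1 t2 s : ℕ) (ht0 : t0 ≤ T) (ht1 : t1 ≤ T) (ht2 : t2 ≤ T) (hs : s ≤ σ * h) :
    Real.exp (2 * h) ^ t1 * Real.exp (2 * h) ^ t2 * ((D0 : ℝ) ^ t0 * (t0.factorial * 2 ^ ((s + 1 + h) * L))) ≤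
      Real.exp ((11 * T + 3 * L * σ) * h) := by
  have e1 : ∀ t ≤ T, Real.exp (2 * h) ^ t ≤ Real.exp (2 * h * T) := by
    intro t ht
    rw [← Real.exp_nat_mul]
    apply Real.exp_le_exp.mpr
    have : (t : ℝ) ≤ T := by exact_mod_cast ht
    have h0 : (0:ℝ) ≤ h := by positivity
    nlinarith
  have e2 : (D0 : ℝ) ^ t0 ≤ Real.exp (6 * h * T) := by
    calc (D0 : ℝ) ^ t0 ≤ Real.exp (6 * h) ^ t0 := by gcongr
      _ = Real.exp (t0 * (6 * h)) := by rw [← Real.exp_nat_mul]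
      _ ≤ _ := by
        apply Real.exp_le_exp.mpr
        have : (t0 : ℝ) ≤ T := by exact_mod_cast ht0
        have h0 : (0:ℝ) ≤ h := by positivity
        nlinarith
  have e3 : (t0.factorial : ℝ) ≤ Real.exp (h * T) := by
    rcases Nat.eq_zero_or_pos T with h0 | hTp
    · have : t0 = 0 := by omega
      subst this; simp; positivity
    calc (t0.factorial : ℝ) ≤ (t0 : ℝ) ^ t0 := by exact_mod_cast Nat.factorial_le_pow t0
      _ ≤ (T : ℝ) ^ t0 := by gcongr
      _ ≤ (T : ℝ) ^ T := pow_le_pow_right₀ (by exact_mod_cast hTp) ht0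
      _ ≤ Real.exp h ^ T := by gcongr
      _ = _ := by rw [← Real.exp_nat_mul]; ring_nf
  have e4 : (2:ℝ) ^ ((s + 1 + h) * L) ≤ Real.exp (3 * L * σ * h) := by
    refine (bk_two_pow_le _).trans ?_
    apply Real.exp_le_exp.mpr
    have : (s + 1 + h) * L ≤ 3 * L * σ * h := by
      have : s + 1 + h ≤ 3 * σ * h := by nlinarith
      calc _ ≤ 3 * σ * h * L := by gcongr
        _ = _ := by ring
    exact_mod_cast this
  calc _ ≤ Real.exp (2 * h * T) * Real.exp (2 * h * T) * (Real.exp (6 * h * T) * (Real.exp (h * T) * Real.exp (3 * L * σ * h))) := by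
        have := e1 t1 ht1
        have := e1 t2 ht2
        gcongr
    _ = _ := by simp only [← Real.exp_add]; ring_nf

set_option maxHeartbeats 1600000 in
theorem bk_begin {L h T σ : ℕ} (hh : 1 ≤ h) (a : Fin 3 → ℝ) (ha : ∀ j, 0 < a j) (D0 : ℕ) (hD0p : 0 < D0)
    (hD0 : ∀ j, 1 ≤ j → j ≤ h → j ∣ D0) (hD0e : (D0 : ℝ) ≤ Real.exp (6 * h)) (c d : ℕ) (hd : 1 ≤ d)
    (hLiou : ∀ (ι : Type) (s : Finset ι) (k : ι → ℤ) (e : ι → Fin 3 → ℕ) (D : ℕ) (H : ℝ), 1 ≤ H →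
      (∀ i ∈ s, ∀ j, e i j ≤ D) → ∑ i ∈ s, |(k i : ℝ)| ≤ H →
      (∑ i ∈ s, (k i : ℝ) * ∏ j, a j ^ e i j) ≠ 0 →
      1 ≤ |∑ i ∈ s, (k i : ℝ) * ∏ j, a j ^ e i j| * (H ^ d * (c : ℝ) ^ D))
    (lam : ℕ) (hlam1 : 1 ≤ lam) (hlam : ∀ j, |Real.log (a j)| ≤ lam)
    (b : Fin 3 → ℤ) (hb : ∀ j, |(b j : ℝ)| ≤ 2 ^ h)
    (hL : 2 * (L : ℝ) ≤ Real.exp h) (hT : (T : ℝ) ≤ Real.exp h) (hN : (L : ℝ) ^ 4 * h ≤ Real.exp h)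
    (hσ : 1 ≤ σ) (hT1 : 1 ≤ T) (hp1 : 6 * L * σ * lam + 2 ≤ 2 * T) (hp2 : c * (L * σ) ≤ T)
    (hp3 : (8 * d + 1) * (T ^ 3 * σ) ≤ L ^ 4) :
    ∃ p : BkI L h → ℤ, p ≠ 0 ∧ (∀ i, |(p i : ℝ)| ≤ Real.exp (13 * T * h)) ∧
      ∀ t0 t1 t2 s : ℕ, t0 + t1 + t2 < T → s < σ * h → bkZ a b p t0 t1 t2 s = 0 := by
  have hh0 : (1:ℝ) ≤ h := by exact_mod_cast hh
  have hT1' : (1:ℝ) ≤ T := by exact_mod_cast hT1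
  have HA := fun t0 s => bk_arith (L := L) hh a ha D0 hD0 t0 s
  choose kq hkq hid using HA
  have hp1' : 6 * (L:ℝ) * σ * lam + 2 ≤ 2 * T := by exact_mod_cast hp1
  have hp2' : (c:ℝ) * (L * σ) ≤ T := by exact_mod_cast hp2
  have hlam1' : (1:ℝ) ≤ lam := by exact_mod_cast hlam1
  have hLs : (0:ℝ) ≤ L * σ := by positivity
  have hLs2 : (L:ℝ) * σ ≤ L * σ * lam := le_mul_of_one_le_right hLs hlam1'
  set Y : ℝ := Real.exp (13 * T * h) with hYdef
  have hY2 : 2 ≤ Y := by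
    have : (13 * T * h : ℝ) ≥ 1 := by nlinarith
    have := Real.add_one_le_exp (13 * T * h : ℝ)
    linarith
  let A : (Fin T × Fin T × Fin T × Fin (σ * h)) → BkI L h → ℝ := fun r i =>
    ((bkU b i : ℝ) ^ (r.2.1 : ℕ) * (bkV b i : ℝ) ^ (r.2.2.1 : ℕ) * (kq r.1 r.2.2.2 i : ℝ)) * ∏ j, a j ^ (bkLam i j * (r.2.2.2 : ℕ))
  have hcardβ : (Fintype.card (BkI L h) : ℝ) = (L : ℝ) ^ 4 * h := by
    simp [Fintype.card_prod]; ring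
  have hg0 : ∀ i j, |A i j| ≤ Real.exp ((11 * T + 6 * L * σ * lam) * h) := by
    rintro ⟨t0, t1, t2, s⟩ i
    simp only [A]
    rw [abs_mul, abs_mul, abs_mul, abs_pow, abs_pow, ← bk_exp_w a ha, Real.abs_exp]
    have h1 := (bkUV_abs b hb hL i).1
    have h2 := (bkUV_abs b hb hL i).2
    have he := bk_entry (L := L) (T := T) D0 hσ hh hD0e hD0p hT t0 t1 t2 s t0.2.le t1.2.le t2.2.le s.2.le
    have hw := (abs_le.mp (bkW_abs a lam hlam i)).2
    calc _ ≤ (Real.exp (2 * h) ^ (t1:ℕ) * Real.exp (2 * h) ^ (t2:ℕ) * ((D0 : ℝ) ^ (t0:ℕ) * ((t0:ℕ).factorial * 2 ^ (((s:ℕ) + 1 + h) * L)))) * Real.exp (3 * L * lam * (σ * h)) := by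
          have := hkq t0 s i
          have hs' : ((s:ℕ):ℝ) ≤ σ * h := by exact_mod_cast s.2.le
          gcongr
      _ ≤ Real.exp ((11 * T + 3 * L * σ) * h) * Real.exp (3 * L * lam * (σ * h)) := by gcongr
      _ = Real.exp ((11 * T + 3 * L * σ) * h + 3 * L * lam * (σ * h)) := by rw [Real.exp_add]
      _ ≤ _ := by
        apply Real.exp_le_exp.mpr
        nlinarith
  have hg1 : (Fintype.card (BkI L h) : ℝ) * (Real.exp ((11 * T + 6 * L * σ * lam) * h) + 1) ≤ Y := by
    rw [hcardβ]
    have h1 : Real.exp ((11 * T + 6 * L * σ * lam) * h) + 1 ≤ Real.exp h * Real.exp ((11 * T + 6 * L * σ * lam) * h) := by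
      have e1 : 2 ≤ Real.exp h := by linarith [Real.add_one_le_exp (h:ℝ)]
      have e2 : 1 ≤ Real.exp ((11 * T + 6 * L * σ * lam) * h) := Real.one_le_exp (by positivity)
      nlinarith
    calc _ ≤ Real.exp h * (Real.exp h * Real.exp ((11 * T + 6 * L * σ * lam) * h)) := by gcongr
      _ = Real.exp (h + (h + (11 * T + 6 * L * σ * lam) * h)) := by rw [Real.exp_add, Real.exp_add]
      _ ≤ _ := by
        apply Real.exp_le_exp.mpr
        nlinarith
  have hg2 : (8*d+1) * Fintype.card (Fin T × Fin T × Fin T × Fin (σ * h)) ≤ Fintype.card (BkI L h) := by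
    simp only [Fintype.card_prod, Fintype.card_fin]
    calc _ = (8 * d + 1) * (T ^ 3 * σ) * h := by ring
      _ ≤ L ^ 4 * h := by gcongr
      _ = _ := by ring
  have hg3 : 0 < Fintype.card (Fin T × Fin T × Fin T × Fin (σ * h)) := by
    simp only [Fintype.card_prod, Fintype.card_fin]
    positivity
  obtain ⟨p, hp0, hpY, hpA⟩ := bk_siegel A Y (Real.exp ((11 * T + 6 * L * σ * lam) * h)) d hd (Real.exp_pos _).le hg0 (by linarith) hg1 hg2 hg3
  refine ⟨p, hp0, hpY, ?_⟩
  intro t0 t1 t2 s ht hs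
  have hA := hpA (⟨t0, by omega⟩, ⟨t1, by omega⟩, ⟨t2, by omega⟩, ⟨s, hs⟩)
  have hN' : (D0 : ℝ) ^ t0 * ‖bkZ a b p t0 t1 t2 s‖ = |∑ j, A (⟨t0, by omega⟩, ⟨t1, by omega⟩, ⟨t2, by omega⟩, ⟨s, hs⟩) j * (p j : ℝ)| := by
    have h3 := congrArg norm (hid t0 s t1 t2 b p)
    rw [norm_mul, norm_pow, Complex.norm_natCast, Complex.norm_real, Real.norm_eq_abs] at h3
    rw [h3]
    congr 1
    refine Finset.sum_congr rfl fun i _ => ?_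
    simp only [A]
    push_cast
    ring
  refine bk_van hh a ha D0 hD0p hD0 c d hLiou b p t0 t1 t2 s Y (Real.exp (2*h)) (Y^2)
    (fun i => (bkUV_abs b hb hL i).1) (fun i => (bkUV_abs b hb hL i).2) hpY (one_le_pow₀ (by linarith)) ?_ ?_
  · have he := bk_entry (L := L) (T := T) D0 hσ hh hD0e hD0p hT t0 t1 t2 s (by omega) (by omega) (by omega) hs.le
    calc _ ≤ Real.exp h * (Y * Real.exp ((11 * T + 3 * L * σ) * h)) := by gcongr
      _ = Y * (Real.exp (h + (11 * T + 3 * L * σ) * h)) := by rw [Real.exp_add]; ring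
      _ ≤ Y * Y := by
        gcongr
        apply Real.exp_le_exp.mpr
        nlinarith
      _ = _ := by ring
  · rw [hN']
    set ES := |∑ j, A (⟨t0, by omega⟩, ⟨t1, by omega⟩, ⟨t2, by omega⟩, ⟨s, hs⟩) j * (p j : ℝ)|
    have hc : (c:ℝ) ^ (L * s) ≤ Y := by
      have hc1 : (c:ℝ) ≤ Real.exp c := by linarith [Real.add_one_le_exp (c:ℝ)]
      calc (c:ℝ) ^ (L * s) ≤ Real.exp c ^ (L * s) := by gcongr
        _ = Real.exp (((L * s : ℕ):ℝ) * c) := by rw [← Real.exp_nat_mul]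
        _ ≤ _ := by
          apply Real.exp_le_exp.mpr
          have : (s:ℝ) ≤ σ * h := by exact_mod_cast hs.le
          push_cast
          calc (L:ℝ) * s * c ≤ L * (σ * h) * c := by gcongr
            _ = c * (L * σ) * h := by ring
            _ ≤ T * h := by gcongr
            _ ≤ 13 * T * h := by nlinarith
    have hES : 0 ≤ ES := abs_nonneg _
    have h4 : ES * Y ^ (2*d+1) * Y ≤ 1 := by
      calc ES * Y ^ (2*d+1) * Y = ES * Y ^ (2*d+2) := by ring
        _ ≤ ES * Y ^ (8*d-4) := by
          gcongr
          · linarith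
          · omega
        _ ≤ 1 := hA
    calc ES * ((Y^2)^d * (c:ℝ) ^ (L*s)) ≤ ES * ((Y^2)^d * Y) := by gcongr
      _ = ES * Y ^ (2*d+1) := by rw [← pow_mul, ← pow_succ]
      _ < 1 := by
        have h5 : 0 ≤ ES * Y ^ (2*d+1) := by positivity
        nlinarith


set_option maxHeartbeats 1600000 in
theorem bk_ind {L h T T' σ σ' : ℕ} (hh : 1 ≤ h) (a : Fin 3 → ℝ) (ha : ∀ j, 0 < a j) (D0 : ℕ) (hD0p : 0 < D0)
    (hD0 : ∀ j, 1 ≤ j → j ≤ h → j ∣ D0) (hD0e : (D0 : ℝ) ≤ Real.exp (6 * h)) (c d : ℕ)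
    (hLiou : ∀ (ι : Type) (s : Finset ι) (k : ι → ℤ) (e : ι → Fin 3 → ℕ) (D : ℕ) (H : ℝ), 1 ≤ H →
      (∀ i ∈ s, ∀ j, e i j ≤ D) → ∑ i ∈ s, |(k i : ℝ)| ≤ H →
      (∑ i ∈ s, (k i : ℝ) * ∏ j, a j ^ e i j) ≠ 0 →
      1 ≤ |∑ i ∈ s, (k i : ℝ) * ∏ j, a j ^ e i j| * (H ^ d * (c : ℝ) ^ D))
    (lam : ℕ) (hlam1 : 1 ≤ lam) (hlam : ∀ j, |Real.log (a j)| ≤ lam)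
    (b : Fin 3 → ℤ) (hb : ∀ j, |(b j : ℝ)| ≤ 2 ^ h) (hb2 : b 2 ≠ 0)
    (hL : 2 * (L : ℝ) ≤ Real.exp h) (hL1 : 1 ≤ L) (hT : (T : ℝ) ≤ Real.exp h) (hN : (L : ℝ) ^ 4 * h ≤ Real.exp h)
    (hσ : 1 ≤ σ) (hσσ : σ ≤ σ') (hT3 : 3 ≤ T) (hTT : T' ≤ T)
    (hmain : 26 * T + 22 * L * lam * σ' + d * (25 * T + 3 * L * σ') + c * (L * σ') < T' * σ)
    (p : BkI L h → ℤ) (hp : ∀ i, |(p i : ℝ)| ≤ Real.exp (13 * T * h))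
    (hδ1 : L * |∑ j, (b j : ℝ) * Real.log (a j)| ≤ 1)
    (hδ : 4*((σ' * h : ℕ):ℝ)^2 * Real.exp (1 + T'*(1 + 4*T'*(5*((σ' * h : ℕ):ℝ)))) * (L * |∑ j, (b j : ℝ) * Real.log (a j)|)
      ≤ Real.exp (-(T'*((σ * h : ℕ):ℝ))))
    (hzero : ∀ t0 t1 t2 s : ℕ, t0 + t1 + t2 < 2 * T' → s < σ * h → bkZ a b p t0 t1 t2 s = 0) :
    ∀ t0 t1 t2 s : ℕ, t0 + t1 + t2 < T' → s < σ' * h → bkZ a b p t0 t1 t2 s = 0 := by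
  intro t0 t1 t2 s ht hs
  have hh0 : (1:ℝ) ≤ h := by exact_mod_cast hh
  have hT3' : (3:ℝ) ≤ T := by exact_mod_cast hT3
  have hlam1' : (1:ℝ) ≤ lam := by exact_mod_cast hlam1
  have hL1' : (1:ℝ) ≤ L := by exact_mod_cast hL1
  have hσ'1 : (1:ℝ) ≤ σ' := by exact_mod_cast hσ.trans hσσ
  have hb2c : (b 2 : ℂ) ≠ 0 := by exact_mod_cast hb2
  have hb2r : (1:ℝ) ≤ |(b 2 : ℝ)| := by
    have := Int.one_le_abs hb2
    exact_mod_cast this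
  set Λ : ℝ := ∑ j, (b j : ℝ) * Real.log (a j) with hΛ
  set μ1 : ℂ := (Real.log (a 0) : ℂ) / (b 2 : ℂ) with hμ1
  set μ2 : ℂ := (Real.log (a 1) : ℂ) / (b 2 : ℂ) with hμ2
  let ε : BkI L h → ℂ := fun i => (bkLam i 2 : ℂ) * (Λ : ℂ) / (b 2 : ℂ)
  have hw : (fun i : BkI L h => ((bkW a i : ℝ) : ℂ)) = fun i => μ1 * (bkU b i : ℂ) + μ2 * (bkV b i : ℂ) + ε i := by
    funext i
    simp only [ε, hΛ, bkW, bkU, bkV, Fin.sum_univ_three, hμ1, hμ2]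
    push_cast
    field_simp
    ring
  have hεb : ∀ i, ‖ε i‖ ≤ L * |Λ| := by
    intro i
    simp only [ε]
    rw [norm_div, norm_mul, Complex.norm_natCast, Complex.norm_real, Complex.norm_intCast, Real.norm_eq_abs]
    have h1 : (bkLam i 2 : ℝ) ≤ L := by exact_mod_cast (bkLam_lt i 2).le
    rw [div_le_iff₀ (by linarith)]
    calc (bkLam i 2 : ℝ) * |Λ| ≤ L * |Λ| := by gcongr
      _ ≤ L * |Λ| * |(b 2 : ℝ)| := le_mul_of_one_le_right (by positivity) hb2r
  have hμ : ∀ i : BkI L h, ‖μ1 * (bkU b i : ℂ) + μ2 * (bkV b i : ℂ)‖ ≤ 4 * L * lam := by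
    intro i
    have e : μ1 * (bkU b i : ℂ) + μ2 * (bkV b i : ℂ) = ((bkW a i : ℝ) : ℂ) - ε i := by
      have := congrFun hw i
      rw [this]; ring
    rw [e]
    refine (norm_sub_le _ _).trans ?_
    rw [Complex.norm_real, Real.norm_eq_abs]
    have h1 := bkW_abs a lam hlam i
    have h2 := (hεb i).trans hδ1
    nlinarith
  have hmain' : (26 * T + 22 * L * lam * σ' + d * (25 * T + 3 * L * σ') + c * (L * σ') : ℝ) + 1 ≤ T' * σ := by
    exact_mod_cast hmain
  have hSS : σ * h ≤ σ' * h := by gcongr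
  have hzero2 : ∀ t0 t1 t2 s : ℕ, t0+t1+t2 < 2*T' → s < σ * h →
      bkG (fun i => (p i : ℂ)) (fun i => (bkU b i : ℂ)) (fun i => (bkV b i : ℂ))
        (fun i => μ1*(bkU b i : ℂ) + μ2*(bkV b i : ℂ) + ε i) bkq t0 t1 t2 s = 0 := by
    rw [← hw]; exact hzero
  have hstep := bk_step (fun i => (p i : ℂ)) (fun i => (bkU b i : ℂ)) (fun i => (bkV b i : ℂ)) ε bkq μ1 μ2 T' (σ * h) (σ' * h)
    hSS (by omega) hzero2 (L * |Λ|) hεb hδ t0 t1 t2 ht (Real.exp ((18 * T + 22 * L * lam * σ') * h)) ?_ s hs.le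
  · rw [← hw] at hstep
    change ‖bkZ a b p t0 t1 t2 s‖ ≤ _ at hstep
    have hcardβ : (Fintype.card (BkI L h) : ℝ) = (L : ℝ) ^ 4 * h := by
      simp [Fintype.card_prod]; ring
    rw [hcardβ] at hstep
    have he := bk_entry (L := L) (T := T) (σ := σ') D0 (hσ.trans hσσ) hh hD0e hD0p hT t0 t1 t2 s (by omega) (by omega) (by omega) hs.le
    have h2e : (2:ℝ) ≤ Real.exp h := by linarith [Real.add_one_le_exp (h:ℝ)]
    refine bk_van hh a ha D0 hD0p hD0 c d hLiou b p t0 t1 t2 s (Real.exp (13 * T * h)) (Real.exp (2*h)) (Real.exp ((25 * T + 3 * L * σ') * h))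
      (fun i => (bkUV_abs b hb hL i).1) (fun i => (bkUV_abs b hb hL i).2) hp (Real.one_le_exp (by positivity)) ?_ ?_
    · calc _ ≤ Real.exp h * (Real.exp (13 * T * h) * Real.exp ((11 * T + 3 * L * σ') * h)) := by gcongr
        _ = Real.exp (h + (13 * T * h + (11 * T + 3 * L * σ') * h)) := by rw [Real.exp_add, Real.exp_add]
        _ ≤ _ := by
          apply Real.exp_le_exp.mpr
          nlinarith
    · have hD : (D0 : ℝ) ^ t0 ≤ Real.exp (6 * T * h) := by
        calc (D0 : ℝ) ^ t0 ≤ Real.exp (6 * h) ^ t0 := by gcongr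
          _ = Real.exp (t0 * (6 * h)) := by rw [← Real.exp_nat_mul]
          _ ≤ _ := by
            apply Real.exp_le_exp.mpr
            have : (t0 : ℝ) ≤ T := by exact_mod_cast (by omega : t0 ≤ T)
            nlinarith
      have hc : (c:ℝ) ^ (L * s) ≤ Real.exp (c * (L * σ') * h) := by
        have hc1 : (c:ℝ) ≤ Real.exp c := by linarith [Real.add_one_le_exp (c:ℝ)]
        calc (c:ℝ) ^ (L * s) ≤ Real.exp c ^ (L * s) := by gcongr
          _ = Real.exp (((L * s : ℕ):ℝ) * c) := by rw [← Real.exp_nat_mul]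
          _ ≤ _ := by
            apply Real.exp_le_exp.mpr
            have : (s:ℝ) ≤ σ' * h := by exact_mod_cast hs.le
            push_cast
            calc (L:ℝ) * s * c ≤ L * (σ' * h) * c := by gcongr
              _ = c * (L * σ') * h := by ring
      have hZ : ‖bkZ a b p t0 t1 t2 s‖ ≤ Real.exp (3 * h + (18 * T + 22 * L * lam * σ') * h - T' * (σ * h)) := by
        calc _ ≤ _ := hstep
          _ ≤ (Real.exp h * Real.exp h) * (Real.exp h * Real.exp ((18 * T + 22 * L * lam * σ') * h)) * Real.exp (-(T' * ((σ * h : ℕ) : ℝ))) := by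
            gcongr
            nlinarith
          _ = _ := by simp only [← Real.exp_add]; push_cast; ring_nf
      have hHd : Real.exp ((25 * T + 3 * L * σ') * h) ^ d = Real.exp (d * ((25 * T + 3 * L * σ') * h)) := by
        rw [← Real.exp_nat_mul]
      rw [hHd]
      calc _ ≤ Real.exp (6 * T * h) * Real.exp (3 * h + (18 * T + 22 * L * lam * σ') * h - T' * (σ * h)) * (Real.exp (d * ((25 * T + 3 * L * σ') * h)) * Real.exp (c * (L * σ') * h)) := by
            gcongr
        _ = Real.exp (h * ((24 * T + 3 + 22 * L * lam * σ' + d * (25 * T + 3 * L * σ') + c * (L * σ')) - T' * σ)) := by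
            simp only [← Real.exp_add]; ring_nf
        _ < 1 := by
            rw [Real.exp_lt_one_iff]
            apply mul_neg_of_pos_of_neg (by linarith)
            linarith
  · intro i z hz
    have hz' : ‖z‖ ≤ ((4 * (σ' * h) : ℕ) : ℝ) := by push_cast at hz ⊢; exact hz
    have hq := bkQ_deriv_bound h i.1 L (4 * (σ' * h)) t0 hh i.1.2 z hz'
    have hU := (bkUV_abs b hb hL i).1
    have hV := (bkUV_abs b hb hL i).2
    have e3 : (t0.factorial : ℝ) ≤ Real.exp (h * T) := by
      have ht0 : t0 ≤ T := by omega
      calc (t0.factorial : ℝ) ≤ (t0 : ℝ) ^ t0 := by exact_mod_cast Nat.factorial_le_pow t0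
        _ ≤ (T : ℝ) ^ t0 := by gcongr
        _ ≤ (T : ℝ) ^ T := pow_le_pow_right₀ (by linarith) ht0
        _ ≤ Real.exp h ^ T := by gcongr
        _ = _ := by rw [← Real.exp_nat_mul]; ring_nf
    have e4 : (2:ℝ) ^ ((4 * (σ' * h) + 1 + h) * L) ≤ Real.exp (6 * L * σ' * h) := by
      refine (bk_two_pow_le _).trans ?_
      apply Real.exp_le_exp.mpr
      have : (4 * (σ' * h) + 1 + h) * L ≤ 6 * L * σ' * h := by
        have h1 : 1 ≤ σ' := hσ.trans hσσ
        have : 4 * (σ' * h) + 1 + h ≤ 6 * σ' * h := by nlinarith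
        calc _ ≤ 6 * σ' * h * L := by gcongr
          _ = _ := by ring
      exact_mod_cast this
    have e1 : ∀ t ≤ T, Real.exp (2 * h) ^ t ≤ Real.exp (2 * h * T) := by
      intro t ht
      rw [← Real.exp_nat_mul]
      apply Real.exp_le_exp.mpr
      have : (t : ℝ) ≤ T := by exact_mod_cast ht
      nlinarith
    have hUt : |(bkU b i : ℝ)| ^ t1 ≤ Real.exp (2 * h * T) := (pow_le_pow_left₀ (abs_nonneg _) hU _).trans (e1 t1 (by omega))
    have hVt : |(bkV b i : ℝ)| ^ t2 ≤ Real.exp (2 * h * T) := (pow_le_pow_left₀ (abs_nonneg _) hV _).trans (e1 t2 (by omega))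
    have hexp : Real.exp (‖μ1 * (bkU b i : ℂ) + μ2 * (bkV b i : ℂ)‖ * (4 * ((σ' * h : ℕ) : ℝ))) ≤ Real.exp (4 * L * lam * (4 * ((σ' * h : ℕ) : ℝ))) := by
      have := hμ i
      gcongr
    have hp' := hp i
    have hq2 : ‖(Polynomial.derivative^[t0] (bkq i)).eval z‖ ≤ Real.exp (h * T) * Real.exp (6 * L * σ' * h) := by
      refine hq.trans ?_
      gcongr
    rw [norm_mul, norm_mul, norm_mul, norm_pow, norm_pow, Complex.norm_intCast, Complex.norm_intCast, Complex.norm_intCast]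
    calc _ ≤ (Real.exp (13 * T * h) * Real.exp (2 * h * T) * Real.exp (2 * h * T) * (Real.exp (h * T) * Real.exp (6 * L * σ' * h))) * Real.exp (4 * L * lam * (4 * ((σ' * h : ℕ) : ℝ))) := by
          gcongr
      _ = Real.exp ((18 * T + 6 * L * σ' + 16 * L * lam * σ') * h) := by
          simp only [← Real.exp_add]; push_cast; ring_nf
      _ ≤ _ := by
          apply Real.exp_le_exp.mpr
          have : (L:ℝ) * σ' ≤ L * lam * σ' := by
            have : (0:ℝ) ≤ L * σ' := by positivity
            nlinarith
          nlinarith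

theorem bk_final {L h : ℕ} (hh : 1 ≤ h) (hL1 : 1 ≤ L) (a : Fin 3 → ℝ)
    (hind : ∀ k : Fin 3 → ℤ, ∑ j, (k j : ℝ) * Real.log (a j) = 0 → k = 0)
    (b : Fin 3 → ℤ) (p : BkI L h → ℤ) (hz : ∀ s < L ^ 4 * h, bkZ a b p 0 0 0 s = 0) : p = 0 := by
  have hLh : 0 < L * h := by positivity
  let i0 : Fin (L * h) := ⟨0, hLh⟩
  let w : Fin L × Fin L × Fin L → ℝ := fun x => bkW a ((i0, x) : BkI L h)
  let P : Fin L × Fin L × Fin L → Polynomial ℝ := fun x =>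
    ∑ m : Fin (L * h), Polynomial.C (p (m, x) : ℝ) * (bkQ h m).map (algebraMap ℚ ℝ)
  have hP := bk_zero_estimate (Finset.univ : Finset (Fin L × Fin L × Fin L)) w ?_ (L ^ 4 * h) (fun _ => L * h) ?_ P ?_
    ((Finset.range (L ^ 4 * h)).image (fun n : ℕ => (n : ℝ))) ?_ ?_
  · funext ⟨m, x⟩
    have h1 := bkQ_indep h (L * h) (fun m => (p (m, x) : ℝ)) (hP x (Finset.mem_univ _))
    have h2 := congrFun h1 m
    simpa using h2
  · intro x _ y _ hxy
    have h0 := hind (fun j => (bkLam ((i0, x) : BkI L h) j : ℤ) - (bkLam ((i0, y) : BkI L h) j : ℤ)) ?_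
    · have e0 := congrFun h0 0
      have e1 := congrFun h0 1
      have e2 := congrFun h0 2
      obtain ⟨x0, x1, x2⟩ := x
      obtain ⟨y0, y1, y2⟩ := y
      simp [bkLam] at e0 e1 e2
      ext <;> simp <;> omega
    · push_cast
      simp only [w, bkW] at hxy
      simp only [sub_mul, Finset.sum_sub_distrib]
      linarith
  · simp [Finset.card_univ, Fintype.card_prod]; ring
  · intro x _
    refine Submodule.sum_mem _ fun m _ => ?_
    rw [← Polynomial.smul_eq_C_mul]
    refine Submodule.smul_mem _ _ ?_
    rw [Polynomial.mem_degreeLT]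
    rw [Polynomial.degree_map, bkQ_degree]
    exact_mod_cast m.2
  · rw [Finset.card_image_of_injective _ Nat.cast_injective, Finset.card_range]
  · intro x hx
    obtain ⟨s, hs, rfl⟩ := Finset.mem_image.mp hx
    have h1 := hz s (Finset.mem_range.mp hs)
    have h2 : bkZ a b p 0 0 0 s = ((∑ x, (P x).eval (s:ℝ) * Real.exp (w x * s) : ℝ) : ℂ) := by
      unfold bkZ bkG
      rw [Fintype.sum_prod_type, Finset.sum_comm, Complex.ofReal_sum]
      refine Finset.sum_congr rfl fun x _ => ?_
      simp only [P, Polynomial.eval_finsetSum]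
      rw [Finset.sum_mul, Complex.ofReal_sum]
      refine Finset.sum_congr rfl fun m _ => ?_
      simp only [pow_zero, mul_one, Function.iterate_zero, id_eq, bkq, Polynomial.eval_mul, Polynomial.eval_C]
      have e1 : Polynomial.eval (s:ℂ) ((bkQ h m).map (algebraMap ℚ ℂ)) = ((Polynomial.eval (s:ℝ) ((bkQ h m).map (algebraMap ℚ ℝ)) : ℝ) : ℂ) := by
        have a1 : (s : ℂ) = algebraMap ℚ ℂ (s : ℚ) := by simp
        have a2 : (s : ℝ) = algebraMap ℚ ℝ (s : ℚ) := by simp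
        rw [a1, a2, Polynomial.eval_map, Polynomial.eval_map, Polynomial.eval₂_at_apply, Polynomial.eval₂_at_apply]
        simp
      rw [e1]
      push_cast
      rfl
    rw [h1] at h2
    exact_mod_cast h2.symm

theorem bk_params (c0 d lam : ℕ) (hc0 : 1 ≤ c0) (hd : 1 ≤ d) (hlam : 1 ≤ lam) :
    ∃ c L A : ℕ, 1 ≤ c ∧ 1 ≤ L ∧ 1 ≤ A ∧
      6 * L * (2 ^ 15 * c) * lam + 2 ≤ 2 * (2 ^ 16 * c * L * A) ∧
      c0 * (L * (2 ^ 15 * c)) ≤ 2 ^ 16 * c * L * A ∧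
      (8 * d + 1) * ((2 ^ 16 * c * L * A) ^ 3 * (2 ^ 15 * c)) ≤ L ^ 4 ∧
      L ^ 4 ≤ 2 ^ 15 * c * A ^ 13 ∧
      ∀ k ≤ 12, 26 * (2 ^ 16 * c * L * A) + 22 * L * lam * (2 ^ 15 * c * A ^ (k + 1)) +
        d * (25 * (2 ^ 16 * c * L * A) + 3 * L * (2 ^ 15 * c * A ^ (k + 1))) + c0 * (L * (2 ^ 15 * c * A ^ (k + 1))) <
        (2 ^ (12 - k) * (2 ^ 3 * c * L * A)) * (2 ^ 15 * c * A ^ k) := by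
  set c := 100 * d * lam * c0 with hc
  have hdl : 1 ≤ d * lam := Nat.one_le_iff_ne_zero.mpr (by positivity)
  have hlc : 1 ≤ lam * c0 := Nat.one_le_iff_ne_zero.mpr (by positivity)
  have hdc : 1 ≤ d * c0 := Nat.one_le_iff_ne_zero.mpr (by positivity)
  have c1 : 100 * d ≤ c := by rw [hc]; nlinarith
  have c2 : 100 * lam ≤ c := by rw [hc]; nlinarith
  have c3 : 100 * c0 ≤ c := by rw [hc]; nlinarith
  set c' := (8 * d + 1) * 2 ^ 63 * c ^ 4 with hc'
  have hcpos : 1 ≤ c := by omega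
  have hcc : c ≤ c' := by
    have : 1 ≤ (8 * d + 1) * 2 ^ 63 * c ^ 3 := Nat.one_le_iff_ne_zero.mpr (by positivity)
    calc c = 1 * c := by ring
      _ ≤ (8 * d + 1) * 2 ^ 63 * c ^ 3 * c := by gcongr
      _ = c' := by rw [hc']; ring
  have hc'1 : 1 ≤ c' := hcpos.trans hcc
  have hAc : c' ≤ c' ^ 4 := Nat.le_self_pow (by norm_num) _
  generalize hA : c' ^ 4 = A at *
  have hA1 : 1 ≤ A := hc'1.trans hAc
  have hcA : c ≤ A := hcc.trans hAc
  have hL1 : 1 ≤ c' * A ^ 3 := Nat.one_le_iff_ne_zero.mpr (by positivity)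
  refine ⟨c, c' * A ^ 3, A, hcpos, hL1, hA1, ?_, ?_, ?_, ?_, ?_⟩
  · generalize c' * A ^ 3 = L at *
    have h1 : 6 * lam ≤ A := by omega
    have h2 : 1 ≤ c * L * A := Nat.one_le_iff_ne_zero.mpr (by positivity)
    calc 6 * L * (2 ^ 15 * c) * lam + 2 = 2 ^ 15 * (c * L * (6 * lam)) + 2 := by ring
      _ ≤ 2 ^ 15 * (c * L * A) + 2 * (c * L * A) := by
        have : c * L * (6 * lam) ≤ c * L * A := by gcongr
        omega
      _ ≤ 2 ^ 17 * (c * L * A) := by omega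
      _ = _ := by ring
  · generalize c' * A ^ 3 = L at *
    have h1 : c0 ≤ A := by omega
    calc c0 * (L * (2 ^ 15 * c)) = 2 ^ 15 * (c * L * c0) := by ring
      _ ≤ 2 ^ 16 * (c * L * A) := by gcongr <;> norm_num
      _ = _ := by ring
  · apply le_of_eq
    generalize hL : c' * A ^ 3 = L at *
    calc _ = ((8 * d + 1) * 2 ^ 63 * c ^ 4) * A ^ 3 * L ^ 3 := by ring
      _ = L * L ^ 3 := by rw [← hc', hL]
      _ = _ := by ring
  · calc (c' * A ^ 3) ^ 4 = c' ^ 4 * A ^ 12 := by ring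
      _ = A ^ 13 := by rw [hA]; ring
      _ ≤ _ := by
        have : 1 ≤ 2 ^ 15 * c := by omega
        exact Nat.le_mul_of_pos_left _ this
  · intro k hk
    generalize c' * A ^ 3 = L at *
    have hAk : 1 ≤ A ^ k := Nat.one_le_iff_ne_zero.mpr (by positivity)
    have h2k : 1 ≤ 2 ^ (12 - k) := Nat.one_le_two_pow
    set X := c * L * A ^ (k + 1) with hX
    have hXA : c * L * A ≤ X := by
      rw [hX, pow_succ]
      calc c * L * A = c * L * (1 * A) := by ring
        _ ≤ c * L * (A ^ k * A) := by gcongr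
    have hXp : 1 ≤ X := Nat.one_le_iff_ne_zero.mpr (by positivity)
    have e1 : 26 + 25 * d ≤ c := by omega
    have e2 : 22 * lam + 3 * d + c0 ≤ c := by omega
    calc _ = (26 + 25 * d) * (2 ^ 16 * (c * L * A)) + (22 * lam + 3 * d + c0) * (2 ^ 15 * X) := by rw [hX]; ring
      _ ≤ c * (2 ^ 16 * X) + c * (2 ^ 15 * X) := by gcongr
      _ = (2 ^ 16 + 2 ^ 15) * (c * X) := by ring
      _ < 2 ^ 18 * (c * X) := by
        have : 1 ≤ c * X := Nat.one_le_iff_ne_zero.mpr (by positivity)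
        omega
      _ = 1 * 2 ^ 18 * (c * X) := by ring
      _ ≤ 2 ^ (12 - k) * 2 ^ 18 * (c * X) := by gcongr
      _ = _ := by rw [hX]; ring

theorem bk_delta (T T' σ σ' S L h : ℕ) (x : ℝ) (hx0 : 0 ≤ x) (hT : 1 ≤ T) (hL : 1 ≤ L) (hh : 1 ≤ h) (hS : 1 ≤ S)
    (hTT : T' ≤ T) (h1 : σ ≤ S) (h2 : σ' ≤ S) (hx : x ≤ Real.exp (-((40 * T ^ 2 * S * L : ℕ) * h))) :
    4*((σ' * h : ℕ):ℝ)^2 * Real.exp (1 + T'*(1 + 4*T'*(5*((σ' * h : ℕ):ℝ)))) * (L * x)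
      ≤ Real.exp (-(T'*((σ * h : ℕ):ℝ))) := by
  have a1 : ((σ' * h : ℕ):ℝ) ≤ Real.exp ((σ' * h : ℕ):ℝ) := by linarith [Real.add_one_le_exp ((σ' * h : ℕ):ℝ)]
  have a2 : (L:ℝ) ≤ Real.exp L := by linarith [Real.add_one_le_exp (L:ℝ)]
  have a3 : (2:ℝ) ≤ Real.exp 1 := by linarith [Real.add_one_le_exp (1:ℝ)]
  have a4 : 4*((σ' * h : ℕ):ℝ)^2 ≤ Real.exp (2 + 2 * ((σ' * h : ℕ):ℝ)) := by
    calc 4*((σ' * h : ℕ):ℝ)^2 = (2 * ((σ' * h : ℕ):ℝ))^2 := by ring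
      _ ≤ (Real.exp 1 * Real.exp ((σ' * h : ℕ):ℝ))^2 := by gcongr
      _ = _ := by rw [← Real.exp_add, ← Real.exp_nat_mul]; push_cast; ring_nf
  have key : 2 + 2 * (σ' * h) + (1 + T' * (1 + 4 * T' * (5 * (σ' * h)))) + L + T' * (σ * h) ≤ 40 * T ^ 2 * S * L * h := by
    set X := T ^ 2 * S * L * h with hX
    have x1 : 1 ≤ X := Nat.one_le_iff_ne_zero.mpr (by positivity)
    have x2 : S * h ≤ X := by
      have : 1 ≤ T ^ 2 * L := Nat.one_le_iff_ne_zero.mpr (by positivity)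
      rw [hX]; nlinarith [Nat.zero_le (S * h)]
    have x3 : σ' * h ≤ X := le_trans (by gcongr) x2
    have x4 : T' ≤ X := by
      have : 1 ≤ T * S * L * h := Nat.one_le_iff_ne_zero.mpr (by positivity)
      rw [hX]; nlinarith [Nat.zero_le T]
    have x5 : T' * T' * (σ' * h) ≤ X := by
      calc _ ≤ T * T * (S * h) := by gcongr
        _ = T ^ 2 * S * h * 1 := by ring
        _ ≤ T ^ 2 * S * h * L := by gcongr
        _ = X := by rw [hX]; ring
    have x6 : L ≤ X := by
      have : 1 ≤ T ^ 2 * S * h := Nat.one_le_iff_ne_zero.mpr (by positivity)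
      rw [hX]; nlinarith [Nat.zero_le L]
    have x7 : T' * (σ * h) ≤ X := by
      calc _ ≤ T * (S * h) := by gcongr
        _ = T * S * h * (1 * 1) := by ring
        _ ≤ T * S * h * (T * L) := by gcongr
        _ = X := by rw [hX]; ring
    calc _ = 3 + 2 * (σ' * h) + T' + 20 * (T' * T' * (σ' * h)) + L + T' * (σ * h) := by ring
      _ ≤ 40 * X := by omega
      _ = _ := by rw [hX]; ring
  have key' : (2 + 2 * (σ' * h) + (1 + T' * (1 + 4 * T' * (5 * (σ' * h)))) + L + T' * (σ * h) : ℝ) ≤ 40 * T ^ 2 * S * L * h := by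
    exact_mod_cast key
  calc _ ≤ Real.exp (2 + 2 * ((σ' * h : ℕ):ℝ)) * Real.exp (1 + T'*(1 + 4*T'*(5*((σ' * h : ℕ):ℝ)))) * (Real.exp L * Real.exp (-((40 * T ^ 2 * S * L : ℕ) * h))) := by gcongr
    _ = Real.exp ((2 + 2 * ((σ' * h : ℕ):ℝ)) + (1 + T'*(1 + 4*T'*(5*((σ' * h : ℕ):ℝ)))) + (L + -((40 * T ^ 2 * S * L : ℕ) * h))) := by
      simp only [Real.exp_add]
    _ ≤ _ := by
      apply Real.exp_le_exp.mpr
      push_cast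
      linarith

theorem bk_core_large (a : Fin 3 → ℝ) (halg : ∀ j, IsAlgebraic ℚ (a j)) (ha : ∀ j, 0 < a j)
    (hind : ∀ k : Fin 3 → ℤ, ∑ j, (k j : ℝ) * Real.log (a j) = 0 → k = 0) :
    ∃ C h0 : ℕ, 1 ≤ C ∧ 1 ≤ h0 ∧ ∀ h : ℕ, h0 ≤ h → ∀ b : Fin 3 → ℤ, b 2 ≠ 0 → (∀ j, |(b j : ℝ)| ≤ 2 ^ h) →
      Real.exp (-(C * h)) ≤ |∑ j, (b j : ℝ) * Real.log (a j)| := by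
  obtain ⟨c0, d, hc0, hd, hLiou⟩ := bk_liouville a halg
  obtain ⟨lam, hlam1, hlam⟩ : ∃ lam : ℕ, 1 ≤ lam ∧ ∀ j, |Real.log (a j)| ≤ lam := by
    refine ⟨1 + ∑ j, ⌈|Real.log (a j)|⌉₊, by omega, fun j => ?_⟩
    have h1 : ⌈|Real.log (a j)|⌉₊ ≤ ∑ j, ⌈|Real.log (a j)|⌉₊ :=
      Finset.single_le_sum (f := fun j => ⌈|Real.log (a j)|⌉₊) (fun _ _ => Nat.zero_le _) (Finset.mem_univ j)
    refine (Nat.le_ceil _).trans ?_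
    exact_mod_cast (by omega)
  obtain ⟨c, L, A, hc1, hL1, hA1, hp1, hp2, hp3, hp4, hmain⟩ := bk_params c0 d lam hc0 hd hlam1
  generalize hTdef : 2 ^ 16 * c * L * A = T at *
  have hTpos : 2 ^ 16 ≤ T := by
    have : 1 ≤ c * L * A := Nat.one_le_iff_ne_zero.mpr (by positivity)
    rw [← hTdef]
    calc 2 ^ 16 = 2 ^ 16 * 1 := by ring
      _ ≤ 2 ^ 16 * (c * L * A) := by gcongr
      _ = _ := by ring
  set S := 2 ^ 15 * c * A ^ 13 with hSdef
  have hS1 : 1 ≤ S := Nat.one_le_iff_ne_zero.mpr (by positivity)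
  refine ⟨40 * T ^ 2 * S * L, 2 * L ^ 4 + 2 * L + T, Nat.one_le_iff_ne_zero.mpr (by positivity), by omega, ?_⟩
  intro h hh0 b hb2 hb
  by_contra hlt
  push Not at hlt
  have hh : 1 ≤ h := by omega
  have hhr : (h:ℝ) ≤ Real.exp h := by linarith [Real.add_one_le_exp (h:ℝ)]
  have hL : 2 * (L : ℝ) ≤ Real.exp h := by
    refine le_trans ?_ hhr
    exact_mod_cast (by omega : 2 * L ≤ h)
  have hT : (T : ℝ) ≤ Real.exp h := by
    refine le_trans ?_ hhr
    exact_mod_cast (by omega : T ≤ h)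
  have hN : (L : ℝ) ^ 4 * h ≤ Real.exp h := by
    have h1 := Real.quadratic_le_exp_of_nonneg (x := (h:ℝ)) (by positivity)
    have h2 : 2 * (L:ℝ) ^ 4 ≤ h := by exact_mod_cast (by omega : 2 * L ^ 4 ≤ h)
    have h3 : (0:ℝ) ≤ h := by positivity
    nlinarith
  obtain ⟨D0, hD0p, hD0, hD0e⟩ := bk_lcm h
  have hσ0 : 1 ≤ 2 ^ 15 * c := by omega
  obtain ⟨p, hp0, hp, hz0⟩ := bk_begin (σ := 2 ^ 15 * c) hh a ha D0 hD0p hD0 hD0e c0 d hd hLiou lam hlam1 hlam b hb hL hT hN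
    hσ0 (by omega) hp1 hp2 hp3
  set x := |∑ j, (b j : ℝ) * Real.log (a j)| with hx
  have hx0 : 0 ≤ x := abs_nonneg _
  have hδ1 : L * x ≤ 1 := by
    have h1 : (L:ℝ) ≤ Real.exp ((40 * T ^ 2 * S * L : ℕ) * h) := by
      have e1 := Real.add_one_le_exp (((40 * T ^ 2 * S * L : ℕ) * h : ℝ))
      have e2 : L ≤ (40 * T ^ 2 * S * L) * h := by
        have : 1 ≤ 40 * T ^ 2 * S * h := Nat.one_le_iff_ne_zero.mpr (by positivity)
        nlinarith [Nat.zero_le L]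
      have e3 : (L:ℝ) ≤ ((40 * T ^ 2 * S * L : ℕ) * h : ℝ) := by exact_mod_cast e2
      linarith
    calc L * x ≤ Real.exp ((40 * T ^ 2 * S * L : ℕ) * h) * Real.exp (-((40 * T ^ 2 * S * L : ℕ) * h)) := by gcongr
      _ = 1 := by rw [← Real.exp_add]; simp
  have claim : ∀ k ≤ 13, ∀ t0 t1 t2 s : ℕ, t0 + t1 + t2 < 2 ^ (13 - k) * (2 ^ 3 * c * L * A) → s < (2 ^ 15 * c * A ^ k) * h →
      bkZ a b p t0 t1 t2 s = 0 := by
    intro k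
    induction k with
    | zero =>
      intro _ t0 t1 t2 s ht hs
      refine hz0 t0 t1 t2 s (lt_of_lt_of_eq ht ?_) (by simpa using hs)
      rw [← hTdef]; ring
    | succ k ih =>
      intro hk
      have hAle : ∀ j ≤ 13, 2 ^ 15 * c * A ^ j ≤ S := fun j hj => by
        rw [hSdef]; gcongr
      have hTT : 2 ^ (12 - k) * (2 ^ 3 * c * L * A) ≤ T := by
        rw [← hTdef]
        calc _ ≤ 2 ^ 12 * (2 ^ 3 * c * L * A) := by gcongr <;> omega
          _ = 2 ^ 15 * (c * L * A) := by ring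
          _ ≤ 2 ^ 16 * (c * L * A) := by gcongr <;> norm_num
          _ = _ := by ring
      have he : 13 - (k + 1) = 12 - k := by omega
      rw [he]
      have hAk : 1 ≤ A ^ k := Nat.one_le_iff_ne_zero.mpr (by positivity)
      refine bk_ind (T := T) (σ := 2 ^ 15 * c * A ^ k) (σ' := 2 ^ 15 * c * A ^ (k+1)) hh a ha D0 hD0p hD0 hD0e c0 d hLiou lam hlam1 hlam b hb hb2 hL hL1 hT hN
        (Nat.one_le_iff_ne_zero.mpr (by positivity)) (by gcongr; omega) (by omega) hTT (hmain k (by omega)) p hp hδ1 ?_ ?_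
      · exact bk_delta T _ _ _ S L h x hx0 (by omega) hL1 hh hS1 hTT (hAle k (by omega)) (hAle (k+1) hk) hlt.le
      · intro t0 t1 t2 s ht hs
        refine ih (by omega) t0 t1 t2 s (lt_of_lt_of_eq ht ?_) hs
        have : 13 - k = (12 - k) + 1 := by omega
        rw [this, pow_succ]; ring
  apply hp0
  refine bk_final hh hL1 a hind b p fun s hs => claim 13 le_rfl 0 0 0 s ?_ ?_
  · positivity
  · exact lt_of_lt_of_le hs (by gcongr)

theorem bk_core (a : Fin 3 → ℝ) (halg : ∀ j, IsAlgebraic ℚ (a j)) (ha : ∀ j, 0 < a j)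
    (hind : ∀ k : Fin 3 → ℤ, ∑ j, (k j : ℝ) * Real.log (a j) = 0 → k = 0) :
    ∃ C : ℕ, 1 ≤ C ∧ ∀ h : ℕ, 1 ≤ h → ∀ b : Fin 3 → ℤ, b 2 ≠ 0 → (∀ j, |(b j : ℝ)| ≤ 2 ^ h) →
      Real.exp (-(C * h)) ≤ |∑ j, (b j : ℝ) * Real.log (a j)| := by
  obtain ⟨C, h0, hC, hh0, H⟩ := bk_core_large a halg ha hind
  refine ⟨C * h0, Nat.one_le_iff_ne_zero.mpr (by positivity), ?_⟩
  intro h hh b hb2 hb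
  have h1 := H (h * h0) (Nat.le_mul_of_pos_left _ hh) b hb2 (fun j => (hb j).trans
    (pow_le_pow_right₀ (by norm_num) (Nat.le_mul_of_pos_right _ hh0)))
  refine le_trans (le_of_eq ?_) h1
  push_cast; ring_nf

theorem bk_log_primes : LinearIndependent ℚ ![Real.log 2, Real.log 3, Real.log 5] := by
  rw [← LinearIndependent.iff_fractionRing ℤ ℚ, Fintype.linearIndependent_iff]
  intro g hg
  simp only [Fin.sum_univ_three, Matrix.cons_val_zero, Matrix.cons_val_one, Matrix.cons_val, zsmul_eq_mul] at hg
  have h1 : ((2:ℝ) ^ g 0 * 3 ^ g 1 * 5 ^ g 2) = 1 := by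
    have h2 : Real.log ((2:ℝ) ^ g 0 * 3 ^ g 1 * 5 ^ g 2) = 0 := by
      rw [Real.log_mul (by positivity) (by positivity), Real.log_mul (by positivity) (by positivity),
        Real.log_zpow, Real.log_zpow, Real.log_zpow, hg]
    have h3 : (0:ℝ) < (2:ℝ) ^ g 0 * 3 ^ g 1 * 5 ^ g 2 := by positivity
    exact Real.eq_one_of_pos_of_log_eq_zero h3 h2
  have h2 : ((2:ℚ) ^ g 0 * 3 ^ g 1 * 5 ^ g 2) = 1 := by
    have h4 : (((2:ℚ) ^ g 0 * 3 ^ g 1 * 5 ^ g 2 : ℚ) : ℝ) = ((1:ℚ) : ℝ) := by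
      push_cast
      exact h1
    exact Rat.cast_injective h4
  have key : ∀ p : ℕ, [Fact p.Prime] → g 0 * padicValRat p 2 + g 1 * padicValRat p 3 + g 2 * padicValRat p 5 = 0 := by
    intro p _
    have h3 := congrArg (padicValRat p) h2
    rw [padicValRat.mul (by positivity) (by positivity), padicValRat.mul (by positivity) (by positivity),
      padicValRat.zpow, padicValRat.zpow, padicValRat.zpow, padicValRat.one] at h3
    exact h3
  have hv : ∀ p q : ℕ, p.Prime → q.Prime → p ≠ q → padicValRat p (q:ℚ) = 0 := by
    intro p q hp hq hpq
    have := Fact.mk hp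
    rw [padicValRat.of_nat]
    have := (Nat.coprime_primes hp hq).mpr hpq
    rw [padicValNat.eq_zero_of_not_dvd]
    · rfl
    · exact (Nat.Prime.coprime_iff_not_dvd hp).mp this
  have hs : ∀ p : ℕ, p.Prime → padicValRat p (p:ℚ) = 1 := fun p hp => padicValRat.self hp.one_lt
  have p2 := Nat.prime_two
  have p3 := Nat.prime_three
  have p5 := Nat.prime_five
  have k2 := @key 2 ⟨p2⟩
  have k3 := @key 3 ⟨p3⟩
  have k5 := @key 5 ⟨p5⟩
  have v22 : padicValRat 2 (2:ℚ) = 1 := hs 2 p2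
  have v33 : padicValRat 3 (3:ℚ) = 1 := hs 3 p3
  have v55 : padicValRat 5 (5:ℚ) = 1 := hs 5 p5
  have v23 : padicValRat 2 (3:ℚ) = 0 := hv 2 3 p2 p3 (by norm_num)
  have v25 : padicValRat 2 (5:ℚ) = 0 := hv 2 5 p2 p5 (by norm_num)
  have v32 : padicValRat 3 (2:ℚ) = 0 := hv 3 2 p3 p2 (by norm_num)
  have v35 : padicValRat 3 (5:ℚ) = 0 := hv 3 5 p3 p5 (by norm_num)
  have v52 : padicValRat 5 (2:ℚ) = 0 := hv 5 2 p5 p2 (by norm_num)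
  have v53 : padicValRat 5 (3:ℚ) = 0 := hv 5 3 p5 p3 (by norm_num)
  rw [v22, v23, v25] at k2
  rw [v32, v33, v35] at k3
  rw [v52, v53, v55] at k5
  intro i
  fin_cases i <;> simp <;> omega

theorem bk_prime (l1 l2 : ℝ) : ∃ p : ℕ, 1 ≤ p ∧ Real.log p ∉ Submodule.span ℚ ({l1, l2} : Set ℝ) := by
  by_contra hcon
  push Not at hcon
  have h1 : Submodule.span ℚ (Set.range ![Real.log 2, Real.log 3, Real.log 5]) ≤ Submodule.span ℚ ({l1, l2} : Set ℝ) := by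
    rw [Submodule.span_le]
    rintro _ ⟨i, rfl⟩
    have a2 := hcon 2 (by norm_num)
    have a3 := hcon 3 (by norm_num)
    have a5 := hcon 5 (by norm_num)
    push_cast at a2 a3 a5
    fin_cases i
    · exact a2
    · exact a3
    · exact a5
  have h2 := finrank_span_eq_card bk_log_primes
  classical
  have hfin : Module.Finite ℚ (Submodule.span ℚ ({l1, l2} : Set ℝ)) := Module.Finite.span_of_finite ℚ (Set.toFinite _)
  have h3 := Submodule.finrank_mono h1
  rw [h2] at h3
  have h4 := finrank_span_finset_le_card (R := ℚ) ({l1, l2} : Finset ℝ)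
  have h5 : (({l1, l2} : Finset ℝ)).card ≤ 2 := Finset.card_le_two
  have h6 : (((({l1, l2} : Finset ℝ)) : Set ℝ)).finrank ℚ = Module.finrank ℚ (Submodule.span ℚ ({l1, l2} : Set ℝ)) := by
    unfold Set.finrank
    rw [Finset.coe_pair]
  rw [h6] at h4
  simp at h3
  omega

theorem bk_two (a1 a2 : ℝ) (h1 : IsAlgebraic ℚ a1) (h2 : IsAlgebraic ℚ a2) (p1 : 0 < a1) (p2 : 0 < a2)
    (hind : ∀ x y : ℤ, (x : ℝ) * Real.log a1 + y * Real.log a2 = 0 → x = 0 ∧ y = 0) :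
    ∃ C : ℕ, 1 ≤ C ∧ ∀ h : ℕ, 1 ≤ h → ∀ x y : ℤ, (x : ℝ) * Real.log a1 + y * Real.log a2 ≠ 0 →
      |(x : ℝ)| ≤ 2 ^ h → |(y : ℝ)| ≤ 2 ^ h →
      Real.exp (-(C * h)) ≤ |(x : ℝ) * Real.log a1 + y * Real.log a2| := by
  obtain ⟨p, hp1, hp⟩ := bk_prime (Real.log a1) (Real.log a2)
  have hpp : (0:ℝ) < p := by exact_mod_cast hp1
  have hpa : IsAlgebraic ℚ (p : ℝ) := isAlgebraic_natCast p
  have key : ∀ z x y : ℤ, (z : ℝ) * Real.log p + x * Real.log a1 + y * Real.log a2 = 0 → z = 0 ∧ x = 0 ∧ y = 0 := by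
    intro z x y h0
    have hz : z = 0 := by
      by_contra hz
      apply hp
      have hzr : (z:ℝ) ≠ 0 := by exact_mod_cast hz
      have e : Real.log p = (-(x:ℚ)/z) • Real.log a1 + (-(y:ℚ)/z) • Real.log a2 := by
        simp only [Rat.smul_def]
        push_cast
        field_simp
        linarith
      rw [e]
      exact Submodule.add_mem _ (Submodule.smul_mem _ _ (Submodule.subset_span (by simp)))
        (Submodule.smul_mem _ _ (Submodule.subset_span (by simp)))
    subst hz
    have := hind x y (by simpa using h0)
    exact ⟨rfl, this⟩
  obtain ⟨C1, hC1, H1⟩ := bk_core ![(p:ℝ), a1, a2] (by intro j; fin_cases j <;> simp [hpa, h1, h2])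
    (by intro j; fin_cases j <;> simp [p1, p2]; exact hp1) (by
      intro k hk
      simp [Fin.sum_univ_three] at hk
      obtain ⟨e0, e1, e2⟩ := key (k 0) (k 1) (k 2) hk
      funext j; fin_cases j <;> simp [e0, e1, e2])
  obtain ⟨C2, hC2, H2⟩ := bk_core ![(p:ℝ), a2, a1] (by intro j; fin_cases j <;> simp [hpa, h1, h2])
    (by intro j; fin_cases j <;> simp [p1, p2]; exact hp1) (by
      intro k hk
      simp [Fin.sum_univ_three] at hk
      obtain ⟨e0, e1, e2⟩ := key (k 0) (k 2) (k 1) (by linarith)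
      funext j; fin_cases j <;> simp [e0, e1, e2])
  refine ⟨C1 + C2, by omega, ?_⟩
  intro h hh x y hne hx hy
  have hh' : (0:ℝ) ≤ h := by positivity
  by_cases hy0 : y = 0
  · have hx0 : x ≠ 0 := by
      rintro rfl
      subst hy0
      simp at hne
    have := H2 h hh ![0, y, x] (by simpa using hx0) (by
      intro j; fin_cases j
      · simp
      · simpa using hy
      · simpa using hx)
    simp [Fin.sum_univ_three] at this
    rw [add_comm ((x:ℝ) * _)]
    refine le_trans (Real.exp_le_exp.mpr ?_) this
    push_cast
    have : (0:ℝ) ≤ C1 * h := by positivity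
    linarith
  · have := H1 h hh ![0, x, y] (by simpa using hy0) (by
      intro j; fin_cases j
      · simp
      · simpa using hx
      · simpa using hy)
    simp [Fin.sum_univ_three] at this
    refine le_trans (Real.exp_le_exp.mpr ?_) this
    push_cast
    have : (0:ℝ) ≤ C2 * h := by positivity
    linarith

theorem bk_discrete (y l : ℝ) (hl : 0 < l) : ∃ δ : ℝ, 0 < δ ∧ ∀ m : ℤ, y + m * l ≠ 0 → δ ≤ |y + m * l| := by
  set f := y / l with hf
  have e : ∀ m : ℤ, y + m * l = (f + m) * l := by intro m; rw [hf]; field_simp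
  have hfl : f = Int.fract f + ⌊f⌋ := (Int.fract_add_floor f).symm
  by_cases h0 : Int.fract f = 0
  · refine ⟨l, hl, fun m hm => ?_⟩
    rw [e] at hm ⊢
    rw [hfl, h0] at hm ⊢
    have hk : (⌊f⌋ + m) ≠ 0 := by
      intro hk
      apply hm
      have : ((⌊f⌋ + m : ℤ) : ℝ) = 0 := by rw [hk]; simp
      push_cast at this
      rw [zero_add, this, zero_mul]
    have h1 : (1:ℝ) ≤ |((⌊f⌋ + m : ℤ) : ℝ)| := by exact_mod_cast Int.one_le_abs hk
    rw [abs_mul, abs_of_pos hl, zero_add]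
    push_cast at h1
    nlinarith
  · have hr0 : 0 < Int.fract f := lt_of_le_of_ne (Int.fract_nonneg f) (Ne.symm h0)
    have hr1 := Int.fract_lt_one f
    refine ⟨min (Int.fract f) (1 - Int.fract f) * l, by
      apply mul_pos _ hl
      exact lt_min hr0 (by linarith), fun m _ => ?_⟩
    rw [e, abs_mul, abs_of_pos hl]
    gcongr
    set k := ⌊f⌋ + m with hk
    have e2 : f + m = Int.fract f + (k : ℝ) := by
      rw [hk]; push_cast; linarith
    rw [e2]
    rcases le_or_gt 0 k with h | h
    · have : (0:ℝ) ≤ k := by exact_mod_cast h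
      refine (min_le_left _ _).trans ?_
      refine le_trans ?_ (le_abs_self _)
      linarith
    · have : (k:ℝ) ≤ -1 := by exact_mod_cast (by omega : k ≤ -1)
      refine (min_le_right _ _).trans ?_
      refine le_trans ?_ (neg_le_abs _)
      linarith

theorem bk_lin (r1 r2 g : ℝ) (h1 : IsAlgebraic ℚ r1) (h2 : IsAlgebraic ℚ r2) (hg : IsAlgebraic ℚ g)
    (hr1 : 1 < r1) (hr2 : 1 < r2) (hg0 : 0 < g) :
    ∃ C : ℝ, 0 < C ∧ ∀ h : ℕ, 1 ≤ h → ∀ n1 n2 : ℕ, n1 ≤ 2 ^ h → n2 ≤ 2 ^ h →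
      Real.log g + n1 * Real.log r1 - n2 * Real.log r2 ≠ 0 →
      Real.exp (-(C * h)) ≤ |Real.log g + n1 * Real.log r1 - n2 * Real.log r2| := by
  have l1 := Real.log_pos hr1
  have l2 := Real.log_pos hr2
  set L1 := Real.log r1
  set L2 := Real.log r2
  set L3 := Real.log g with hL3
  by_cases hd : ∃ x y : ℤ, (x : ℝ) * L1 + y * L2 = 0 ∧ ¬ (x = 0 ∧ y = 0)
  · obtain ⟨x, y, hxy, hne⟩ := hd
    have hy : y ≠ 0 := by
      rintro rfl
      simp [l1.ne'] at hxy
      exact hne ⟨hxy, rfl⟩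
    have hyr : (0:ℝ) < |(y:ℝ)| := by
      rw [abs_pos]; exact_mod_cast hy
    obtain ⟨δ, hδ, H⟩ := bk_discrete (y * L3) L1 l1
    refine ⟨max 1 (-Real.log (δ / |(y:ℝ)|)), by positivity, ?_⟩
    intro h hh n1 n2 _ _ hΛ
    have e : (y:ℝ) * (L3 + n1 * L1 - n2 * L2) = y * L3 + ((n1 * y + n2 * x : ℤ) : ℝ) * L1 := by
      push_cast
      linear_combination (-(n2:ℝ)) * hxy
    have h3 := H (n1 * y + n2 * x) (by
      rw [← e]
      exact mul_ne_zero (by exact_mod_cast hy) hΛ)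
    rw [← e, abs_mul] at h3
    have h4 : δ / |(y:ℝ)| ≤ |L3 + n1 * L1 - n2 * L2| := by
      rw [div_le_iff₀ hyr]; linarith
    refine le_trans ?_ h4
    rw [← Real.le_log_iff_exp_le (by positivity)]
    have hh' : (1:ℝ) ≤ h := by exact_mod_cast hh
    have a1 := le_max_left 1 (-Real.log (δ / |(y:ℝ)|))
    have a2 := le_max_right 1 (-Real.log (δ / |(y:ℝ)|))
    nlinarith
  · push Not at hd
    by_cases hd3 : ∃ k : Fin 3 → ℤ, ∑ j, (k j : ℝ) * Real.log (![r1, r2, g] j) = 0 ∧ k ≠ 0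
    · obtain ⟨k, hk, hk0⟩ := hd3
      simp [Fin.sum_univ_three] at hk
      have hk2 : k 2 ≠ 0 := by
        intro h0
        rw [h0] at hk
        obtain ⟨e0, e1⟩ := hd (k 0) (k 1) (by simpa using hk)
        apply hk0
        funext j; fin_cases j <;> simp [h0, e0, e1]
      obtain ⟨C, hC, H⟩ := bk_two r1 r2 h1 h2 (by linarith) (by linarith) hd
      set K : ℕ := (k 0).natAbs + (k 1).natAbs + (k 2).natAbs with hK
      refine ⟨C * (1 + K) + K, by positivity, ?_⟩
      intro h hh n1 n2 hn1 hn2 hΛ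
      have hh' : (1:ℝ) ≤ h := by exact_mod_cast hh
      have e : (k 2 : ℝ) * (L3 + n1 * L1 - n2 * L2) = ((k 2 * n1 - k 0 : ℤ) : ℝ) * L1 + ((-(k 2 * n2) - k 1 : ℤ) : ℝ) * L2 := by
        push_cast
        linear_combination hk
      have hKb : ∀ j, |(k j : ℝ)| ≤ K := by
        intro j
        have : (k j).natAbs ≤ K := by fin_cases j <;> simp [hK] <;> omega
        rw [← Int.cast_abs, Int.abs_eq_natAbs]
        exact_mod_cast this
      have hk2r : (1:ℝ) ≤ |(k 2 : ℝ)| := by exact_mod_cast Int.one_le_abs hk2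
      have hKpos : (1:ℝ) ≤ K := hk2r.trans (hKb 2)
      have hKN : 1 ≤ K := by exact_mod_cast hKpos
      have hpow : (K:ℝ) * 2 ^ h + K ≤ 2 ^ (h * (1 + K)) := by
        have s1 : 2 * K ≤ 2 ^ K := by
          have := Nat.lt_two_pow_self (n := K - 1)
          have e : 2 ^ K = 2 * 2 ^ (K - 1) := by
            rw [← pow_succ']; congr 1; omega
          rw [e]; omega
        have s2 : K * 2 ^ h + K ≤ 2 ^ (h * (1 + K)) := by
          have t1 : 1 ≤ 2 ^ h := Nat.one_le_two_pow
          calc K * 2 ^ h + K ≤ 2 * K * 2 ^ h := by nlinarith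
            _ ≤ 2 ^ K * 2 ^ h := by gcongr
            _ = 2 ^ (K + h) := (pow_add 2 K h).symm
            _ ≤ _ := by
              apply Nat.pow_le_pow_right (by norm_num)
              nlinarith
        exact_mod_cast s2
      have bnd : ∀ n : ℕ, n ≤ 2 ^ h → ∀ j, |(k 2 : ℝ)| * n + |(k j : ℝ)| ≤ 2 ^ (h * (1 + K)) := by
        intro n hn j
        have hn' : (n:ℝ) ≤ 2 ^ h := by exact_mod_cast hn
        refine le_trans ?_ hpow
        have := hKb 2
        have := hKb j
        gcongr
      have h3 := H (h * (1 + K)) (Nat.one_le_iff_ne_zero.mpr (by positivity)) (k 2 * n1 - k 0) (-(k 2 * n2) - k 1) (by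
        change ((k 2 * n1 - k 0 : ℤ) : ℝ) * L1 + ((-(k 2 * n2) - k 1 : ℤ) : ℝ) * L2 ≠ 0
        rw [← e]
        exact mul_ne_zero (by exact_mod_cast hk2) hΛ) (by
        push_cast
        refine (abs_sub _ _).trans ?_
        rw [abs_mul, Nat.abs_cast]
        exact bnd n1 hn1 0) (by
        push_cast
        refine (abs_sub _ _).trans ?_
        rw [abs_neg, abs_mul, Nat.abs_cast]
        exact bnd n2 hn2 1)
      change _ ≤ |((k 2 * n1 - k 0 : ℤ) : ℝ) * L1 + ((-(k 2 * n2) - k 1 : ℤ) : ℝ) * L2| at h3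
      rw [← e, abs_mul] at h3
      have hKe : (K:ℝ) ≤ Real.exp (K * h) := by
        have := Real.add_one_le_exp (K * h : ℝ)
        nlinarith
      have h4 : Real.exp (-(C * ((h * (1 + K) : ℕ) : ℝ))) ≤ Real.exp (K * h) * |L3 + n1 * L1 - n2 * L2| := by
        refine h3.trans ?_
        have := (hKb 2).trans hKe
        gcongr
      calc Real.exp (-((C * (1 + K) + K) * h)) = Real.exp (-(K * h)) * Real.exp (-(C * ((h * (1 + K) : ℕ) : ℝ))) := by
            rw [← Real.exp_add]; push_cast; ring_nf
        _ ≤ Real.exp (-(K * h)) * (Real.exp (K * h) * |L3 + n1 * L1 - n2 * L2|) := by gcongr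
        _ = _ := by rw [← mul_assoc, ← Real.exp_add]; simp
    · push Not at hd3
      obtain ⟨C, hC, H⟩ := bk_core ![r1, r2, g] (by intro j; fin_cases j <;> simp [h1, h2, hg])
        (by intro j; fin_cases j <;> simp <;> linarith) hd3
      refine ⟨C, by exact_mod_cast hC, ?_⟩
      intro h hh n1 n2 hn1 hn2 _
      have hp1 : (1:ℝ) ≤ 2 ^ h := one_le_pow₀ (by norm_num)
      have h3 := H h hh ![(n1:ℤ), -(n2:ℤ), 1] (by simp) (by
        intro j; fin_cases j
        · simp; exact_mod_cast hn1
        · simp; exact_mod_cast hn2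
        · simpa using hp1)
      simp [Fin.sum_univ_three] at h3
      have e : L3 + n1 * L1 - n2 * L2 = n1 * L1 + -(n2 * L2) + L3 := by ring
      rw [e]
      exact h3

theorem bk_alg_abs (c : ℝ) (h : IsAlgebraic ℚ c) : IsAlgebraic ℚ |c| := by
  rcases abs_choice c with h1 | h1 <;> rw [h1]
  · exact h
  · exact h.neg

theorem bk_diff (X Y : ℝ) (hX : 0 < X) (hY : 0 < Y) (hXY : X < 2 * Y) :
    X / 2 * |Real.log (X / Y)| ≤ |X - Y| := by
  rcases le_total X Y with h | h
  · have h1 : Real.log (X / Y) ≤ 0 := Real.log_nonpos (by positivity) (by rw [div_le_one hY]; exact h)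
    rw [abs_of_nonpos h1, abs_of_nonpos (by linarith)]
    have h2 : Real.log (Y / X) ≤ Y / X - 1 := Real.log_le_sub_one_of_pos (by positivity)
    have h3 : -Real.log (X / Y) = Real.log (Y / X) := by rw [← Real.log_inv, inv_div]
    rw [h3]
    have h4 : 0 ≤ Real.log (Y / X) := by rw [← h3]; linarith
    calc X / 2 * Real.log (Y / X) ≤ X * Real.log (Y / X) := by nlinarith
      _ ≤ X * (Y / X - 1) := by gcongr
      _ = -(X - Y) := by field_simp; ring
  · have h1 : 0 ≤ Real.log (X / Y) := Real.log_nonneg (by rw [one_le_div hY]; exact h)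
    rw [abs_of_nonneg h1, abs_of_nonneg (by linarith)]
    have h2 : Real.log (X / Y) ≤ X / Y - 1 := Real.log_le_sub_one_of_pos (by positivity)
    calc X / 2 * Real.log (X / Y) ≤ Y * Real.log (X / Y) := by nlinarith
      _ ≤ Y * (X / Y - 1) := by gcongr
      _ = X - Y := by field_simp

set_option maxHeartbeats 1600000 in
theorem bk_half (r1 r2 c1 c2 : ℝ) (h1 : IsAlgebraic ℚ r1) (h2 : IsAlgebraic ℚ r2)
    (ha1 : IsAlgebraic ℚ c1) (ha2 : IsAlgebraic ℚ c2) (hr1 : 1 < r1) (hr2 : 1 < r2)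
    (hc1 : c1 ≠ 0) (hc2 : c2 ≠ 0) :
    ∃ C : ℝ, 0 < C ∧ ∀ n1 n2 : ℕ, c1 * r1 ^ n1 + c2 * r2 ^ n2 ≠ 0 →
      |c1 * r1 ^ n1 + c2 * r2 ^ n2| > r1 ^ n1 / ((n1 : ℝ) + 2) ^ C := by
  have hc1' : 0 < |c1| := abs_pos.mpr hc1
  have hc2' : 0 < |c2| := abs_pos.mpr hc2
  have hg : IsAlgebraic ℚ (|c1| / |c2|) := by
    rw [div_eq_mul_inv]
    exact (bk_alg_abs c1 ha1).mul (bk_alg_abs c2 ha2).inv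
  obtain ⟨C, hC, H⟩ := bk_lin r1 r2 (|c1| / |c2|) h1 h2 hg hr1 hr2 (by positivity)
  have l1 := Real.log_pos hr1
  have l2 := Real.log_pos hr2
  set L3 := Real.log (|c1| / |c2|) with hL3
  obtain ⟨B, hB⟩ := exists_nat_ge (max 1 (max ((|L3| + 1) / Real.log r2) (Real.log r1 / Real.log r2)))
  have hB1 : (1:ℝ) ≤ B := (le_max_left _ _).trans hB
  have hB2 : (|L3| + 1) / Real.log r2 ≤ B := ((le_max_left _ _).trans (le_max_right _ _)).trans hB
  have hB3 : Real.log r1 / Real.log r2 ≤ B := ((le_max_right _ _).trans (le_max_right _ _)).trans hB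
  rw [div_le_iff₀ l2] at hB2 hB3
  have hlog2 : 0 < Real.log 2 := Real.log_pos (by norm_num)
  set K : ℝ := C * (B + 2) / Real.log 2 with hK
  have hK0 : 0 < K := by positivity
  obtain ⟨e, he⟩ := pow_unbounded_of_one_lt (2 / |c1|) (one_lt_two)
  refine ⟨K + e, by positivity, ?_⟩
  intro n1 n2 hne
  set m : ℝ := (n1 : ℝ) + 2 with hm
  have hm2 : 2 ≤ m := by rw [hm]; linarith [(Nat.cast_nonneg n1 : (0:ℝ) ≤ n1)]
  have hm0 : 0 < m := by linarith
  have hr1n : 0 < r1 ^ n1 := by positivity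
  have hr2n : 0 < r2 ^ n2 := by positivity
  have hmK : 1 ≤ m ^ K := Real.one_le_rpow (by linarith) hK0.le
  have hmK0 : 0 < m ^ K := by linarith
  set X := |c1| * r1 ^ n1 with hX
  set Y := |c2| * r2 ^ n2 with hY
  have hX0 : 0 < X := by positivity
  have hY0 : 0 < Y := by positivity
  have hEX : |c1 * r1 ^ n1| = X := by rw [abs_mul, abs_of_pos hr1n]
  have hEY : |c2 * r2 ^ n2| = Y := by rw [abs_mul, abs_of_pos hr2n]
  -- it suffices to prove the following weaker looking bound
  suffices hs : X / 2 / m ^ K ≤ |c1 * r1 ^ n1 + c2 * r2 ^ n2| by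
    refine lt_of_lt_of_le ?_ hs
    rw [Real.rpow_add hm0, Real.rpow_natCast]
    have hme : 2 / |c1| < m ^ e := he.trans_le (by gcongr)
    rw [div_lt_iff₀ hc1'] at hme
    have hme0 : 0 < m ^ e := by positivity
    rw [div_div, div_lt_div_iff₀ (by positivity) (by positivity), hX]
    have : 0 < r1 ^ n1 * m ^ K := by positivity
    nlinarith
  have hsimple : X / 2 / m ^ K ≤ X / 2 := div_le_self (by positivity) hmK
  by_cases hsame : 0 < c1 * c2
  · have : |c1 * r1 ^ n1 + c2 * r2 ^ n2| = X + Y := by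
      rw [← hEX, ← hEY]
      rcases pos_and_pos_or_neg_and_neg_of_mul_pos hsame with ⟨p, q⟩ | ⟨p, q⟩
      · rw [abs_of_pos (by positivity), abs_of_pos (by positivity), abs_of_pos (by positivity)]
      · have u1 : c1 * r1 ^ n1 < 0 := mul_neg_of_neg_of_pos p hr1n
        have u2 : c2 * r2 ^ n2 < 0 := mul_neg_of_neg_of_pos q hr2n
        rw [abs_of_neg u1, abs_of_neg u2, abs_of_neg (by linarith)]; ring
    rw [this]; linarith
  have hE : |c1 * r1 ^ n1 + c2 * r2 ^ n2| = |X - Y| := by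
    have hneg : c1 * c2 < 0 := lt_of_le_of_ne (not_lt.mp hsame) (mul_ne_zero hc1 hc2)
    rw [← hEX, ← hEY]
    rcases mul_neg_iff.mp hneg with ⟨p, q⟩ | ⟨p, q⟩
    · have u2 : c2 * r2 ^ n2 < 0 := mul_neg_of_neg_of_pos q hr2n
      rw [abs_of_neg u2, abs_of_pos (show 0 < c1 * r1 ^ n1 by positivity)]
      congr 1; ring
    · have u2 : c1 * r1 ^ n1 < 0 := mul_neg_of_neg_of_pos p hr1n
      rw [abs_of_neg u2, abs_of_pos (show 0 < c2 * r2 ^ n2 by positivity), ← abs_neg]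
      congr 1; ring
  rw [hE]
  have hXYne : X ≠ Y := by
    intro h
    rw [h, sub_self, abs_zero, abs_eq_zero] at hE
    exact hne hE
  by_cases hA : 2 * Y ≤ X
  · rw [abs_of_pos (by linarith)]; linarith
  by_cases hA2 : 2 * X ≤ Y
  · rw [abs_of_neg (by linarith)]; linarith
  push Not at hA hA2
  refine le_trans ?_ (bk_diff X Y hX0 hY0 hA)
  have hΛ : Real.log (X / Y) = L3 + n1 * Real.log r1 - n2 * Real.log r2 := by
    have : X / Y = (|c1| / |c2|) * r1 ^ n1 / r2 ^ n2 := by rw [hX, hY]; field_simp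
    rw [this, Real.log_div (by positivity) (by positivity), Real.log_mul (by positivity) (by positivity),
      Real.log_pow, Real.log_pow]
  have hΛne : Real.log (X / Y) ≠ 0 := by
    apply Real.log_ne_zero_of_pos_of_ne_one (by positivity)
    rw [Ne, div_eq_one_iff_eq hY0.ne']
    exact hXYne
  have hΛlow : -1 ≤ Real.log (X / Y) := by
    have : Real.log (Y / X) ≤ Y / X - 1 := Real.log_le_sub_one_of_pos (by positivity)
    have h3 : -Real.log (X / Y) = Real.log (Y / X) := by rw [← Real.log_inv, inv_div]
    have h4 : Y / X ≤ 2 := by rw [div_le_iff₀ hX0]; linarith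
    linarith
  rw [hΛ] at hΛne hΛlow ⊢
  have hn1 : (0:ℝ) ≤ n1 := Nat.cast_nonneg _
  have hn2 : (n2 : ℝ) ≤ B * m := by
    have h5 : (n2:ℝ) * Real.log r2 ≤ (B * m) * Real.log r2 := by
      have a1 := le_abs_self L3
      have a2 : (n1:ℝ) * Real.log r1 ≤ n1 * (B * Real.log r2) := by gcongr
      have a3 : 0 < (B:ℝ) * Real.log r2 := by positivity
      calc (n2:ℝ) * Real.log r2 ≤ B * Real.log r2 + n1 * (B * Real.log r2) := by linarith
        _ ≤ (B * m) * Real.log r2 := by rw [hm]; nlinarith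
    exact le_of_mul_le_mul_right h5 l2
  have hn1' : (n1 : ℝ) ≤ B * m := by rw [hm]; nlinarith
  set q : ℝ := Real.log m / Real.log 2 with hq
  have hq1 : 1 ≤ q := by
    rw [hq, one_le_div hlog2]
    exact Real.log_le_log (by norm_num) hm2
  have hceil : (⌈q⌉₊ : ℝ) < q + 1 := Nat.ceil_lt_add_one (by linarith)
  have hm2q : m ≤ 2 ^ ⌈q⌉₊ := by
    rw [← Real.log_le_log_iff hm0 (by positivity), Real.log_pow]
    have := Nat.le_ceil q
    calc Real.log m = q * Real.log 2 := by rw [hq]; field_simp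
      _ ≤ _ := by gcongr
  have hBm : (B:ℝ) * m ≤ 2 ^ (B + ⌈q⌉₊) := by
    rw [pow_add]
    have : (B:ℝ) ≤ 2 ^ B := by exact_mod_cast Nat.lt_two_pow_self.le
    gcongr
  have hB1N : 1 ≤ B := by exact_mod_cast hB1
  have hfin := H (B + ⌈q⌉₊) (by omega) n1 n2 (by exact_mod_cast hn1'.trans hBm) (by exact_mod_cast hn2.trans hBm) hΛne
  have hfin2 : 1 / m ^ K ≤ Real.exp (-(C * ((B + ⌈q⌉₊ : ℕ) : ℝ))) := by
    rw [one_div, ← Real.rpow_neg hm0.le, Real.rpow_def_of_pos hm0]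
    apply Real.exp_le_exp.mpr
    push_cast
    have e1 : Real.log m * -K = -(C * ((B + 2) * q)) := by
      rw [hK, hq]; ring
    rw [e1]
    have : (B:ℝ) + ⌈q⌉₊ ≤ (B + 2) * q := by nlinarith
    have := mul_le_mul_of_nonneg_left this hC.le
    linarith
  calc X / 2 / m ^ K = X / 2 * (1 / m ^ K) := by ring
    _ ≤ _ := by
      have := hfin2.trans hfin
      gcongr

/-- Baker-type lower bound for `|c₁·ρ₁^{n₁} + c₂·ρ₂^{n₂}|` for real algebraic
`ρ₁, ρ₂ > 1` and nonzero real algebraic `c₁, c₂`. -/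
theorem baker_sum_of_two_powers
    (ρ₁ ρ₂ c₁ c₂ : ℝ)
    (hρ₁alg : IsAlgebraic ℚ ρ₁) (hρ₂alg : IsAlgebraic ℚ ρ₂)
    (hc₁alg : IsAlgebraic ℚ c₁) (hc₂alg : IsAlgebraic ℚ c₂)
    (hρ₁ : 1 < ρ₁) (hρ₂ : 1 < ρ₂)
    (hc₁ : c₁ ≠ 0) (hc₂ : c₂ ≠ 0) :
    ∃ C : ℝ, 0 < C ∧ ∀ n₁ n₂ : ℕ,
      c₁ * ρ₁ ^ n₁ + c₂ * ρ₂ ^ n₂ ≠ 0 →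
      |c₁ * ρ₁ ^ n₁ + c₂ * ρ₂ ^ n₂| > ρ₁ ^ n₁ / ((n₁ : ℝ) + 2) ^ C ∧
      |c₁ * ρ₁ ^ n₁ + c₂ * ρ₂ ^ n₂| > ρ₂ ^ n₂ / ((n₂ : ℝ) + 2) ^ C := by
  obtain ⟨C1, hC1, H1⟩ := bk_half ρ₁ ρ₂ c₁ c₂ hρ₁alg hρ₂alg hc₁alg hc₂alg hρ₁ hρ₂ hc₁ hc₂
  obtain ⟨C2, hC2, H2⟩ := bk_half ρ₂ ρ₁ c₂ c₁ hρ₂alg hρ₁alg hc₂alg hc₁alg hρ₂ hρ₁ hc₂ hc₁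
  refine ⟨C1 + C2, by positivity, fun n₁ n₂ hne => ⟨?_, ?_⟩⟩
  · refine lt_of_le_of_lt ?_ (H1 n₁ n₂ hne)
    have : (0:ℝ) ≤ n₁ := Nat.cast_nonneg _
    gcongr
    · linarith
    · linarith
  · rw [add_comm (c₁ * ρ₁ ^ n₁)] at hne ⊢
    refine lt_of_le_of_lt ?_ (H2 n₂ n₁ hne)
    have : (0:ℝ) ≤ n₂ := Nat.cast_nonneg _
    gcongr
    · linarith
    · linarith
end

section
/- Let d ≥ 2 and let λ₁, …, λ_d be real algebraic numbers, each greater than 1, that are pairwise multiplicatively independent (for all i ≠ j and all integers a, b, λᵢ^a · λⱼ^b = 1 implies a = 0 and b = 0). Assume moreover that every triple is multiplicatively dependent: for all pairwise distinct i, j, k there exist integers (a, b, c) ≠ (0, 0, 0) with λᵢ^a · λⱼ^b · λ_k^c = 1. Then 1/log(λ₁), …, 1/log(λ_d) are linearly independent over ℚ: if q₁, …, q_d ∈ ℚ satisfy q₁/log(λ₁) + ⋯ + q_d/log(λ_d) = 0, then q₁ = ⋯ = q_d = 0. -/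
lemma gs_sum_lower {ι : Type*} [Fintype ι] (e : ι → ℕ) (he : Function.Injective e) :
    Fintype.card ι * (Fintype.card ι - 1) / 2 ≤ ∑ i, e i := by
  classical
  have key : ∀ s : Finset ℕ, ∑ k ∈ Finset.range s.card, k ≤ ∑ k ∈ s, k := by
    intro s
    induction s using Finset.induction_on_max with
    | empty => simp
    | insert a s ha ih =>
      have hns : a ∉ s := fun h => lt_irrefl _ (ha a h)
      rw [Finset.card_insert_of_notMem hns, Finset.sum_range_succ, Finset.sum_insert hns]
      have : s.card ≤ a := by
        have : s ⊆ Finset.range a := fun x hx => Finset.mem_range.2 (ha x hx)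
        simpa using Finset.card_le_card this
      omega
  have := key (Finset.univ.image e)
  rw [Finset.card_image_of_injective _ he, Finset.sum_image (fun x _ y _ h => he h),
    Finset.sum_range_id] at this
  simpa using this

lemma gs_det_poly {ι : Type*} [Fintype ι] [DecidableEq ι] (N : ℕ) (p : ι → ℕ) (c : ι → ℕ → ℝ)
    (hc : ∀ i m, 0 ≤ c i m) (ζ : ι → ℝ) (T R : ℝ) (hT0 : 0 ≤ T) (hT : ∀ j, |ζ j| ≤ T)
    (hR : 1 ≤ R) :
    |(Matrix.of fun i j => ∑ m : Fin N, c i m * ζ j ^ (p i + m)).det| *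
      R ^ (Fintype.card ι * (Fintype.card ι - 1) / 2) ≤
    (Fintype.card ι).factorial * ∏ i, ∑ m : Fin N, c i m * (R * T) ^ (p i + m) := by
  set Q := Fintype.card ι * (Fintype.card ι - 1) / 2
  have h1 : (Matrix.of fun i j => ∑ m : Fin N, c i m * ζ j ^ (p i + m)).det =
      ∑ r : ι → Fin N, (∏ i, c i (r i)) * (Matrix.of fun i j => ζ j ^ (p i + r i)).det := by
    have := (Matrix.detRowAlternating (n := ι) (R := ℝ)).toMultilinearMap.map_sum
      (fun i (m : Fin N) => c i m • (fun j => ζ j ^ (p i + m)))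
    have h2 : ∀ r : ι → Fin N, Matrix.detRowAlternating (n := ι) (R := ℝ)
        (fun i => c i (r i) • (fun j => ζ j ^ (p i + r i))) =
        (∏ i, c i (r i)) * (Matrix.of fun i j => ζ j ^ (p i + r i)).det := by
      intro r
      exact (Matrix.detRowAlternating (n := ι) (R := ℝ)).toMultilinearMap.map_smul_univ
        (fun i => c i (r i)) (fun i j => ζ j ^ (p i + r i))
    refine Eq.trans ?_ (this.trans (Finset.sum_congr rfl fun r _ => h2 r))
    show Matrix.det _ = Matrix.det _
    congr 1
    ext i j
    simp [Finset.sum_apply]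
  have h3 : ∀ r : ι → Fin N, |(Matrix.of fun i j => ζ j ^ (p i + r i)).det| * R ^ Q ≤
      (Fintype.card ι).factorial * ∏ i, (R * T) ^ (p i + r i) := by
    intro r
    by_cases hinj : Function.Injective (fun i => p i + (r i : ℕ))
    · have hQ : Q ≤ ∑ i, (p i + (r i : ℕ)) := gs_sum_lower _ hinj
      have hdet : |(Matrix.of fun i j => ζ j ^ (p i + r i)).det| ≤
          (Fintype.card ι).factorial * ∏ i, T ^ (p i + r i) := by
        rw [Matrix.det_apply]
        refine (Finset.abs_sum_le_sum_abs _ _).trans ?_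
        rw [← Fintype.card_perm, ← nsmul_eq_mul, ← Finset.card_univ]
        refine Finset.sum_le_card_nsmul _ _ _ fun σ _ => ?_
        have : |Equiv.Perm.sign σ • ∏ i, (Matrix.of fun i j => ζ j ^ (p i + (r i : ℕ))) (σ i) i| =
            ∏ i, |ζ i| ^ (p (σ i) + (r (σ i) : ℕ)) := by
          rcases Int.units_eq_one_or (Equiv.Perm.sign σ) with h | h <;>
            simp [h, Finset.abs_prod, abs_pow]
        rw [this, ← Equiv.prod_comp σ (fun i => T ^ (p i + (r i : ℕ)))]
        exact Finset.prod_le_prod (fun i _ => by positivity)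
          fun i _ => pow_le_pow_left₀ (abs_nonneg _) (hT i) _
      calc _ ≤ ((Fintype.card ι).factorial * ∏ i, T ^ (p i + (r i : ℕ))) *
            R ^ (∑ i, (p i + (r i : ℕ))) := by
              gcongr
        _ = _ := by
          rw [← Finset.prod_pow_eq_pow_sum, mul_assoc, ← Finset.prod_mul_distrib]
          simp_rw [mul_pow, mul_comm]
    · have : (Matrix.of fun i j => ζ j ^ (p i + r i)).det = 0 := by
        simp only [Function.Injective, not_forall] at hinj
        obtain ⟨a, b, hab, hne⟩ := hinj
        refine Matrix.det_zero_of_row_eq hne ?_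
        ext j
        simp only [Matrix.of_apply]
        rw [hab]
      rw [this]
      simp only [abs_zero, zero_mul]
      positivity
  have h4 : ∏ i, ∑ m : Fin N, c i m * (R * T) ^ (p i + m) =
      ∑ r : ι → Fin N, (∏ i, c i (r i)) * ∏ i, (R * T) ^ (p i + r i) := by
    rw [Finset.prod_univ_sum]
    simp [Finset.prod_mul_distrib]
  rw [h1, h4, Finset.mul_sum]
  calc _ ≤ (∑ r : ι → Fin N, (∏ i, c i (r i)) *
        |(Matrix.of fun i j => ζ j ^ (p i + r i)).det|) * R ^ Q := by
        gcongr
        refine (Finset.abs_sum_le_sum_abs _ _).trans (le_of_eq ?_)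
        refine Finset.sum_congr rfl fun r _ => ?_
        rw [abs_mul, abs_of_nonneg (Finset.prod_nonneg fun i _ => hc _ _)]
    _ ≤ _ := by
        rw [Finset.sum_mul]
        refine Finset.sum_le_sum fun r _ => ?_
        have := mul_le_mul_of_nonneg_left (h3 r)
          (Finset.prod_nonneg fun i (_ : i ∈ Finset.univ) => hc i (r i))
        linarith

lemma gs_det_upper {ι : Type*} [Fintype ι] [DecidableEq ι] (p : ι → ℕ) (w : ι → ℝ)
    (hw : ∀ i, 0 ≤ w i) (ζ : ι → ℝ) (T R : ℝ) (hT0 : 0 ≤ T) (hT : ∀ j, |ζ j| ≤ T)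
    (hR : 1 ≤ R) :
    |(Matrix.of fun i j => ζ j ^ p i * Real.exp (w i * ζ j)).det| *
      R ^ (Fintype.card ι * (Fintype.card ι - 1) / 2) ≤
    (Fintype.card ι).factorial * ∏ i, ((R * T) ^ p i * Real.exp (w i * (R * T))) := by
  have hs : ∀ (i : ι) (x : ℝ), HasSum (fun m : ℕ => w i ^ m / m.factorial * x ^ (p i + m))
      (x ^ p i * Real.exp (w i * x)) := by
    intro i x
    have := (NormedSpace.expSeries_div_hasSum_exp (w i * x)).mul_left (x ^ p i)
    rw [← Real.exp_eq_exp_ℝ] at this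
    have e : (fun m : ℕ => w i ^ m / m.factorial * x ^ (p i + m)) =
        fun m : ℕ => x ^ p i * ((w i * x) ^ m / m.factorial) := by
      funext m
      rw [mul_pow, pow_add]; ring
    rw [e]
    exact this
  have ht : ∀ (i : ι) (x : ℝ), Filter.Tendsto
      (fun N : ℕ => ∑ m : Fin N, w i ^ (m : ℕ) / (m : ℕ).factorial * x ^ (p i + m))
      Filter.atTop (nhds (x ^ p i * Real.exp (w i * x))) := by
    intro i x
    have := (hs i x).tendsto_sum_nat
    refine this.congr fun N => ?_
    rw [Finset.sum_range]
  have hdet : Filter.Tendsto (fun N : ℕ => |(Matrix.of fun i j => ∑ m : Fin N,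
      w i ^ (m : ℕ) / (m : ℕ).factorial * ζ j ^ (p i + m)).det| *
      R ^ (Fintype.card ι * (Fintype.card ι - 1) / 2)) Filter.atTop
      (nhds (|(Matrix.of fun i j => ζ j ^ p i * Real.exp (w i * ζ j)).det| *
      R ^ (Fintype.card ι * (Fintype.card ι - 1) / 2))) := by
    refine Filter.Tendsto.mul_const _ (Filter.Tendsto.abs ?_)
    simp only [Matrix.det_apply, Matrix.of_apply]
    refine tendsto_finsetSum _ fun σ _ => Filter.Tendsto.const_smul ?_ _
    exact tendsto_finsetProd _ fun i _ => ht _ _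
  refine le_of_tendsto hdet (Filter.Eventually.of_forall fun N => ?_)
  refine (gs_det_poly N p (fun i m => w i ^ m / m.factorial)
    (fun i m => div_nonneg (pow_nonneg (hw i) _) (by positivity)) ζ T R hT0 hT hR).trans ?_
  gcongr with i
  · intro i _
    exact Finset.sum_nonneg fun m _ => mul_nonneg (div_nonneg (pow_nonneg (hw i) _) (by positivity))
      (by positivity)
  · rw [← Finset.sum_range (fun m => w i ^ m / m.factorial * (R * T) ^ (p i + m))]
    exact sum_le_hasSum _ (fun m _ => mul_nonneg (div_nonneg (pow_nonneg (hw i) _) (by positivity))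
      (by positivity)) (hs i (R * T))

lemma gs_rolle (f f' : ℝ → ℝ) (hf : ∀ x, HasDerivAt f (f' x) x) (n : ℕ) (z : Fin (n + 1) → ℝ)
    (hz : StrictMono z) (h0 : ∀ k, f (z k) = 0) :
    ∃ y : Fin n → ℝ, StrictMono y ∧ ∀ k, f' (y k) = 0 := by
  have : ∀ k : Fin n, ∃ c ∈ Set.Ioo (z k.castSucc) (z k.succ), f' c = 0 := by
    intro k
    refine exists_hasDerivAt_eq_zero (hz k.castSucc_lt_succ) ?_ (by rw [h0, h0]) fun x _ => hf x
    exact fun x _ => (hf x).continuousAt.continuousWithinAt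
  choose y hy hy0 using this
  refine ⟨y, ?_, hy0⟩
  intro a b hab
  have h1 := (hy a).2
  have h2 := (hy b).1
  have h3 : z a.succ ≤ z b.castSucc := hz.monotone (by
    rw [Fin.le_def]; simpa using hab)
  linarith

open Polynomial in
lemma gs_zeros {κ : Type*} [Fintype κ] [DecidableEq κ] (n : ℕ) :
    ∀ (d : κ → ℕ) (w : κ → ℝ) (P : κ → ℝ[X]), Function.Injective w → (∑ k, d k = n) →
    (∀ k, (P k).degree < d k) → ∀ z : Fin n → ℝ, StrictMono z →
    (∀ j, ∑ k, (P k).eval (z j) * Real.exp (w k * z j) = 0) → ∀ k, P k = 0 := by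
  induction n with
  | zero =>
    intro d w P _ hd hP z _ _ k
    have hk : d k = 0 := by
      have := (Finset.sum_eq_zero_iff.1 hd) k (Finset.mem_univ k)
      exact this
    have := hP k
    rw [hk] at this
    by_contra hne
    rw [Polynomial.degree_eq_natDegree hne] at this
    norm_cast at this
  | succ n ih =>
    intro d w P hw hd hP z hz h0
    obtain ⟨q, hq⟩ : ∃ q, d q ≠ 0 := by
      by_contra hcon
      push Not at hcon
      simp [hcon] at hd
    set P' : κ → ℝ[X] := fun k => derivative (P k) + C (w k - w q) * P k with hP'
    have hder : ∀ x, HasDerivAt (fun x => ∑ k, (P k).eval x * Real.exp ((w k - w q) * x))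
        (∑ k, (P' k).eval x * Real.exp ((w k - w q) * x)) x := by
      intro x
      refine HasDerivAt.fun_sum fun k _ => ?_
      have h1 := (P k).hasDerivAt x
      have h2 : HasDerivAt (fun x => Real.exp ((w k - w q) * x))
          (Real.exp ((w k - w q) * x) * ((w k - w q) * 1)) x :=
        ((hasDerivAt_id x).const_mul (w k - w q)).exp
      refine (h1.mul h2).congr_deriv ?_
      simp only [hP', eval_add, eval_mul, eval_C]
      ring
    have h0' : ∀ j, ∑ k, (P k).eval (z j) * Real.exp ((w k - w q) * z j) = 0 := by
      intro j
      have : ∀ k, (P k).eval (z j) * Real.exp ((w k - w q) * z j) =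
          Real.exp (-(w q * z j)) * ((P k).eval (z j) * Real.exp (w k * z j)) := by
        intro k
        have : (w k - w q) * z j = -(w q * z j) + w k * z j := by ring
        rw [this, Real.exp_add]; ring
      simp_rw [this]
      rw [← Finset.mul_sum, h0, mul_zero]
    obtain ⟨y, hy, hy0⟩ := gs_rolle _ _ hder n z hz h0'
    have hP'0 := ih (Function.update d q (d q - 1)) (fun k => w k - w q) P'
      (fun a b hab => hw (by simpa using hab))
      (by
        rw [Finset.sum_update_of_mem (Finset.mem_univ q)]
        rw [← Finset.sum_sdiff (Finset.subset_univ {q}), Finset.sum_singleton] at hd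
        omega)
      (by
        intro k
        by_cases hk : k = q
        · subst hk
          simp only [hP', sub_self, map_zero, zero_mul, add_zero, Function.update_self]
          by_cases hPk : P k = 0
          · simp [hPk]
            
          · have h1 := hP k
            have h2 := Polynomial.degree_derivative_lt hPk
            by_cases hd0 : derivative (P k) = 0
            · simp [hd0]
              
            · rw [Polynomial.degree_eq_natDegree hPk] at h1 h2
              rw [Polynomial.degree_eq_natDegree hd0] at h2 ⊢
              norm_cast at h1 h2 ⊢
              omega
        · simp only [hP', Function.update_of_ne hk]
          refine lt_of_le_of_lt (Polynomial.degree_add_le _ _) (max_lt ?_ ?_)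
          · exact lt_of_le_of_lt (Polynomial.degree_derivative_le) (hP k)
          · refine lt_of_le_of_lt ?_ (hP k)
            rw [← Polynomial.smul_eq_C_mul]
            exact Polynomial.degree_smul_le _ _)
      y hy hy0
    have hne : ∀ k, k ≠ q → P k = 0 := by
      intro k hk
      by_contra hPk
      have h1 := hP'0 k
      have h2 : derivative (P k) = - (C (w k - w q) * P k) := eq_neg_of_add_eq_zero_left h1
      have h3 := Polynomial.degree_derivative_lt hPk
      rw [h2, Polynomial.degree_neg, Polynomial.degree_C_mul (sub_ne_zero.2 (hw.ne hk))] at h3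
      exact lt_irrefl _ h3
    have hqc : P q = C ((P q).coeff 0) := by
      have h1 := hP'0 q
      simp only [hP', sub_self, map_zero, zero_mul, add_zero] at h1
      exact Polynomial.eq_C_of_derivative_eq_zero h1
    have hz0 := h0' 0
    rw [Finset.sum_eq_single q (fun k _ hk => by simp [hne k hk]) (by simp), hqc] at hz0
    simp at hz0
    intro k
    by_cases hk : k = q
    · rw [hk, hqc, hz0, map_zero]
    · exact hne k hk

/-- Nonvanishing of the interpolation determinant. -/
lemma gs_det_ne_zero (A B : ℕ) (ℓ : ℝ) (hℓ : ℓ ≠ 0) (ζ : Fin A × Fin B → ℝ)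
    (hζ : Function.Injective ζ) :
    (Matrix.of fun (i j : Fin A × Fin B) =>
      ζ j ^ (i.1 : ℕ) * Real.exp (((i.2 : ℕ) * ℓ) * ζ j)).det ≠ 0 := by
  intro hdet
  obtain ⟨v, hv, hv0⟩ := Matrix.exists_vecMul_eq_zero_iff.2 hdet
  have hcard : (Finset.univ.image ζ).card = B * A := by
    rw [Finset.card_image_of_injective _ hζ]; simp [mul_comm]
  set z := (Finset.univ.image ζ).orderEmbOfFin hcard
  have key := gs_zeros (κ := Fin B) (B * A) (fun _ => A) (fun k => (k : ℕ) * ℓ)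
    (fun k => ∑ i : Fin A, Polynomial.monomial (i : ℕ) (v (i, k)))
    (fun a b hab => by
      have := mul_right_cancel₀ hℓ hab
      exact Fin.ext (by exact_mod_cast this))
    (by simp)
    (fun k => by
      refine lt_of_le_of_lt (Polynomial.degree_sum_le _ _) ?_
      rw [Finset.sup_lt_iff (WithBot.bot_lt_coe _)]
      intro i _
      refine lt_of_le_of_lt (Polynomial.degree_monomial_le _ _) ?_
      exact_mod_cast i.2)
    z z.strictMono
    (fun j => by
      have hmem := Finset.orderEmbOfFin_mem (Finset.univ.image ζ) hcard j
      obtain ⟨x, -, hx⟩ := Finset.mem_image.1 hmem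
      have h1 := congrFun hv0 x
      simp only [Matrix.vecMul, dotProduct, Matrix.of_apply, Pi.zero_apply] at h1
      rw [Fintype.sum_prod_type_right] at h1
      rw [show z j = ζ x from hx.symm, ← h1]
      refine Finset.sum_congr rfl fun k _ => ?_
      rw [Polynomial.eval_finsetSum, Finset.sum_mul]
      refine Finset.sum_congr rfl fun i _ => ?_
      rw [Polynomial.eval_monomial, mul_assoc])
  apply hv
  ext ⟨a, b⟩
  have h1 := congrArg (fun p => Polynomial.coeff p (a : ℕ)) (key b)
  simp only [Polynomial.finsetSum_coeff, Polynomial.coeff_monomial, Polynomial.coeff_zero] at h1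
  rw [Finset.sum_eq_single a (fun i _ hi => if_neg fun h => hi (Fin.ext h)) (by simp)] at h1
  simpa using h1

lemma gs_lower {K : Type*} [Field K] [NumberField K] {ι : Type*} [Fintype ι] [DecidableEq ι]
    (σ₀ : K →+* ℂ) (M : Matrix ι ι K) (c : ℤ) (hc : c ≠ 0) (E : ℕ)
    (hint : ∀ i j, IsIntegral ℤ ((c : K) ^ E * M i j)) (B : ℝ)
    (hB : ∀ (σ : K →+* ℂ) i j, ‖σ (M i j)‖ ≤ B) (hdet : M.det ≠ 0) :
    1 ≤ (|(c : ℝ)| ^ E) ^ Fintype.card ι * ‖σ₀ M.det‖ *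
      ((Fintype.card ι).factorial * (|(c : ℝ)| ^ E * B) ^ Fintype.card ι) ^
        (Module.finrank ℚ K - 1) := by
  set M' : Matrix ι ι K := (c : K) ^ E • M with hM'
  have hdet' : M'.det = ((c : K) ^ E) ^ Fintype.card ι * M.det := by
    rw [hM', Matrix.det_smul]
  have hcK : (c : K) ≠ 0 := by exact_mod_cast hc
  have hne : M'.det ≠ 0 := by
    rw [hdet']; exact mul_ne_zero (pow_ne_zero _ (pow_ne_zero _ hcK)) hdet
  have hI : IsIntegral ℤ M'.det := IsIntegral.det fun i j => by simpa [hM'] using hint i j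
  have hσ : ∀ σ : K →+* ℂ, ‖σ M'.det‖ ≤
      (Fintype.card ι).factorial * (|(c : ℝ)| ^ E * B) ^ Fintype.card ι := by
    intro σ
    rw [RingHom.map_det]
    have := Matrix.det_le (A := σ.mapMatrix M') (abv := NormedField.toAbsoluteValue ℂ)
      (x := |(c : ℝ)| ^ E * B) (fun i j => by
        show ‖σ (M' i j)‖ ≤ _
        simp only [hM', Matrix.smul_apply, smul_eq_mul, map_mul, map_pow, norm_mul, norm_pow,
          map_intCast, Complex.norm_intCast]
        exact mul_le_mul_of_nonneg_left (hB σ i j) (by positivity))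
    rw [nsmul_eq_mul] at this
    exact this
  have hhouse : NumberField.house M'.det ≤
      (Fintype.card ι).factorial * (|(c : ℝ)| ^ E * B) ^ Fintype.card ι := by
    obtain ⟨σ, -, hs⟩ := Finset.exists_mem_eq_sup' (Finset.univ_nonempty (α := K →+* ℂ))
      (fun φ : K →+* ℂ => ‖φ M'.det‖₊)
    rw [NumberField.house_eq_sup', hs]
    exact hσ σ
  have h1 := NumberField.norm_norm_le_norm_mul_house_pow M'.det σ₀
  have h2 : 1 ≤ ‖Algebra.norm ℚ M'.det‖ := by
    obtain ⟨m, hm⟩ := IsIntegrallyClosed.isIntegral_iff.1 (Algebra.isIntegral_norm ℚ hI)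
    rw [← hm]
    have hm0 : m ≠ 0 := by
      rintro rfl
      rw [map_zero] at hm
      exact hne (Algebra.norm_eq_zero_iff.1 hm.symm)
    simp only [eq_intCast, Int.norm_cast_rat, Int.norm_eq_abs]
    exact_mod_cast Int.one_le_abs hm0
  refine h2.trans (h1.trans ?_)
  have h3 : ‖σ₀ M'.det‖ = (|(c : ℝ)| ^ E) ^ Fintype.card ι * ‖σ₀ M.det‖ := by
    rw [hdet']; simp
  rw [h3]
  gcongr
  exact NumberField.house_nonneg _

lemma gs_entry_integral {K : Type*} [Field K] (a b g : K) (c : ℤ)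
    (ha : IsIntegral ℤ ((c : K) * a)) (hb : IsIntegral ℤ ((c : K) * b))
    (hg : IsIntegral ℤ ((c : K) * g)) (p q s t A D S : ℕ) (hp : p ≤ A) (hq : q ≤ D)
    (hs : s ≤ S) (ht : t ≤ S) :
    IsIntegral ℤ ((c : K) ^ (A + 2 * (D * S)) * (((s : K) + t * b) ^ p * (a ^ s * g ^ t) ^ q)) := by
  have h1 : s * q ≤ D * S := by rw [mul_comm]; exact Nat.mul_le_mul hq hs
  have h2 : t * q ≤ D * S := by rw [mul_comm]; exact Nat.mul_le_mul hq ht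
  obtain ⟨r, hr⟩ : ∃ r, A + 2 * (D * S) = r + p + s * q + t * q :=
    ⟨A + 2 * (D * S) - (p + s * q + t * q), by omega⟩
  have hcI : IsIntegral ℤ (c : K) := by simpa using isIntegral_algebraMap (R := ℤ) (A := K) (x := c)
  have hN : ∀ m : ℕ, IsIntegral ℤ (m : K) := fun m => by
    simpa using isIntegral_algebraMap (R := ℤ) (A := K) (x := (m : ℤ))
  have : (c : K) ^ (A + 2 * (D * S)) * (((s : K) + t * b) ^ p * (a ^ s * g ^ t) ^ q) =
      (c : K) ^ r * ((c * s + t * (c * b)) ^ p * (((c : K) * a) ^ s * (c * g) ^ t) ^ q) := by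
    have e1 : (c : K) * s + t * (c * b) = c * (s + t * b) := by ring
    rw [hr, e1]
    simp only [mul_pow, pow_add, pow_mul]
    ring
  rw [this]
  exact (hcI.pow _).mul ((((hcI.mul (hN s)).add ((hN t).mul hb)).pow _).mul
    (((ha.pow _).mul (hg.pow _)).pow _))

lemma gs_entry_norm (a b g : ℂ) (A : ℝ) (hA : 1 ≤ A) (ha : ‖a‖ ≤ A) (hb : ‖b‖ ≤ A) (hg : ‖g‖ ≤ A)
    (p q s t P D S : ℕ) (hp : p ≤ P) (hq : q ≤ D)
    (hs : s ≤ S) (ht : t ≤ S) (hS : 1 ≤ S) :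
    ‖((s : ℂ) + t * b) ^ p * (a ^ s * g ^ t) ^ q‖ ≤ (2 * S * A) ^ P * (A ^ (2 * S)) ^ D := by
  have hsS : (s : ℝ) ≤ S := by exact_mod_cast hs
  have htS : (t : ℝ) ≤ S := by exact_mod_cast ht
  have hS1 : (1 : ℝ) ≤ S := by exact_mod_cast hS
  have h1 : ‖(s : ℂ) + t * b‖ ≤ 2 * S * A := by
    refine (norm_add_le _ _).trans ?_
    rw [norm_mul, Complex.norm_natCast, Complex.norm_natCast]
    have : (t : ℝ) * ‖b‖ ≤ S * A := mul_le_mul htS hb (norm_nonneg _) (by positivity)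
    nlinarith
  have h2 : ‖a ^ s * g ^ t‖ ≤ A ^ (2 * S) := by
    rw [norm_mul, norm_pow, norm_pow, two_mul, pow_add]
    gcongr
    · exact (pow_le_pow_left₀ (norm_nonneg _) ha _).trans (pow_le_pow_right₀ hA hs)
    · exact (pow_le_pow_left₀ (norm_nonneg _) hg _).trans (pow_le_pow_right₀ hA ht)
  rw [norm_mul, norm_pow, norm_pow]
  have h3 : 1 ≤ 2 * S * A := by nlinarith
  gcongr
  · exact (pow_le_pow_left₀ (norm_nonneg _) h1 _).trans (pow_le_pow_right₀ h3 hp)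
  · exact (pow_le_pow_left₀ (norm_nonneg _) h2 _).trans (pow_le_pow_right₀ (one_le_pow₀ hA) hq)

lemma gs_numeric (C A t ℓ : ℝ) (hC : 1 ≤ C) (hA : 1 ≤ A) (ht : 0 ≤ t) (hℓ : 0 ≤ ℓ) (h : ℕ)
    (H : ∀ n : ℕ, 1 ≤ n → ∃ X : ℝ, 0 ≤ X ∧
      1 ≤ (C ^ (n ^ 4 + 2 * (n ^ 2 * n ^ 3))) ^ (n ^ 6) * X * (((n ^ 6).factorial : ℝ) *
        (C ^ (n ^ 4 + 2 * (n ^ 2 * n ^ 3)) *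
          ((2 * ((n ^ 3 : ℕ) : ℝ) * A) ^ (n ^ 4) * (A ^ (2 * n ^ 3)) ^ (n ^ 2))) ^ (n ^ 6)) ^ h ∧
      X * 4 ^ (n ^ 6 * (n ^ 6 - 1) / 2) ≤ ((n ^ 6).factorial : ℝ) *
        ((4 * (((n ^ 3 : ℕ) : ℝ) * (1 + t))) ^ (n ^ 4) *
          Real.exp (((n ^ 2 : ℕ) : ℝ) * ℓ * (4 * (((n ^ 3 : ℕ) : ℝ) * (1 + t))))) ^ (n ^ 6)) :
    False := by
  set G : ℝ := 64 * (32 * (1 + t) * Real.exp (4 * ℓ * (1 + t))) * C ^ 3 *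
    (64 * (C ^ 3 * (16 * A * A ^ 2))) ^ h with hG
  obtain ⟨g, hg⟩ : ∃ g : ℕ, G ≤ 2 ^ g := by
    obtain ⟨g, hg⟩ := pow_unbounded_of_one_lt G (one_lt_two)
    exact ⟨g, hg.le⟩
  have hn : 1 ≤ g + 2 := by omega
  obtain ⟨X, hX, h1, h2⟩ := H (g + 2) hn
  set n := g + 2 with hndef
  set L := n ^ 6 with hL
  set E := n ^ 4 + 2 * (n ^ 2 * n ^ 3) with hE
  set B := (2 * ((n ^ 3 : ℕ) : ℝ) * A) ^ (n ^ 4) * (A ^ (2 * n ^ 3)) ^ (n ^ 2) with hB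
  set U := (4 * (((n ^ 3 : ℕ) : ℝ) * (1 + t))) ^ (n ^ 4) *
          Real.exp (((n ^ 2 : ℕ) : ℝ) * ℓ * (4 * (((n ^ 3 : ℕ) : ℝ) * (1 + t)))) with hU
  have hL1 : 1 ≤ L := Nat.one_le_pow _ _ hn
  have hB0 : 0 ≤ B := by positivity
  have hU0 : 0 ≤ U := by positivity
  have hfac : ((L.factorial : ℕ) : ℝ) ≤ (L : ℝ) ^ L := by exact_mod_cast Nat.factorial_le_pow L
  -- combine
  have h3 : (2 : ℝ) ^ ((L - 1) * L) ≤ ((L * U) * C ^ E * (L * (C ^ E * B)) ^ h) ^ L := by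
    have hQ : (4 : ℝ) ^ (L * (L - 1) / 2) = 2 ^ ((L - 1) * L) := by
      have he : 2 ∣ L * (L - 1) := (Nat.even_mul_pred_self L).two_dvd
      rw [show (4 : ℝ) = 2 ^ 2 by norm_num, ← pow_mul, Nat.mul_div_cancel' he, mul_comm]
    rw [hQ] at h2
    have h2' : X * 2 ^ ((L - 1) * L) ≤ (L * U) ^ L := by
      refine h2.trans ?_
      rw [mul_pow (L : ℝ) U L]
      exact mul_le_mul_of_nonneg_right hfac (pow_nonneg hU0 _)
    have h1' : 1 ≤ (C ^ E) ^ L * X * ((L * (C ^ E * B)) ^ L) ^ h := by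
      refine h1.trans ?_
      rw [mul_pow (L : ℝ) (C ^ E * B) L]
      refine mul_le_mul_of_nonneg_left (pow_le_pow_left₀ (by positivity) ?_ _) (by positivity)
      exact mul_le_mul_of_nonneg_right hfac (by positivity)
    calc (2 : ℝ) ^ ((L - 1) * L) = 1 * 2 ^ ((L - 1) * L) := (one_mul _).symm
      _ ≤ ((C ^ E) ^ L * X * ((L * (C ^ E * B)) ^ L) ^ h) * 2 ^ ((L - 1) * L) := by gcongr
      _ = (X * 2 ^ ((L - 1) * L)) * ((C ^ E) ^ L * ((L * (C ^ E * B)) ^ L) ^ h) := by ring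
      _ ≤ (L * U) ^ L * ((C ^ E) ^ L * ((L * (C ^ E * B)) ^ L) ^ h) := by gcongr
      _ = _ := by
        rw [mul_pow (L * U * C ^ E), mul_pow (L * U), ← pow_mul _ L h, mul_comm L h,
          pow_mul _ h L, mul_assoc]
  have h4 : (2 : ℝ) ^ (L - 1) ≤ (L * U) * C ^ E * (L * (C ^ E * B)) ^ h := by
    rw [pow_mul] at h3
    exact le_of_pow_le_pow_left₀ (by omega) (by positivity) h3
  -- bounds
  have hn2 : (n : ℝ) ≤ 2 ^ n := by exact_mod_cast (Nat.lt_two_pow_self (n := n)).le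
  have hnn : n ≠ 0 := by omega
  have hn5 : n ≤ n ^ 5 := Nat.le_self_pow (by norm_num) n
  have bL : (L : ℝ) ≤ 64 ^ (n ^ 5) := by
    calc (L : ℝ) = (n : ℝ) ^ 6 := by rw [hL]; push_cast; rfl
      _ ≤ (2 ^ n) ^ 6 := by gcongr
      _ = 64 ^ n := by rw [← pow_mul, mul_comm, pow_mul]; norm_num
      _ ≤ _ := pow_le_pow_right₀ (by norm_num) hn5
  have bn3 : ∀ (k y : ℝ), 1 ≤ k → 1 ≤ y → k * ((n ^ 3 : ℕ) : ℝ) * y ≤ (8 * k * y) ^ n := by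
    intro k y hk hy
    have e1 : k ≤ k ^ n := le_self_pow₀ hk hnn
    have e2 : y ≤ y ^ n := le_self_pow₀ hy hnn
    have e3 : ((n ^ 3 : ℕ) : ℝ) ≤ 8 ^ n := by
      push_cast
      calc (n : ℝ) ^ 3 ≤ (2 ^ n) ^ 3 := by gcongr
        _ = 8 ^ n := by rw [← pow_mul, mul_comm, pow_mul]; norm_num
    calc _ ≤ k ^ n * 8 ^ n * y ^ n := by gcongr
      _ = _ := by rw [mul_pow, mul_pow]; ring
  have bC : C ^ E ≤ (C ^ 3) ^ (n ^ 5) := by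
    rw [← pow_mul]
    refine pow_le_pow_right₀ hC ?_
    have : n ^ 4 ≤ n ^ 5 := Nat.pow_le_pow_right hn (by norm_num)
    have h' : n ^ 2 * n ^ 3 = n ^ 5 := by ring
    rw [hE, h']; omega
  have bB : B ≤ (16 * A * A ^ 2) ^ (n ^ 5) := by
    have e1 : (2 * ((n ^ 3 : ℕ) : ℝ) * A) ^ (n ^ 4) ≤ (16 * A) ^ (n ^ 5) := by
      calc _ ≤ ((8 * 2 * A) ^ n) ^ (n ^ 4) := by
            gcongr
            exact bn3 2 A (by norm_num) hA
        _ = _ := by rw [← pow_mul]; norm_num; ring_nf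
    have e2 : (A ^ (2 * n ^ 3)) ^ (n ^ 2) = (A ^ 2) ^ (n ^ 5) := by
      rw [← pow_mul, ← pow_mul]; ring_nf
    rw [hB, e2, mul_pow (16 * A)]
    gcongr
  have bU : U ≤ (32 * (1 + t) * Real.exp (4 * ℓ * (1 + t))) ^ (n ^ 5) := by
    have e1 : (4 * (((n ^ 3 : ℕ) : ℝ) * (1 + t))) ^ (n ^ 4) ≤ (32 * (1 + t)) ^ (n ^ 5) := by
      calc _ ≤ ((8 * 4 * (1 + t)) ^ n) ^ (n ^ 4) := by
            gcongr
            rw [← mul_assoc]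
            exact bn3 4 (1 + t) (by norm_num) (by linarith)
        _ = _ := by rw [← pow_mul]; norm_num; ring_nf
    have e2 : Real.exp (((n ^ 2 : ℕ) : ℝ) * ℓ * (4 * (((n ^ 3 : ℕ) : ℝ) * (1 + t)))) =
        Real.exp (4 * ℓ * (1 + t)) ^ (n ^ 5) := by
      rw [← Real.exp_nat_mul]
      congr 1
      push_cast
      ring
    rw [hU, e2, mul_pow (32 * (1 + t))]
    gcongr
  have h5 : (2 : ℝ) ^ (L - 1) ≤ G ^ (n ^ 5) := by
    calc _ ≤ _ := h4
      _ ≤ (64 ^ (n ^ 5) * (32 * (1 + t) * Real.exp (4 * ℓ * (1 + t))) ^ (n ^ 5)) *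
          (C ^ 3) ^ (n ^ 5) * (64 ^ (n ^ 5) * ((C ^ 3) ^ (n ^ 5) *
            (16 * A * A ^ 2) ^ (n ^ 5))) ^ h := by gcongr
      _ = _ := by
        rw [← mul_pow (C ^ 3), ← mul_pow 64, ← mul_pow 64, ← pow_mul _ (n ^ 5) h,
          mul_comm (n ^ 5) h, pow_mul _ h, ← mul_pow, ← mul_pow]
  have hG0 : 0 ≤ G := by positivity
  have h6 : (2 : ℝ) ^ (L - 1) ≤ 2 ^ (g * n ^ 5) := by
    rw [pow_mul]
    exact h5.trans (pow_le_pow_left₀ hG0 hg _)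
  have h7 : L - 1 ≤ g * n ^ 5 := (pow_le_pow_iff_right₀ (by norm_num)).1 h6
  have h8 : L = g * n ^ 5 + 2 * n ^ 5 := by
    rw [hL, pow_succ, mul_comm, ← add_mul]
  have h9 : 1 ≤ n ^ 5 := Nat.one_le_pow _ _ hn
  omega

lemma gs_exp_eq (α γ : ℝ) (hα : 1 < α) (hγ : 1 < γ) (s t q : ℕ) :
    (α ^ s * γ ^ t) ^ q = Real.exp (((q : ℝ) * Real.log α) *
      (s + t * (Real.log γ / Real.log α))) := by
  have hl : Real.log α ≠ 0 := (Real.log_pos hα).ne'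
  have : ((q : ℝ) * Real.log α) * (s + t * (Real.log γ / Real.log α)) =
      q * (s * Real.log α + t * Real.log γ) := by
    field_simp
  rw [this, Real.exp_nat_mul, Real.exp_add, Real.exp_nat_mul, Real.exp_nat_mul,
    Real.exp_log (by linarith), Real.exp_log (by linarith)]

/-- Real case of the Gelfond–Schneider theorem. -/
lemma gs_real (α γ : ℝ) (hα : 1 < α) (hγ : 1 < γ) (ha : IsAlgebraic ℚ α) (hg : IsAlgebraic ℚ γ)
    (hirr : Irrational (Real.log γ / Real.log α)) :
    Transcendental ℚ (Real.log γ / Real.log α) := by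
  intro hb
  set t := Real.log γ / Real.log α with ht
  set ℓ := Real.log α with hℓdef
  have hℓ : 0 < ℓ := Real.log_pos hα
  have ht0 : 0 ≤ t := div_nonneg (Real.log_pos hγ).le hℓ.le
  let K := IntermediateField.adjoin ℚ ({α, t, γ} : Set ℝ)
  have hfin : FiniteDimensional ℚ K := by
    have : Finite ({α, t, γ} : Set ℝ) := Set.toFinite _
    refine IntermediateField.finiteDimensional_adjoin ?_
    intro x hx
    rcases hx with rfl | rfl | rfl
    · exact ha.isIntegral
    · exact hb.isIntegral
    · exact hg.isIntegral
  have : NumberField K := { to_charZero := inferInstance, to_finiteDimensional := hfin }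
  have hsub := IntermediateField.subset_adjoin ℚ ({α, t, γ} : Set ℝ)
  let a : K := ⟨α, hsub (by simp)⟩
  let b : K := ⟨t, hsub (by simp)⟩
  let g : K := ⟨γ, hsub (by simp)⟩
  obtain ⟨c, hc, hcint⟩ : ∃ c : ℤ, c ≠ 0 ∧ ∀ z ∈ ({a, b, g} : Finset K),
      IsIntegral ℤ ((c : K) * z) := by
    have : Algebra.IsAlgebraic ℤ K :=
      (IsFractionRing.comap_isAlgebraic_iff (A := ℤ) (K := ℚ) (C := K)).2 inferInstance
    obtain ⟨c, hc, h⟩ := Algebra.IsAlgebraic.exists_integral_multiples ℤ ({a, b, g} : Finset K)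
    exact ⟨c, hc, fun z hz => by simpa using h z hz⟩
  let A : ℝ := 1 + NumberField.house a + NumberField.house b + NumberField.house g
  have hA1 := NumberField.house_nonneg a
  have hA2 := NumberField.house_nonneg b
  have hA3 := NumberField.house_nonneg g
  let φ : K →+* ℝ := K.val.toRingHom
  let σ₀ : K →+* ℂ := Complex.ofRealHom.comp φ
  refine gs_numeric |(c : ℝ)| A t ℓ (by exact_mod_cast Int.one_le_abs hc) (by simp only [A]; linarith)
    ht0 hℓ.le (Module.finrank ℚ K - 1) ?_
  intro n hn
  have hcard : Fintype.card (Fin (n ^ 4) × Fin (n ^ 2)) = n ^ 6 := by simp; ring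
  let e : Fin (n ^ 4) × Fin (n ^ 2) ≃ Fin (n ^ 3) × Fin (n ^ 3) :=
    Fintype.equivOfCardEq (by simp; ring)
  let M : Matrix (Fin (n ^ 4) × Fin (n ^ 2)) (Fin (n ^ 4) × Fin (n ^ 2)) K :=
    Matrix.of fun i j => (((e j).1 : ℕ) + ((e j).2 : ℕ) * b) ^ (i.1 : ℕ) *
      (a ^ ((e j).1 : ℕ) * g ^ ((e j).2 : ℕ)) ^ (i.2 : ℕ)
  let ζ : Fin (n ^ 4) × Fin (n ^ 2) → ℝ := fun j => ((e j).1 : ℕ) + ((e j).2 : ℕ) * t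
  have hζ : Function.Injective ζ := by
    intro x y hxy
    apply e.injective
    simp only [ζ] at hxy
    by_cases h2 : ((e x).2 : ℕ) = (e y).2
    · rw [h2] at hxy
      have h1 : ((e x).1 : ℕ) = (e y).1 := by exact_mod_cast add_right_cancel hxy
      exact Prod.ext (Fin.ext h1) (Fin.ext h2)
    · exfalso
      have h3 : (((e x).2 : ℕ) : ℝ) - ((e y).2 : ℕ) ≠ 0 := sub_ne_zero.2 (by exact_mod_cast h2)
      apply hirr
      refine ⟨((((e y).1 : ℕ) : ℚ) - ((e x).1 : ℕ)) / (((e x).2 : ℕ) - ((e y).2 : ℕ)), ?_⟩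
      push_cast
      rw [div_eq_iff h3]
      linarith
  have hφM : φ.mapMatrix M = Matrix.of fun i j => ζ j ^ (i.1 : ℕ) *
      Real.exp (((i.2 : ℕ) * ℓ) * ζ j) := by
    ext i j
    have := gs_exp_eq α γ hα hγ (e j).1 (e j).2 i.2
    simp only [RingHom.mapMatrix_apply, Matrix.map_apply, M, Matrix.of_apply, map_mul, map_pow,
      map_add, map_natCast]
    show _ * (α ^ _ * γ ^ _) ^ _ = _
    rw [this]
    rfl
  have hdet : φ M.det = (Matrix.of fun (i j : Fin (n ^ 4) × Fin (n ^ 2)) => ζ j ^ (i.1 : ℕ) *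
      Real.exp (((i.2 : ℕ) * ℓ) * ζ j)).det := by
    rw [RingHom.map_det, hφM]
  have hdet0 : M.det ≠ 0 := by
    intro h
    rw [h, map_zero] at hdet
    exact gs_det_ne_zero _ _ ℓ hℓ.ne' ζ hζ hdet.symm
  have hn3 : 1 ≤ n ^ 3 := Nat.one_le_pow _ _ hn
  refine ⟨|φ M.det|, abs_nonneg _, ?_, ?_⟩
  · have := gs_lower σ₀ M c hc (n ^ 4 + 2 * (n ^ 2 * n ^ 3))
      (fun i j => gs_entry_integral a b g c (hcint a (by simp)) (hcint b (by simp))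
        (hcint g (by simp)) _ _ _ _ _ _ _ i.1.2.le i.2.2.le (e j).1.2.le (e j).2.2.le)
      ((2 * ((n ^ 3 : ℕ) : ℝ) * A) ^ (n ^ 4) * (A ^ (2 * n ^ 3)) ^ (n ^ 2))
      (fun σ i j => by
        simp only [M, Matrix.of_apply, map_mul, map_pow, map_add, map_natCast]
        refine gs_entry_norm _ _ _ A ?_ ?_ ?_ ?_ _ _ _ _ _ _ _ i.1.2.le i.2.2.le
          (e j).1.2.le (e j).2.2.le hn3
        · simp only [A]; linarith
        · refine (NumberField.norm_embedding_le_house _ σ).trans ?_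
          simp only [A]; linarith
        · refine (NumberField.norm_embedding_le_house _ σ).trans ?_
          simp only [A]; linarith
        · refine (NumberField.norm_embedding_le_house _ σ).trans ?_
          simp only [A]; linarith) hdet0
    have hnorm : ‖σ₀ M.det‖ = |φ M.det| := by
      show ‖((φ M.det : ℝ) : ℂ)‖ = _
      rw [Complex.norm_real, Real.norm_eq_abs]
    rw [hcard, hnorm] at this
    exact this
  · rw [hdet]
    have hT0 : (0 : ℝ) ≤ ((n ^ 3 : ℕ) : ℝ) * (1 + t) := by positivity
    have h1T : 1 ≤ 4 * (((n ^ 3 : ℕ) : ℝ) * (1 + t)) := by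
      have : (1 : ℝ) ≤ ((n ^ 3 : ℕ) : ℝ) := by exact_mod_cast hn3
      nlinarith
    have := gs_det_upper (fun i : Fin (n ^ 4) × Fin (n ^ 2) => (i.1 : ℕ))
      (fun i => ((i.2 : ℕ) : ℝ) * ℓ) (fun i => by positivity) ζ (((n ^ 3 : ℕ) : ℝ) * (1 + t)) 4 hT0
      (fun j => by
        have h1 : (((e j).1 : ℕ) : ℝ) ≤ ((n ^ 3 : ℕ) : ℝ) := by exact_mod_cast (e j).1.2.le
        have h2 : (((e j).2 : ℕ) : ℝ) ≤ ((n ^ 3 : ℕ) : ℝ) := by exact_mod_cast (e j).2.2.le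
        rw [abs_of_nonneg (by simp only [ζ]; positivity)]
        simp only [ζ]
        nlinarith) (by norm_num)
    rw [hcard] at this
    refine this.trans ?_
    refine mul_le_mul_of_nonneg_left ?_ (by positivity)
    refine (Finset.prod_le_prod (g := fun _ => (4 * (((n ^ 3 : ℕ) : ℝ) * (1 + t))) ^ (n ^ 4) *
      Real.exp (((n ^ 2 : ℕ) : ℝ) * ℓ * (4 * (((n ^ 3 : ℕ) : ℝ) * (1 + t)))))
      (fun i _ => by positivity) fun i _ => ?_).trans ?_
    · refine mul_le_mul (pow_le_pow_right₀ h1T i.1.2.le) (Real.exp_le_exp.2 ?_) (Real.exp_pos _).le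
        (by positivity)
      have : ((i.2 : ℕ) : ℝ) ≤ ((n ^ 2 : ℕ) : ℝ) := by exact_mod_cast i.2.2.le
      gcongr
    · rw [Finset.prod_const, Finset.card_univ, hcard]

/-- If `λ₁, …, λ_d` (d ≥ 2) are real algebraic numbers, each `> 1`, pairwise
multiplicatively independent but such that every triple is multiplicatively
dependent, then `1/log λ₁, …, 1/log λ_d` are linearly independent over `ℚ`. -/
theorem inv_log_linear_independent
    (d : ℕ) (hd : 2 ≤ d) (lam : Fin d → ℝ)
    (halg : ∀ i, IsAlgebraic ℚ (lam i))
    (hgt : ∀ i, 1 < lam i)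
    (hpair : ∀ i j, i ≠ j → ∀ a b : ℤ, lam i ^ a * lam j ^ b = 1 → a = 0 ∧ b = 0)
    (htriple : ∀ i j k, i ≠ j → j ≠ k → i ≠ k →
      ∃ a b c : ℤ, (a, b, c) ≠ (0, 0, 0) ∧ lam i ^ a * lam j ^ b * lam k ^ c = 1) :
    ∀ q : Fin d → ℚ, (∑ i, (q i : ℝ) / Real.log (lam i)) = 0 → ∀ i, q i = 0 := by
  intro q hq i
  have hpos : ∀ k, 0 < lam k := fun k => lt_trans one_pos (hgt k)
  have hlog : ∀ k, 0 < Real.log (lam k) := fun k => Real.log_pos (hgt k)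
  -- additive form of pairwise independence
  have hpair' : ∀ i j, i ≠ j → ∀ a b : ℤ,
      (a : ℝ) * Real.log (lam i) + b * Real.log (lam j) = 0 → a = 0 ∧ b = 0 := by
    intro i j hij a b h
    refine hpair i j hij a b ?_
    apply Real.log_injOn_pos (Set.mem_Ioi.2 (mul_pos (zpow_pos (hpos i) _) (zpow_pos (hpos j) _)))
      (Set.mem_Ioi.2 one_pos)
    rw [Real.log_mul (zpow_pos (hpos i) _).ne' (zpow_pos (hpos j) _).ne', Real.log_zpow,
      Real.log_zpow, h, Real.log_one]
  obtain ⟨j, hj⟩ : ∃ j : Fin d, j ≠ i := by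
    have : Nontrivial (Fin d) := Fin.nontrivial_iff_two_le.2 hd
    exact exists_ne i
  set t := Real.log (lam i) / Real.log (lam j) with ht
  have hirr : Irrational t := by
    rintro ⟨r, hr⟩
    have h1 : (r : ℝ) = r.num / r.den := by exact_mod_cast (Rat.num_div_den r).symm
    have hden : (r.den : ℝ) ≠ 0 := by exact_mod_cast r.den_nz
    rw [ht, h1, div_eq_div_iff hden (hlog j).ne'] at hr
    have := hpair' j i hj r.num (-r.den) (by push_cast; linarith)
    exact r.den_nz (by have := this.2; omega)
  have htr : Transcendental ℚ t := gs_real _ _ (hgt j) (hgt i) (halg j) (halg i) hirr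
  -- each log as a rational combination
  have hrep : ∀ k, ∃ a b : ℚ, (k ≠ i → a ≠ 0) ∧ (k = i → a = 0) ∧
      Real.log (lam k) = Real.log (lam j) * (a + b * t) := by
    intro k
    have htj : Real.log (lam j) * t = Real.log (lam i) := by
      rw [ht]; field_simp [(hlog j).ne']
    by_cases hki : k = i
    · subst hki
      exact ⟨0, 1, by simp, by simp, by simp [htj]⟩
    by_cases hkj : k = j
    · subst hkj
      exact ⟨1, 0, by simp, by simp [hki], by simp⟩
    obtain ⟨a, b, c, hne, hrel⟩ := htriple j i k hj (Ne.symm hki) (Ne.symm hkj)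
    have hrel' : (a : ℝ) * Real.log (lam j) + b * Real.log (lam i) + c * Real.log (lam k) = 0 := by
      have := congrArg Real.log hrel
      rw [Real.log_mul (mul_pos (zpow_pos (hpos j) _) (zpow_pos (hpos i) _)).ne'
        (zpow_pos (hpos k) _).ne', Real.log_mul (zpow_pos (hpos j) _).ne'
        (zpow_pos (hpos i) _).ne', Real.log_zpow, Real.log_zpow, Real.log_zpow, Real.log_one] at this
      exact this
    have hc : c ≠ 0 := by
      rintro rfl
      have := hpair' j i hj a b (by simpa using hrel')
      exact hne (by rw [this.1, this.2])
    have ha : a ≠ 0 := by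
      rintro rfl
      have := hpair' i k (Ne.symm hki) b c (by simpa using hrel')
      exact hc this.2
    have hcR : (c : ℝ) ≠ 0 := by exact_mod_cast hc
    refine ⟨-a / c, -b / c, fun _ => ?_, fun h => absurd h hki, ?_⟩
    · have : (a : ℚ) ≠ 0 := by exact_mod_cast ha
      have h2 : (c : ℚ) ≠ 0 := by exact_mod_cast hc
      exact div_ne_zero (neg_ne_zero.2 this) h2
    · push_cast
      have : Real.log (lam j) * (-(a : ℝ) / c + -(b : ℝ) / c * t) =
          (-(a * Real.log (lam j)) - b * (Real.log (lam j) * t)) / c := by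
        field_simp
        ring
      rw [this, htj, eq_div_iff hcR]
      linarith
  choose a b ha ha0 hab using hrep
  have hne : ∀ k, (a k : ℝ) + b k * t ≠ 0 := by
    intro k h
    have := hab k
    rw [h, mul_zero] at this
    exact (hlog k).ne' this
  let P : Polynomial ℚ := ∑ k, Polynomial.C (q k) *
    ∏ m ∈ Finset.univ.erase k, (Polynomial.C (a m) + Polynomial.C (b m) * Polynomial.X)
  have hPt : Polynomial.aeval t P = 0 := by
    have h1 : Polynomial.aeval t P = ∑ k, (q k : ℝ) *
        ∏ m ∈ Finset.univ.erase k, ((a m : ℝ) + b m * t) := by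
      simp [P, map_sum, map_prod]
    have h2 : ∀ k, (q k : ℝ) * ∏ m ∈ Finset.univ.erase k, ((a m : ℝ) + b m * t) =
        (Real.log (lam j) * ∏ m, ((a m : ℝ) + b m * t)) * ((q k : ℝ) / Real.log (lam k)) := by
      intro k
      rw [← Finset.mul_prod_erase Finset.univ _ (Finset.mem_univ k), hab k]
      have := hne k
      have := (hlog j).ne'
      generalize ∏ m ∈ Finset.univ.erase k, ((a m : ℝ) + b m * t) = W
      generalize (a k : ℝ) + b k * t = V at *
      field_simp
    rw [h1, Finset.sum_congr rfl fun k _ => h2 k, ← Finset.mul_sum, hq, mul_zero]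
  have hP : P = 0 := by
    by_contra h
    exact htr ⟨P, h, hPt⟩
  have hev := congrArg (Polynomial.eval 0) hP
  simp only [P, Polynomial.eval_finsetSum, Polynomial.eval_mul, Polynomial.eval_C,
    Polynomial.eval_prod, Polynomial.eval_add, Polynomial.eval_X, mul_zero, add_zero,
    Polynomial.eval_zero] at hev
  rw [Finset.sum_eq_single i] at hev
  · rcases mul_eq_zero.1 hev with h | h
    · exact h
    · obtain ⟨m, hm, hm0⟩ := Finset.prod_eq_zero_iff.1 h
      exact absurd hm0 (ha m (Finset.ne_of_mem_erase hm))
  · intro k _ hk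
    rw [Finset.prod_eq_zero (Finset.mem_erase.2 ⟨Ne.symm hk, Finset.mem_univ i⟩) (ha0 i rfl),
      mul_zero]
  · simp
end
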